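/- For every T > 0 there is a constant M(T), depending only on T (and the standing assumptions), such that sup_{0≤t≤T} ∫_{ℝ²}(1+|x|²)|u(x,t)|²dx ≤ M(T)ε₀. -/

import Mathlib

open MeasureTheory Filter

noncomputable section

/-- Points/vectors in the plane, with Lebesgue measure. -/
abbrev V : Type := Fin 2 → ℝ

/-- 2×2 real matrices realized as nested functions. -/
abbrev M2 : Type := Fin 2 → Fin 2 → ℝ

/-- Partial derivative in the `i`-th coordinate direction. -/
def pd (i : Fin 2) (f : V → ℝ) (x : V) : ℝ :=
  fderiv ℝ f x (Pi.single i 1)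

/-- Laplacian of a scalar field. -/
def lap (f : V → ℝ) (x : V) : ℝ := ∑ i, pd i (pd i f) x

/-- Spatial gradient of a vector field: `(∇u)_{ij} = ∂_j u_i`. -/
def gradU (u : V → V) (x : V) : M2 := fun i j => pd j (fun y => u y i) x

/-- Divergence of a vector field. -/
def divV (u : V → V) (x : V) : ℝ := ∑ i, pd i (fun y => u y i) x

/-- Squared Frobenius norm of a 2×2 matrix. -/
def nsq (A : M2) : ℝ := ∑ i, ∑ j, (A i j) ^ 2

/-- Squared Euclidean norm of a vector in the plane. -/
def vnsq (v : V) : ℝ := ∑ i, (v i) ^ 2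

/-- The identity matrix. -/
def idM : M2 := fun i j => if i = j then 1 else 0

/-- The weight `σ(t) = min{1,t}`. -/
def sg (t : ℝ) : ℝ := min 1 t

/-- The material derivative `u̇ = ∂ₜ u + (u·∇)u`. -/
def mdot (u : ℝ → V → V) (t : ℝ) (x : V) : V :=
  fun i => deriv (fun s => u s x i) t + ∑ j, u t x j * pd j (fun y => u t y i) x

/-- `ε₀ = ‖F₀ − I‖²_{L^∞} + ∫ (|F₀ − I|² + |u₀|²)(1+|x|²) dx`. -/
def eps0 (u0 : V → V) (F0 : V → M2) : ℝ :=
  (⨆ x : V, nsq (F0 x - idM)) +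
    ∫ x : V, (nsq (F0 x - idM) + vnsq (u0 x)) * (1 + vnsq x)

/-- The incompressible viscoelastic system on the time interval `[0,T]`:
momentum equation, deformation-gradient transport equation, and `div u = 0`. -/
def IsSolution (u : ℝ → V → V) (F : ℝ → V → M2) (P : ℝ → V → ℝ) (T : ℝ) : Prop :=
  (∀ t ∈ Set.Icc (0:ℝ) T, ∀ (x : V) (i : Fin 2),
      deriv (fun s => u s x i) t + (∑ j, u t x j * pd j (fun y => u t y i) x)
        - lap (fun y => u t y i) x + pd i (P t) x
        = ∑ j, pd j (fun y => ∑ k, F t y i k * F t y j k) x) ∧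
  (∀ t ∈ Set.Icc (0:ℝ) T, ∀ (x : V) (i j : Fin 2),
      deriv (fun s => F s x i j) t + (∑ k, u t x k * pd k (fun y => F t y i j) x)
        = ∑ k, pd k (fun y => u t y i) x * F t x k j) ∧
  (∀ t ∈ Set.Icc (0:ℝ) T, ∀ x : V, divV (u t) x = 0)

/-- The quantity `A(T)` (with `w = 𝒫u̇` the Leray projection of the material
derivative, given as a separate argument). -/
def Afun (u : ℝ → V → V) (F : ℝ → V → M2) (w : ℝ → V → V) (T : ℝ) : ℝ :=
  (⨆ t ∈ Set.Icc (0:ℝ) T, ∫ x : V,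
      (vnsq (u t x) + nsq (F t x - idM) + sg t * nsq (gradU (u t) x)
        + (sg t) ^ 2 * vnsq (w t x))) +
  ∫ t in Set.Ioc (0:ℝ) T, ∫ x : V,
      (nsq (gradU (u t) x) + sg t * vnsq (mdot u t x)
        + (sg t) ^ 2 * nsq (gradU (w t) x))

/-- The quantity `B(T) = ‖F − I‖²_{L^∞(ℝ²×[0,T])}`. -/
def Bfun (F : ℝ → V → M2) (T : ℝ) : ℝ :=
  ⨆ t ∈ Set.Icc (0:ℝ) T, ⨆ x : V, nsq (F t x - idM)

open scoped ContDiff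

section Calculus

theorem contDiff_pd {f : V → ℝ} (hf : ContDiff ℝ ∞ f) (i : Fin 2) : ContDiff ℝ ∞ (pd i f) := by
  have h : ContDiff ℝ ∞ (fderiv ℝ f) := hf.fderiv_right (by simp)
  exact h.clm_apply contDiff_const

theorem pd_add {f g : V → ℝ} {x : V} (hf : DifferentiableAt ℝ f x)
    (hg : DifferentiableAt ℝ g x) (i : Fin 2) :
    pd i (fun y => f y + g y) x = pd i f x + pd i g x := by
  simp [pd, fderiv_fun_add hf hg]

theorem pd_sub {f g : V → ℝ} {x : V} (hf : DifferentiableAt ℝ f x)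
    (hg : DifferentiableAt ℝ g x) (i : Fin 2) :
    pd i (fun y => f y - g y) x = pd i f x - pd i g x := by
  simp [pd, fderiv_fun_sub hf hg]

theorem pd_mul {f g : V → ℝ} {x : V} (hf : DifferentiableAt ℝ f x)
    (hg : DifferentiableAt ℝ g x) (i : Fin 2) :
    pd i (fun y => f y * g y) x = f x * pd i g x + g x * pd i f x := by
  simp [pd, fderiv_fun_mul hf hg]

theorem pd_const (c : ℝ) (i : Fin 2) (x : V) : pd i (fun _ => c) x = 0 := by
  simp [pd]

theorem pd_coord (i j : Fin 2) (x : V) :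
    pd i (fun y => y j) x = if i = j then 1 else 0 := by
  have : HasFDerivAt (fun y : V => y j) (ContinuousLinearMap.proj (R := ℝ) (φ := fun _ => ℝ) j) x :=
    hasFDerivAt_apply j x
  rw [pd, this.fderiv]
  simp [Pi.single_apply, eq_comm]

theorem pd_comp {L : ℝ → ℝ} {f : V → ℝ} {x : V} (hL : DifferentiableAt ℝ L (f x))
    (hf : DifferentiableAt ℝ f x) (i : Fin 2) :
    pd i (fun y => L (f y)) x = deriv L (f x) * pd i f x := by
  have := (hL.hasDerivAt.comp_hasFDerivAt x hf.hasFDerivAt).fderiv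
  simp only [Function.comp_def] at this
  simp [pd, this]

theorem pd_comm {f : V → ℝ} (hf : ContDiff ℝ ∞ f) (i j : Fin 2) (x : V) :
    pd i (pd j f) x = pd j (pd i f) x := by
  have h2 : DifferentiableAt ℝ (fderiv ℝ f) x :=
    (hf.fderiv_right (m := ∞) (by simp)).differentiable (by simp) x
  have hs : IsSymmSndFDerivAt ℝ f x :=
    hf.contDiffAt.isSymmSndFDerivAt (by
      simpa using (WithTop.coe_le_coe.2 le_top : ((2 : ℕ∞) : WithTop ℕ∞) ≤ ∞))
  have key : ∀ a b : Fin 2, pd a (pd b f) x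
      = fderiv ℝ (fderiv ℝ f) x (Pi.single a 1) (Pi.single b 1) := by
    intro a b
    unfold pd
    rw [fderiv_clm_apply h2 (differentiableAt_const _)]
    simp
  rw [key, key, hs.eq]

theorem continuous_pd {f : V → ℝ} (hf : ContDiff ℝ ∞ f) (i : Fin 2) : Continuous (pd i f) :=
  (contDiff_pd hf i).continuous

theorem pd_eq_zero_of_notMem {f : V → ℝ} {x : V} (hx : x ∉ tsupport f) (i : Fin 2) :
    pd i f x = 0 := by
  have : fderiv ℝ f x = 0 := by
    by_contra h
    exact hx (support_fderiv_subset ℝ h)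
  simp [pd, this]

theorem hasCompactSupport_pd {f : V → ℝ} (hf : HasCompactSupport f) (i : Fin 2) :
    HasCompactSupport (pd i f) :=
  hf.mono' fun x hx => by
    by_contra h
    exact hx (pd_eq_zero_of_notMem h i)

theorem integral_pd_eq_zero {f : V → ℝ} (hf : Differentiable ℝ f) (h : Integrable f) (i : Fin 2)
    (h' : Integrable (pd i f)) : ∫ x, pd i f x = 0 := by
  have := integral_mul_fderiv_eq_neg_fderiv_mul_of_integrable (𝕜 := ℝ) (μ := (volume : Measure V))
    (f := fun _ => (1 : ℝ)) (g := f) (v := Pi.single i 1) (by simp) (by simpa using! h')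
    (by simpa using h) (by simp) (fun x _ => hf x)
  simpa using! this

theorem integral_mul_pd {f g : V → ℝ} (hf : ContDiff ℝ ∞ f) (hg : ContDiff ℝ ∞ g)
    (hc : HasCompactSupport g) (i : Fin 2) :
    ∫ x, f x * pd i g x = - ∫ x, pd i f x * g x :=
  integral_mul_fderiv_eq_neg_fderiv_mul_of_integrable (𝕜 := ℝ)
    (((continuous_pd hf i).mul hg.continuous).integrable_of_hasCompactSupport hc.mul_left)
    ((hf.continuous.mul (continuous_pd hg i)).integrable_of_hasCompactSupport
      (hasCompactSupport_pd hc i).mul_left)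
    ((hf.continuous.mul hg.continuous).integrable_of_hasCompactSupport hc.mul_left)
    (fun x _ => hf.differentiable (by simp) x) (fun x _ => hg.differentiable (by simp) x)

theorem contDiff_slice {h : ℝ → V → ℝ} (hh : ContDiff ℝ ∞ (Function.uncurry h)) (t : ℝ) :
    ContDiff ℝ ∞ (h t) :=
  hh.comp (contDiff_const.prodMk contDiff_id)

theorem contDiff_pd_uncurry {h : ℝ → V → ℝ} (hh : ContDiff ℝ ∞ (Function.uncurry h)) (j : Fin 2) :
    ContDiff ℝ ∞ (Function.uncurry fun t => pd j (h t)) := by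
  have h1 : (Function.uncurry fun t => pd j (h t))
      = fun p : ℝ × V => fderiv ℝ (Function.uncurry h) p (0, Pi.single j 1) := by
    funext p
    obtain ⟨t, x⟩ := p
    have h2 : HasFDerivAt (h t) _ x :=
      ((hh.differentiable (by simp) (t, x)).hasFDerivAt).comp x
        ((hasFDerivAt_const t x).prodMk (hasFDerivAt_id x))
    simp [Function.uncurry, pd, h2.fderiv]
  rw [h1]
  exact (hh.fderiv_right (m := ∞) (by simp)).clm_apply contDiff_const

theorem contDiff_deriv_uncurry {h : ℝ → V → ℝ} (hh : ContDiff ℝ ∞ (Function.uncurry h)) :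
    ContDiff ℝ ∞ (Function.uncurry fun t x => deriv (fun s => h s x) t) := by
  have h1 : (Function.uncurry fun t x => deriv (fun s => h s x) t)
      = fun p : ℝ × V => fderiv ℝ (Function.uncurry h) p (1, 0) := by
    funext p
    obtain ⟨t, x⟩ := p
    have h2 : HasDerivAt (fun s => h s x) _ t :=
      HasFDerivAt.comp_hasDerivAt (f := fun s : ℝ => (s, x)) t
        ((hh.differentiable (by simp) (t, x)).hasFDerivAt)
        ((hasDerivAt_id t).prodMk (hasDerivAt_const t x))
    simp [Function.uncurry, h2.deriv]
  rw [h1]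
  exact (hh.fderiv_right (m := ∞) (by simp)).clm_apply contDiff_const

theorem differentiableAt_time {h : ℝ → V → ℝ} (hh : ContDiff ℝ ∞ (Function.uncurry h)) (x : V)
    (t : ℝ) : DifferentiableAt ℝ (fun s => h s x) t :=
  ((hh.comp (contDiff_id.prodMk (contDiff_const (c := x)))).differentiable (by simp)) t

theorem integrable_of_support {f : V → ℝ} (hf : Continuous f) {K : Set V} (hK : IsCompact K)
    (h : ∀ x, x ∉ K → f x = 0) : Integrable f :=
  hf.integrable_of_hasCompactSupport (HasCompactSupport.intro hK h)

theorem continuous_integral_of_support {X : Type*} [TopologicalSpace X]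
    [FirstCountableTopology X] [LocallyCompactSpace X] {h : X → V → ℝ}
    (hh : Continuous (Function.uncurry h))
    {K : Set V} (hK : IsCompact K) (hs : ∀ t x, x ∉ K → h t x = 0) :
    Continuous fun t => ∫ x, h t x := by
  have : (fun t => ∫ x, h t x) = fun t => ∫ x in K, h t x := by
    funext t
    exact (setIntegral_eq_integral_of_forall_compl_eq_zero (hs t)).symm
  rw [this]
  exact continuous_parametric_integral_of_continuous hh hK

theorem hasDerivAt_integral_of_support {h : ℝ → V → ℝ} (hh : ContDiff ℝ ∞ (Function.uncurry h))
    {K : Set V} (hK : IsCompact K) (hs : ∀ t x, x ∉ K → h t x = 0) (t : ℝ) :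
    HasDerivAt (fun t => ∫ x, h t x) (∫ x, deriv (fun s => h s x) t) t := by
  have hd := (contDiff_deriv_uncurry hh).continuous
  have hds : ∀ s x, x ∉ K → deriv (fun s => h s x) s = 0 := by
    intro s x hx
    have : (fun s => h s x) = fun _ => 0 := funext fun s => hs s x hx
    simp [this]
  obtain ⟨C, hC⟩ := ((isCompact_Icc (a := t - 1) (b := t + 1)).prod hK).exists_bound_of_continuousOn
    hd.continuousOn
  have hcs : ∀ s, Continuous (h s) := fun s =>
    hh.continuous.comp (by fun_prop : Continuous fun x : V => (s, x))
  refine (hasDerivAt_integral_of_dominated_loc_of_deriv_le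
    (F' := fun t x => deriv (fun s => h s x) t) (s := Set.Icc (t - 1) (t + 1))
    (bound := K.indicator fun _ => C) (Icc_mem_nhds (by linarith) (by linarith)) ?_ ?_ ?_ ?_ ?_ ?_).2
  · exact Eventually.of_forall fun s => (hcs s).aestronglyMeasurable
  · exact integrable_of_support (hcs t) hK (hs t)
  · exact (hd.comp (by fun_prop : Continuous fun x : V => (t, x))).aestronglyMeasurable
  · refine Eventually.of_forall fun x s hst => ?_
    by_cases hx : x ∈ K
    · simpa [hx] using hC (s, x) ⟨hst, hx⟩
    · simp [hx, hds s x hx]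
  · exact (integrable_indicator_iff hK.measurableSet).2
      (integrableOn_const hK.measure_lt_top.ne)
  · exact Eventually.of_forall fun x s _ => (differentiableAt_time hh x s).hasDerivAt

theorem integral_deriv_of_support {h : ℝ → V → ℝ} (hh : ContDiff ℝ ∞ (Function.uncurry h))
    {K : Set V} (hK : IsCompact K) (hs : ∀ t x, x ∉ K → h t x = 0) (a b : ℝ) :
    ∫ t in a..b, (∫ x, deriv (fun s => h s x) t) = (∫ x, h b x) - ∫ x, h a x := by
  have hds : ∀ s x, x ∉ K → deriv (fun s => h s x) s = 0 := by
    intro s x hx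
    have : (fun s => h s x) = fun _ => 0 := funext fun s => hs s x hx
    simp [this]
  refine intervalIntegral.integral_eq_sub_of_hasDerivAt
    (fun t _ => hasDerivAt_integral_of_support hh hK hs t) (Continuous.intervalIntegrable ?_ _ _)
  exact continuous_integral_of_support (contDiff_deriv_uncurry hh).continuous hK hds

theorem sq_integral_mul_le {α : Type*} [MeasurableSpace α] {μ : Measure α} {f g : α → ℝ}
    (hf : AEStronglyMeasurable f μ) (hg : AEStronglyMeasurable g μ)
    (hf2 : Integrable (fun x => f x ^ 2) μ) (hg2 : Integrable (fun x => g x ^ 2) μ) :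
    Integrable (fun x => f x * g x) μ ∧
      ∫ x, |f x * g x| ∂μ ≤ √(∫ x, f x ^ 2 ∂μ) * √(∫ x, g x ^ 2 ∂μ) := by
  have hi : Integrable (fun x => f x * g x) μ := by
    refine (hf2.add hg2).mono' (hf.mul hg) (Eventually.of_forall fun x => ?_)
    simp only [Pi.add_apply, Real.norm_eq_abs, abs_le]
    constructor <;>
      nlinarith [sq_nonneg (f x + g x), sq_nonneg (f x - g x), sq_nonneg (f x), sq_nonneg (g x)]
  refine ⟨hi, ?_⟩
  have h := integral_mul_le_Lp_mul_Lq_of_nonneg (μ := μ) Real.HolderConjugate.two_two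
    (f := fun x => |f x|) (g := fun x => |g x|) (Eventually.of_forall fun x => abs_nonneg _)
    (Eventually.of_forall fun x => abs_nonneg _)
    (by
      have := (memLp_two_iff_integrable_sq hf).2 hf2
      norm_num
      exact this.abs)
    (by
      have := (memLp_two_iff_integrable_sq hg).2 hg2
      norm_num
      exact this.abs)
  simp only [abs_mul, Real.sqrt_eq_rpow]
  simpa [sq_abs] using h

end Calculus

section Convolution

/-- The convolution of two scalar functions on the plane. -/
def cv (f k : V → ℝ) (x : V) : ℝ := ∫ y, f y * k (x - y)

theorem cv_eq_convolution (f k : V → ℝ) :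
    cv f k = convolution f k (ContinuousLinearMap.mul ℝ ℝ) volume := rfl

theorem cv_comm (f k : V → ℝ) : cv f k = cv k f := by
  funext x
  rw [cv_eq_convolution, convolution_eq_swap]
  simp [cv, mul_comm]

theorem contDiff_cv {f k : V → ℝ} (hf : Continuous f) (hk : ContDiff ℝ ∞ k)
    (hck : HasCompactSupport k) : ContDiff ℝ ∞ (cv f k) :=
  hck.contDiff_convolution_right (μ := volume) (ContinuousLinearMap.mul ℝ ℝ)
    hf.locallyIntegrable hk

theorem hasCompactSupport_cv {f k : V → ℝ} (hf : HasCompactSupport f)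
    (hk : HasCompactSupport k) : HasCompactSupport (cv f k) := by
  rw [cv_eq_convolution]
  exact HasCompactSupport.convolution (μ := volume) (ContinuousLinearMap.mul ℝ ℝ) hf hk

theorem pd_cv {f k : V → ℝ} (hf : Continuous f) (hk : ContDiff ℝ ∞ k)
    (hck : HasCompactSupport k) (i : Fin 2) : pd i (cv f k) = cv f (pd i k) := by
  funext x
  have h := hck.hasFDerivAt_convolution_right (μ := volume) (ContinuousLinearMap.mul ℝ ℝ)
    hf.locallyIntegrable (hk.of_le (by simp)) x
  rw [pd, cv_eq_convolution, h.fderiv, convolution_precompR_apply _ hf.locallyIntegrable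
    (hck.fderiv ℝ) (hk.continuous_fderiv (by simp))]
  rfl

theorem cv_pd {f k : V → ℝ} (hf : ContDiff ℝ ∞ f) (hcf : HasCompactSupport f)
    (hk : ContDiff ℝ ∞ k) (hck : HasCompactSupport k) (i : Fin 2) :
    cv (pd i f) k = cv f (pd i k) := by
  rw [← pd_cv hf.continuous hk hck, cv_comm f k, pd_cv hk.continuous hf hcf, cv_comm]

theorem integrable_cv_integrand {f k : V → ℝ} (hf : Continuous f) (hcf : HasCompactSupport f)
    (hk : Continuous k) (x : V) : Integrable fun y => f y * k (x - y) :=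
  (hf.mul (by fun_prop)).integrable_of_hasCompactSupport hcf.mul_right

theorem cv_add_right {f k l : V → ℝ} (hf : Continuous f) (hcf : HasCompactSupport f)
    (hk : Continuous k) (hl : Continuous l) (x : V) :
    cv f (fun y => k y + l y) x = cv f k x + cv f l x := by
  simp only [cv, mul_add]
  exact integral_add (integrable_cv_integrand hf hcf hk x) (integrable_cv_integrand hf hcf hl x)

theorem cv_sub_right {f k l : V → ℝ} (hf : Continuous f) (hcf : HasCompactSupport f)
    (hk : Continuous k) (hl : Continuous l) (x : V) :
    cv f (fun y => k y - l y) x = cv f k x - cv f l x := by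
  simp only [cv, mul_sub]
  exact integral_sub (integrable_cv_integrand hf hcf hk x) (integrable_cv_integrand hf hcf hl x)

theorem lap_cv {f k : V → ℝ} (hf : Continuous f) (hcf : HasCompactSupport f)
    (hk : ContDiff ℝ ∞ k) (hck : HasCompactSupport k) : lap (cv f k) = cv f (lap k) := by
  funext x
  simp only [lap, Fin.sum_univ_two]
  simp only [pd_cv hf hk hck, pd_cv hf (contDiff_pd hk _) (hasCompactSupport_pd hck _)]
  rw [← cv_add_right hf hcf (continuous_pd (contDiff_pd hk _) _)
    (continuous_pd (contDiff_pd hk _) _)]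
  congr 1
  funext y
  simp [lap]

/-- Young's inequality `L¹ * L² → L²`. -/
theorem integral_sq_cv_le {f k : V → ℝ} (hf : Continuous f) (hcf : HasCompactSupport f)
    (hk : Continuous k) (hck : HasCompactSupport k) :
    ∫ x, cv f k x ^ 2 ≤ (∫ x, |f x|) ^ 2 * ∫ x, k x ^ 2 := by
  have hfa : Continuous fun x => |f x| := hf.abs
  have hcfa : HasCompactSupport fun x => |f x| := hcf.comp_left abs_zero
  have hk2 : Continuous fun x => k x ^ 2 := hk.pow 2
  have hck2 : HasCompactSupport fun x => k x ^ 2 := hck.comp_left (g := fun r : ℝ => r ^ 2) (by simp)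
  have hpt : ∀ x, cv f k x ^ 2 ≤ (∫ y, |f y|) * cv (fun y => |f y|) (fun y => k y ^ 2) x := by
    intro x
    have e1 : ∀ y, √|f y| ^ 2 = |f y| := fun y => Real.sq_sqrt (abs_nonneg _)
    have h1 := sq_integral_mul_le (μ := (volume : Measure V)) (f := fun y => √|f y|)
      (g := fun y => √|f y| * k (x - y)) (by fun_prop) (by fun_prop)
      (by simpa only [e1] using hfa.integrable_of_hasCompactSupport hcfa)
      (by
        simp only [mul_pow, e1]
        exact integrable_cv_integrand hfa hcfa hk2 x)
    have h2 := h1.2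
    simp only [mul_pow, e1] at h2
    have h3 : |cv f k x| ≤ ∫ y, |√|f y| * (√|f y| * k (x - y))| := by
      refine (abs_integral_le_integral_abs).trans (le_of_eq ?_)
      congr 1
      funext y
      rw [← mul_assoc, ← sq, e1, abs_mul, abs_mul, abs_abs]
    have n1 : 0 ≤ ∫ y, |f y| := integral_nonneg fun y => abs_nonneg _
    have n2 : 0 ≤ ∫ y, |f y| * k (x - y) ^ 2 :=
      integral_nonneg fun y => mul_nonneg (abs_nonneg _) (sq_nonneg _)
    calc cv f k x ^ 2 = |cv f k x| ^ 2 := (sq_abs _).symm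
      _ ≤ (√(∫ y, |f y|) * √(∫ y, |f y| * k (x - y) ^ 2)) ^ 2 := by
        gcongr
        exact h3.trans h2
      _ = _ := by rw [mul_pow, Real.sq_sqrt n1, Real.sq_sqrt n2]; rfl
  have hintg : Integrable (cv (fun y => |f y|) (fun y => k y ^ 2)) :=
    (hfa.integrable_of_hasCompactSupport hcfa).integrable_convolution
      (ContinuousLinearMap.mul ℝ ℝ) (hk2.integrable_of_hasCompactSupport hck2)
  have hI : ∫ x, cv (fun y => |f y|) (fun y => k y ^ 2) x = (∫ x, |f x|) * ∫ x, k x ^ 2 :=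
    integral_convolution (ContinuousLinearMap.mul ℝ ℝ)
      (hfa.integrable_of_hasCompactSupport hcfa) (hk2.integrable_of_hasCompactSupport hck2)
  calc ∫ x, cv f k x ^ 2
      ≤ ∫ x, (∫ y, |f y|) * cv (fun y => |f y|) (fun y => k y ^ 2) x :=
        integral_mono_of_nonneg (Eventually.of_forall fun x => sq_nonneg _) (hintg.const_mul _)
          (Eventually.of_forall hpt)
    _ = _ := by rw [integral_const_mul, hI]; ring

end Convolution

section Kernel

/-- The rescaling `x ↦ s⁻² k(x / s)`, preserving the integral. -/
def rescale (s : ℝ) (k : V → ℝ) (x : V) : ℝ := s⁻¹ ^ 2 * k (s⁻¹ • x)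

theorem contDiff_rescale {k : V → ℝ} (hk : ContDiff ℝ ∞ k) (s : ℝ) :
    ContDiff ℝ ∞ (rescale s k) :=
  contDiff_const.mul (hk.comp (by fun_prop : ContDiff ℝ ∞ fun x : V => s⁻¹ • x))

theorem hasCompactSupport_rescale {k : V → ℝ} (hk : HasCompactSupport k) {s : ℝ} (hs : 0 < s) :
    HasCompactSupport (rescale s k) :=
  (hk.comp_smul (inv_ne_zero hs.ne')).mul_left

theorem pd_rescale {k : V → ℝ} (hk : ContDiff ℝ ∞ k) (s : ℝ) (i : Fin 2) :
    pd i (rescale s k) = fun x => s⁻¹ * rescale s (pd i k) x := by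
  funext x
  have h : HasFDerivAt (rescale s k)
      (s⁻¹ ^ 2 • ((fderiv ℝ k (s⁻¹ • x)).comp (s⁻¹ • ContinuousLinearMap.id ℝ V))) x :=
    (((hk.differentiable (by simp) (s⁻¹ • x)).hasFDerivAt).comp x
      ((hasFDerivAt_id x).const_smul s⁻¹)).const_mul (s⁻¹ ^ 2)
  simp only [pd, h.fderiv, rescale]
  simp
  ring

theorem integral_rescale (k : V → ℝ) {s : ℝ} (hs : 0 < s) :
    ∫ x, rescale s k x = ∫ x, k x := by
  simp only [rescale]
  rw [integral_const_mul, Measure.integral_comp_inv_smul_of_nonneg _ _ hs.le]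
  simp
  field_simp

theorem integral_rescale_sq (k : V → ℝ) {s : ℝ} (hs : 0 < s) :
    ∫ x, rescale s k x ^ 2 = s⁻¹ ^ 2 * ∫ x, k x ^ 2 := by
  have h : ∀ x, rescale s k x ^ 2 = s⁻¹ ^ 2 * rescale s (fun y => k y ^ 2) x := by
    intro x
    simp only [rescale]
    ring
  simp only [h]
  rw [integral_const_mul, integral_rescale _ hs]

theorem integral_abs_rescale (k : V → ℝ) {s : ℝ} (hs : 0 < s) :
    ∫ x, |rescale s k x| = ∫ x, |k x| := by
  rw [← integral_rescale (fun x => |k x|) hs]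
  congr 1
  funext x
  simp only [rescale, abs_mul, abs_pow, sq_abs]

/-- A smooth nondecreasing step from `0` (on `r ≤ 1/2`) to `1` (on `1 ≤ r`). -/
def step (r : ℝ) : ℝ := Real.smoothTransition (2 * r - 1)

theorem contDiff_step : ContDiff ℝ ∞ step :=
  Real.smoothTransition.contDiff.comp (by fun_prop)

theorem step_of_le {r : ℝ} (h : r ≤ 1 / 2) : step r = 0 :=
  Real.smoothTransition.zero_of_nonpos (by linarith)

theorem step_of_ge {r : ℝ} (h : 1 ≤ r) : step r = 1 :=
  Real.smoothTransition.one_of_one_le (by linarith)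

theorem step_mono : Monotone step := fun a b h =>
  Real.smoothTransition.monotone (by linarith)

theorem deriv_step_nonneg (r : ℝ) : 0 ≤ deriv step r := step_mono.deriv_nonneg

theorem deriv_step_of_gt {r : ℝ} (h : 1 < r) : deriv step r = 0 := by
  have : step =ᶠ[nhds r] fun _ => 1 := by
    filter_upwards [Ioi_mem_nhds h] with y hy using step_of_ge (le_of_lt hy)
  simp [this.deriv_eq]

theorem contDiff_deriv_step : ContDiff ℝ ∞ (deriv step) :=
  (contDiff_infty_iff_deriv.1 contDiff_step).2

theorem contDiff_vnsq : ContDiff ℝ ∞ vnsq := by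
  unfold vnsq
  fun_prop

theorem vnsq_nonneg (x : V) : 0 ≤ vnsq x := Finset.sum_nonneg fun _ _ => sq_nonneg _

theorem hasCompactSupport_of_vnsq {f : V → ℝ} (R : ℝ) (h : ∀ x, R < vnsq x → f x = 0) :
    HasCompactSupport f := by
  refine HasCompactSupport.intro (isCompact_closedBall (0 : V) (√R)) fun x hx => h x ?_
  by_contra hR
  push Not at hR
  apply hx
  rw [mem_closedBall_zero_iff, pi_norm_le_iff_of_nonneg (Real.sqrt_nonneg _)]
  intro i
  rw [Real.norm_eq_abs]
  apply Real.abs_le_sqrt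
  refine le_trans ?_ hR
  exact Finset.single_le_sum (f := fun i => x i ^ 2) (fun _ _ => sq_nonneg _) (Finset.mem_univ i)

/-- A nonnegative radial bump. -/
def bump (x : V) : ℝ := 4 * deriv step (vnsq x)

theorem contDiff_bump : ContDiff ℝ ∞ bump :=
  contDiff_const.mul (contDiff_deriv_step.comp contDiff_vnsq)

theorem bump_nonneg (x : V) : 0 ≤ bump x := mul_nonneg (by norm_num) (deriv_step_nonneg _)

theorem hasCompactSupport_bump : HasCompactSupport bump :=
  hasCompactSupport_of_vnsq 1 fun x hx => by simp [bump, deriv_step_of_gt hx]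

theorem integral_bump_pos : 0 < ∫ x, bump x := by
  obtain ⟨c, hc, hc'⟩ := exists_deriv_eq_slope step (zero_lt_one' ℝ)
    contDiff_step.continuous.continuousOn (contDiff_step.differentiable (by simp)).differentiableOn
  rw [step_of_le (r := 0) (by norm_num), step_of_ge le_rfl] at hc'
  refine contDiff_bump.continuous.integral_pos_of_hasCompactSupport_nonneg_nonzero
    hasCompactSupport_bump bump_nonneg (x := ![√c, 0]) ?_
  have : vnsq ![√c, 0] = c := by simp [vnsq, Real.sq_sqrt hc.1.le]
  simp [bump, this, hc']

theorem pd_vnsq (i : Fin 2) (x : V) : pd i vnsq x = 2 * x i := by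
  have h : vnsq = fun x : V => x 0 * x 0 + x 1 * x 1 := by
    funext x
    simp [vnsq, sq]
  have d : ∀ j : Fin 2, DifferentiableAt ℝ (fun y : V => y j) x := fun j => by fun_prop
  rw [h, pd_add (by fun_prop) (by fun_prop), pd_mul (d 0) (d 0), pd_mul (d 1) (d 1),
    pd_coord, pd_coord]
  fin_cases i <;> simp <;> ring

/-- The radial profile `((step (r/ε²) - step (r/R²)) / r)`. -/
def profile (ε R r : ℝ) : ℝ := (step (r / ε ^ 2) - step (r / R ^ 2)) / r

theorem mul_profile (ε R r : ℝ) : r * profile ε R r = step (r / ε ^ 2) - step (r / R ^ 2) := by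
  by_cases h : r = 0
  · subst h
    simp
  · rw [profile]
    field_simp

theorem contDiff_profile {ε R : ℝ} (hε : 0 < ε) (hR : 0 < R) : ContDiff ℝ ∞ (profile ε R) := by
  rw [contDiff_iff_contDiffAt]
  intro r
  by_cases h : r = 0
  · subst h
    have : profile ε R =ᶠ[nhds 0] fun _ => 0 := by
      have h1 : 0 < min (ε ^ 2 / 2) (R ^ 2 / 2) := by positivity
      filter_upwards [Iio_mem_nhds h1] with y hy
      have h2 := lt_min_iff.1 (Set.mem_Iio.1 hy)
      rw [profile, step_of_le, step_of_le]
      · simp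
      · rw [div_le_iff₀ (by positivity)]; linarith [h2.2]
      · rw [div_le_iff₀ (by positivity)]; linarith [h2.1]
    exact contDiffAt_const.congr_of_eventuallyEq this
  · exact (((contDiff_step.comp (contDiff_id.div_const _)).sub
      (contDiff_step.comp (contDiff_id.div_const _))).contDiffAt).div contDiffAt_id h

/-- The primitive of `profile` vanishing for large arguments. -/
def potential (ε R r : ℝ) : ℝ := ∫ ρ in R ^ 2..r, profile ε R ρ

theorem hasDerivAt_potential {ε R : ℝ} (hε : 0 < ε) (hR : 0 < R) (r : ℝ) :
    HasDerivAt (potential ε R) (profile ε R r) r :=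
  (contDiff_profile hε hR).continuous.integral_hasStrictDerivAt _ r |>.hasDerivAt

theorem contDiff_potential {ε R : ℝ} (hε : 0 < ε) (hR : 0 < R) :
    ContDiff ℝ ∞ (potential ε R) := by
  rw [contDiff_infty_iff_deriv]
  refine ⟨fun r => (hasDerivAt_potential hε hR r).differentiableAt, ?_⟩
  rw [show deriv (potential ε R) = profile ε R from
    funext fun r => (hasDerivAt_potential hε hR r).deriv]
  exact contDiff_profile hε hR

/-- A compactly supported radial kernel whose Laplacian is the difference of two rescaled bumps. -/
def radialKernel (ε R : ℝ) (x : V) : ℝ := potential ε R (vnsq x)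

theorem contDiff_radialKernel {ε R : ℝ} (hε : 0 < ε) (hR : 0 < R) :
    ContDiff ℝ ∞ (radialKernel ε R) :=
  (contDiff_potential hε hR).comp contDiff_vnsq

theorem hasCompactSupport_radialKernel {ε R : ℝ} (hε : 0 < ε) (hR : ε ≤ R) :
    HasCompactSupport (radialKernel ε R) := by
  have hR0 : 0 < R := hε.trans_le hR
  refine hasCompactSupport_of_vnsq (R ^ 2) fun x hx => ?_
  rw [radialKernel, potential, intervalIntegral.integral_congr (g := fun _ => (0 : ℝ)),
    intervalIntegral.integral_zero]
  intro ρ hρ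
  rw [Set.uIcc_of_le hx.le] at hρ
  have h2 : ε ^ 2 ≤ R ^ 2 := by gcongr
  simp only [profile]
  rw [step_of_ge, step_of_ge]
  · simp
  · rw [le_div_iff₀ (by positivity)]; linarith [hρ.1]
  · rw [le_div_iff₀ (by positivity)]; linarith [hρ.1]

theorem lap_radialKernel {ε R : ℝ} (hε : 0 < ε) (hR : 0 < R) :
    lap (radialKernel ε R) = fun x => rescale ε bump x - rescale R bump x := by
  have dv : Differentiable ℝ vnsq := contDiff_vnsq.differentiable (by simp)
  have h1 : ∀ i, pd i (radialKernel ε R) = fun x => profile ε R (vnsq x) * (2 * x i) := by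
    intro i
    funext x
    unfold radialKernel
    rw [pd_comp (hasDerivAt_potential hε hR _).differentiableAt (dv x),
      (hasDerivAt_potential hε hR _).deriv, pd_vnsq]
  have dp : Differentiable ℝ (profile ε R) := (contDiff_profile hε hR).differentiable (by simp)
  have h2 : ∀ i x, pd i (pd i (radialKernel ε R)) x
      = profile ε R (vnsq x) * 2 + 2 * x i * (deriv (profile ε R) (vnsq x) * (2 * x i)) := by
    intro i x
    rw [h1 i, pd_mul (f := fun x => profile ε R (vnsq x)) (g := fun x => 2 * x i)
      ((dp _).comp x (dv x)) (by fun_prop), pd_comp (L := profile ε R) (dp _) (dv x), pd_vnsq,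
      pd_mul (f := fun _ => 2) (g := fun x => x i) (by fun_prop) (by fun_prop), pd_coord, pd_const]
    simp
  have h3 : ∀ r, profile ε R r + r * deriv (profile ε R) r
      = deriv step (r / ε ^ 2) / ε ^ 2 - deriv step (r / R ^ 2) / R ^ 2 := by
    intro r
    have ds : Differentiable ℝ step := contDiff_step.differentiable (by simp)
    have e1 : HasDerivAt (fun r => r * profile ε R r)
        (1 * profile ε R r + r * deriv (profile ε R) r) r :=
      (hasDerivAt_id r).mul (dp r).hasDerivAt
    have e2 : ∀ a : ℝ, HasDerivAt (fun r => step (r / a)) (deriv step (r / a) * (1 / a)) r :=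
      fun a => (ds _).hasDerivAt.comp r ((hasDerivAt_id r).div_const a)
    have e3 := (e2 (ε ^ 2)).sub (e2 (R ^ 2))
    have e4 : (fun r => r * profile ε R r) = fun r => step (r / ε ^ 2) - step (r / R ^ 2) :=
      funext fun r => mul_profile ε R r
    rw [e4] at e1
    have := e1.unique e3
    simp only [one_mul] at this
    rw [this]
    ring
  funext x
  have h4 := h3 (vnsq x)
  have e5 : ∀ s : ℝ, vnsq (s⁻¹ • x) = vnsq x / s ^ 2 := by
    intro s
    simp [vnsq, mul_pow]
    ring
  simp only [lap, Fin.sum_univ_two, h2, rescale, bump, e5]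
  have e6 : vnsq x = x 0 ^ 2 + x 1 ^ 2 := by simp [vnsq]
  have e7 : profile ε R (vnsq x) * 2 + 2 * x 0 * (deriv (profile ε R) (vnsq x) * (2 * x 0)) +
      (profile ε R (vnsq x) * 2 + 2 * x 1 * (deriv (profile ε R) (vnsq x) * (2 * x 1)))
      = 4 * (profile ε R (vnsq x) + (x 0 ^ 2 + x 1 ^ 2) * deriv (profile ε R) (vnsq x)) := by ring
  rw [e7, ← e6, h4]
  ring

end Kernel

section StokesFlow

/-- Smooth solutions of the Stokes system `∂ₜv + ∇p = Δv + div S`, `div v = 0`. -/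
structure IsStokesFlow (T : ℝ) (v : Fin 2 → ℝ → V → ℝ) (p : ℝ → V → ℝ)
    (S : Fin 2 → Fin 2 → ℝ → V → ℝ) : Prop where
  smooth_v : ∀ i, ContDiff ℝ ∞ (Function.uncurry (v i))
  smooth_p : ContDiff ℝ ∞ (Function.uncurry p)
  smooth_S : ∀ i l, ContDiff ℝ ∞ (Function.uncurry (S i l))
  momentum : ∀ t ∈ Set.Icc 0 T, ∀ x i,
    deriv (fun s => v i s x) t + pd i (p t) x = lap (v i t) x + ∑ l, pd l (S i l t) x
  div_free : ∀ t ∈ Set.Icc 0 T, ∀ x, ∑ i, pd i (v i t) x = 0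

theorem integrable_mul_of_compact {f g : V → ℝ} (hf : Continuous f) (hg : Continuous g)
    (hc : HasCompactSupport g) : Integrable fun x => f x * g x :=
  (hf.mul hg).integrable_of_hasCompactSupport hc.mul_left

theorem integrable_sq_of_compact {f : V → ℝ} (hf : Continuous f) (hc : HasCompactSupport f) :
    Integrable fun x => f x ^ 2 := by
  simpa only [sq] using integrable_mul_of_compact hf hf hc

theorem contDiff_lap {f : V → ℝ} (hf : ContDiff ℝ ∞ f) : ContDiff ℝ ∞ (lap f) := by
  unfold lap
  exact ContDiff.sum fun i _ => contDiff_pd (contDiff_pd hf i) i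

theorem hasCompactSupport_lap {f : V → ℝ} (hf : HasCompactSupport f) :
    HasCompactSupport (lap f) := by
  have h : lap f = pd 0 (pd 0 f) + pd 1 (pd 1 f) := by
    funext x
    simp [lap]
  rw [h]
  exact (hasCompactSupport_pd (hasCompactSupport_pd hf 0) 0).add
    (hasCompactSupport_pd (hasCompactSupport_pd hf 1) 1)

theorem integral_mul_lap {f g : V → ℝ} (hf : ContDiff ℝ ∞ f) (hg : ContDiff ℝ ∞ g)
    (hc : HasCompactSupport g) : ∫ x, f x * lap g x = ∫ x, lap f x * g x := by
  have h : ∀ i, ∫ x, f x * pd i (pd i g) x = ∫ x, pd i (pd i f) x * g x := fun i => by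
    rw [integral_mul_pd hf (contDiff_pd hg i) (hasCompactSupport_pd hc i),
      integral_mul_pd (contDiff_pd hf i) hg hc, neg_neg]
  simp only [lap, Fin.sum_univ_two, mul_add, add_mul]
  have i1 : ∀ i, Integrable fun x => f x * pd i (pd i g) x := fun i =>
    integrable_mul_of_compact hf.continuous (continuous_pd (contDiff_pd hg i) i)
      (hasCompactSupport_pd (hasCompactSupport_pd hc i) i)
  have i2 : ∀ i, Integrable fun x => pd i (pd i f) x * g x := fun i =>
    integrable_mul_of_compact (continuous_pd (contDiff_pd hf i) i) hg.continuous hc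
  rw [integral_add (i1 0) (i1 1), integral_add (i2 0) (i2 1), h, h]

variable {T : ℝ} {v : Fin 2 → ℝ → V → ℝ} {p : ℝ → V → ℝ} {S : Fin 2 → Fin 2 → ℝ → V → ℝ}

theorem IsStokesFlow.weak_form (H : IsStokesFlow T v p S) {t : ℝ} (ht : t ∈ Set.Icc 0 T)
    {h : V → ℝ} (hh : ContDiff ℝ ∞ h) (hc : HasCompactSupport h) (i : Fin 2) :
    ∫ x, p t x * pd i h x = - (∫ x, v i t x * lap h x) + (∑ l, ∫ x, S i l t x * pd l h x)
      + ∫ x, deriv (fun s => v i s x) t * h x := by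
  have hv := contDiff_slice (H.smooth_v i) t
  have hS := fun l => contDiff_slice (H.smooth_S i l) t
  have hd := contDiff_slice (contDiff_deriv_uncurry (H.smooth_v i)) t
  rw [integral_mul_pd (contDiff_slice H.smooth_p t) hh hc, integral_mul_lap hv hh hc]
  simp only [Fin.sum_univ_two, integral_mul_pd (hS _) hh hc]
  have i0 := integrable_mul_of_compact (contDiff_lap hv).continuous hh.continuous hc
  have i1 := fun l => integrable_mul_of_compact (continuous_pd (hS l) l) hh.continuous hc
  have i2 := integrable_mul_of_compact hd.continuous hh.continuous hc
  have e : ∀ x, pd i (p t) x * h x = lap (v i t) x * h x + pd 0 (S i 0 t) x * h x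
      + pd 1 (S i 1 t) x * h x - deriv (fun s => v i s x) t * h x := by
    intro x
    have := H.momentum t ht x i
    rw [Fin.sum_univ_two] at this
    rw [show pd i (p t) x = lap (v i t) x + (pd 0 (S i 0 t) x + pd 1 (S i 1 t) x)
      - deriv (fun s => v i s x) t by linarith]
    ring
  simp only [e]
  have i3 : Integrable fun x => lap (v i t) x * h x + pd 0 (S i 0 t) x * h x := i0.add (i1 0)
  have i4 : Integrable fun x => lap (v i t) x * h x + pd 0 (S i 0 t) x * h x
      + pd 1 (S i 1 t) x * h x := i3.add (i1 1)
  rw [integral_sub i4 i2, integral_add i3 (i1 1), integral_add i0 (i1 0)]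
  ring

theorem IsStokesFlow.integral_grad (H : IsStokesFlow T v p S) {t : ℝ} (ht : t ∈ Set.Icc 0 T)
    {w : V → ℝ} (hw : ContDiff ℝ ∞ w) (hc : HasCompactSupport w) :
    (∫ x, v 0 t x * pd 0 w x) + ∫ x, v 1 t x * pd 1 w x = 0 := by
  have hv := fun i => contDiff_slice (H.smooth_v i) t
  rw [integral_mul_pd (hv 0) hw hc, integral_mul_pd (hv 1) hw hc, ← neg_add, ← integral_add
    (integrable_mul_of_compact (continuous_pd (hv 0) 0) hw.continuous hc)
    (integrable_mul_of_compact (continuous_pd (hv 1) 1) hw.continuous hc), neg_eq_zero]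
  have : ∀ x, pd 0 (v 0 t) x * w x + pd 1 (v 1 t) x * w x = 0 := by
    intro x
    have := H.div_free t ht x
    rw [Fin.sum_univ_two] at this
    rw [← add_mul, this, zero_mul]
  simp [this]

theorem lap_pd {w : V → ℝ} (hw : ContDiff ℝ ∞ w) (i : Fin 2) : lap (pd i w) = pd i (lap w) := by
  funext x
  have h : ∀ l, pd l (pd l (pd i w)) x = pd i (pd l (pd l w)) x := by
    intro l
    have : pd l (pd i w) = pd i (pd l w) := funext fun y => pd_comm hw l i y
    rw [this, pd_comm (contDiff_pd hw l)]
  have e : lap w = fun y => pd 0 (pd 0 w) y + pd 1 (pd 1 w) y := by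
    funext y
    simp [lap]
  have d := fun l : Fin 2 => (contDiff_pd (contDiff_pd hw l) l).differentiable (by simp) x
  rw [e, pd_add (d 0) (d 1), lap, Fin.sum_univ_two, h, h]

theorem IsStokesFlow.integral_deriv_grad (H : IsStokesFlow T v p S) {t : ℝ}
    (ht : t ∈ Set.Ioo 0 T) {w : V → ℝ} (hw : ContDiff ℝ ∞ w) (hc : HasCompactSupport w) :
    (∫ x, deriv (fun s => v 0 s x) t * pd 0 w x)
      + ∫ x, deriv (fun s => v 1 s x) t * pd 1 w x = 0 := by
  have key : ∀ i, HasDerivAt (fun τ => ∫ x, v i τ x * pd i w x)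
      (∫ x, deriv (fun s => v i s x) t * pd i w x) t := by
    intro i
    have h1 := hasDerivAt_integral_of_support
      (h := fun τ x => v i τ x * pd i w x)
      ((H.smooth_v i).mul ((contDiff_pd hw i).comp contDiff_snd)) hc
      (fun τ x hx => by rw [pd_eq_zero_of_notMem hx, mul_zero]) t
    convert h1 using 3 with x
    rw [deriv_mul_const (differentiableAt_time (H.smooth_v i) x t)]
  have h2 : (fun τ => (∫ x, v 0 τ x * pd 0 w x) + ∫ x, v 1 τ x * pd 1 w x)
      =ᶠ[nhds t] fun _ => 0 := by
    filter_upwards [Ioo_mem_nhds ht.1 ht.2] with τ hτ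
      using H.integral_grad (Set.Ioo_subset_Icc_self hτ) hw hc
  exact ((key 0).add (key 1)).unique ((hasDerivAt_const t 0).congr_of_eventuallyEq h2)

theorem IsStokesFlow.integral_mul_lap_eq (H : IsStokesFlow T v p S) {t : ℝ}
    (ht : t ∈ Set.Ioo 0 T) {w : V → ℝ} (hw : ContDiff ℝ ∞ w) (hc : HasCompactSupport w) :
    ∫ x, p t x * lap w x = ∑ i, ∑ l, ∫ x, S i l t x * pd l (pd i w) x := by
  have hp := (contDiff_slice H.smooth_p t).continuous
  have ht' := Set.Ioo_subset_Icc_self ht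
  have hwi := fun i => contDiff_pd hw i
  have hci := fun i => hasCompactSupport_pd hc i
  have h0 := H.weak_form ht' (hwi 0) (hci 0) 0
  have h1 := H.weak_form ht' (hwi 1) (hci 1) 1
  have h2 := H.integral_deriv_grad ht hw hc
  have h3 := H.integral_grad ht' (contDiff_lap hw) (hasCompactSupport_lap hc)
  rw [lap_pd hw] at h0 h1
  have h4 : ∫ x, p t x * lap w x
      = (∫ x, p t x * pd 0 (pd 0 w) x) + ∫ x, p t x * pd 1 (pd 1 w) x := by
    rw [← integral_add (integrable_mul_of_compact hp (continuous_pd (hwi 0) 0)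
      (hasCompactSupport_pd (hci 0) 0)) (integrable_mul_of_compact hp (continuous_pd (hwi 1) 1)
      (hasCompactSupport_pd (hci 1) 1))]
    simp [lap, mul_add]
  rw [h4, h0, h1]
  simp only [Fin.sum_univ_two]
  linarith

theorem integral_sq_hessian_le {w : V → ℝ} (hw : ContDiff ℝ ∞ w) (hc : HasCompactSupport w)
    (i l : Fin 2) : ∫ x, pd l (pd i w) x ^ 2 ≤ ∫ x, lap w x ^ 2 := by
  have c2 := fun i l => contDiff_pd (contDiff_pd hw i) l
  have k2 := fun i l : Fin 2 => hasCompactSupport_pd (hasCompactSupport_pd hc i) l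
  have hmix : ∫ x, pd 1 (pd 0 w) x * pd 1 (pd 0 w) x = ∫ x, pd 0 (pd 0 w) x * pd 1 (pd 1 w) x := by
    have e : ∀ x, pd 0 (pd 1 (pd 0 w)) x = pd 1 (pd 0 (pd 0 w)) x :=
      fun x => pd_comm (contDiff_pd hw 0) 0 1 x
    have e1 : pd 1 (pd 0 w) = pd 0 (pd 1 w) := funext fun x => pd_comm hw 1 0 x
    calc ∫ x, pd 1 (pd 0 w) x * pd 1 (pd 0 w) x
        = ∫ x, pd 1 (pd 0 w) x * pd 0 (pd 1 w) x := by rw [← e1]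
      _ = - ∫ x, pd 0 (pd 1 (pd 0 w)) x * pd 1 w x :=
        integral_mul_pd (c2 0 1) (contDiff_pd hw 1) (hasCompactSupport_pd hc 1) 0
      _ = - ∫ x, pd 1 (pd 0 (pd 0 w)) x * pd 1 w x := by simp only [e]
      _ = _ := (integral_mul_pd (c2 0 0) (contDiff_pd hw 1) (hasCompactSupport_pd hc 1) 1).symm
  have I : ∀ i l i' l', Integrable fun x => pd l (pd i w) x * pd l' (pd i' w) x :=
    fun i l i' l' => integrable_mul_of_compact (c2 i l).continuous (c2 i' l').continuous (k2 i' l')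
  have hlap : ∫ x, lap w x ^ 2 = (∫ x, pd 0 (pd 0 w) x * pd 0 (pd 0 w) x)
      + 2 * (∫ x, pd 1 (pd 0 w) x * pd 1 (pd 0 w) x)
      + ∫ x, pd 1 (pd 1 w) x * pd 1 (pd 1 w) x := by
    have I1 : Integrable fun x => pd 0 (pd 0 w) x * pd 0 (pd 0 w) x
        + 2 * (pd 0 (pd 0 w) x * pd 1 (pd 1 w) x) := (I 0 0 0 0).add ((I 0 0 1 1).const_mul 2)
    rw [hmix, ← integral_const_mul, ← integral_add (I 0 0 0 0) ((I 0 0 1 1).const_mul 2),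
      ← integral_add I1 (I 1 1 1 1)]
    congr 1
    funext x
    simp only [lap, Fin.sum_univ_two]
    ring
  have n : ∀ i l, 0 ≤ ∫ x, pd l (pd i w) x * pd l (pd i w) x :=
    fun i l => integral_nonneg fun x => mul_self_nonneg _
  have e1 : pd 0 (pd 1 w) = pd 1 (pd 0 w) := funext fun x => pd_comm hw 0 1 x
  have n1 := n 0 0
  have n2 := n 0 1
  have n3 := n 1 1
  simp only [sq (pd _ _ _)]
  rw [hlap]
  fin_cases i <;> fin_cases l <;> simp only [Fin.zero_eta, Fin.mk_one, e1] <;> linarith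

/-- `|∫ f g| ≤ a b` when `∫ f² ≤ a²` and `∫ g² ≤ b²`. -/
theorem abs_integral_mul_le {f g : V → ℝ} (hf : Continuous f) (hg : Continuous g) {a b : ℝ}
    (ha : 0 ≤ a) (hb : 0 ≤ b) (hf2 : Integrable fun x => f x ^ 2)
    (hg2 : Integrable fun x => g x ^ 2) (hfa : ∫ x, f x ^ 2 ≤ a ^ 2) (hgb : ∫ x, g x ^ 2 ≤ b ^ 2) :
    |∫ x, f x * g x| ≤ a * b := by
  refine (abs_integral_le_integral_abs).trans ((sq_integral_mul_le hf.aestronglyMeasurable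
    hg.aestronglyMeasurable hf2 hg2).2.trans ?_)
  exact mul_le_mul ((Real.sqrt_le_left ha).2 hfa) ((Real.sqrt_le_left hb).2 hgb)
    (Real.sqrt_nonneg _) ha

theorem IsStokesFlow.abs_integral_mul_lap_le (H : IsStokesFlow T v p S) {t : ℝ}
    (ht : t ∈ Set.Ioo 0 T) {γ : ℝ} (hγ : 0 ≤ γ) (hSi : ∀ i l, Integrable fun x => S i l t x ^ 2)
    (hS : ∀ i l, ∫ x, S i l t x ^ 2 ≤ γ ^ 2) {b : ℝ} (hb : 0 ≤ b)
    {w : V → ℝ} (hw : ContDiff ℝ ∞ w) (hc : HasCompactSupport w) (hwb : ∫ x, lap w x ^ 2 ≤ b ^ 2) :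
    |∫ x, p t x * lap w x| ≤ 4 * (γ * b) := by
  have h : ∀ i l, |∫ x, S i l t x * pd l (pd i w) x| ≤ γ * b := by
    intro i l
    have c2 := continuous_pd (contDiff_pd hw i) l
    exact abs_integral_mul_le (contDiff_slice (H.smooth_S i l) t).continuous c2 hγ hb (hSi i l)
      (integrable_sq_of_compact c2 (hasCompactSupport_pd (hasCompactSupport_pd hc i) l))
      (hS i l) ((integral_sq_hessian_le hw hc i l).trans hwb)
  rw [H.integral_mul_lap_eq ht hw hc]
  simp only [Fin.sum_univ_two]
  have h00 := abs_le.1 (h 0 0)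
  have h01 := abs_le.1 (h 0 1)
  have h10 := abs_le.1 (h 1 0)
  have h11 := abs_le.1 (h 1 1)
  rw [abs_le]
  constructor <;> linarith [h00.1, h00.2, h01.1, h01.2, h10.1, h10.2, h11.1, h11.2]

end StokesFlow

section Pressure

open scoped Pointwise

theorem contDiff_cv_uncurry {f : ℝ → V → ℝ} (hf : ContDiff ℝ ∞ (Function.uncurry f)) {K : Set V}
    (hK : IsCompact K) (hs : ∀ t x, x ∉ K → f t x = 0) {k : V → ℝ} (hk : Continuous k) :
    ContDiff ℝ ∞ (Function.uncurry fun t => cv (f t) k) := by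
  have h := contDiffOn_convolution_right_with_param (μ := (volume : Measure V))
    (ContinuousLinearMap.mul ℝ ℝ) (f := k) (g := f) (s := Set.univ) isOpen_univ hK
    (fun t x _ hx => hs t x hx) hk.locallyIntegrable (n := (⊤ : ℕ∞))
    (by rw [Set.univ_prod_univ, contDiffOn_univ]; exact hf)
  rw [Set.univ_prod_univ, contDiffOn_univ] at h
  convert h using 1
  funext q
  obtain ⟨t, x⟩ := q
  rw [← cv_eq_convolution, Function.uncurry_apply_pair, cv_comm]

theorem cv_eq_zero {f : V → ℝ} {K : Set V} (hs : ∀ x, x ∉ K → f x = 0) {k : V → ℝ} {x : V}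
    (hx : x ∉ K + tsupport k) : cv f k x = 0 := by
  refine integral_eq_zero_of_ae (Eventually.of_forall fun y => ?_)
  by_cases hy : y ∈ K
  · have : x - y ∉ tsupport k := fun h => hx ⟨y, hy, x - y, h, by simp⟩
    simp [image_eq_zero_of_notMem_tsupport this]
  · simp [hs y hy]

theorem deriv_cv {f : ℝ → V → ℝ} (hf : ContDiff ℝ ∞ (Function.uncurry f)) {K : Set V}
    (hK : IsCompact K) (hs : ∀ t x, x ∉ K → f t x = 0) {k : V → ℝ} (hk : ContDiff ℝ ∞ k)
    (t : ℝ) (x : V) :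
    deriv (fun s => cv (f s) k x) t = cv (fun y => deriv (fun s => f s y) t) k x := by
  have h := hasDerivAt_integral_of_support
    (h := fun τ y => f τ y * k (x - y))
    (hf.mul (hk.comp ((contDiff_const (c := x)).sub contDiff_snd))) hK
    (fun τ y hy => by simp [hs τ y hy]) t
  have h2 := h.deriv
  simp only [cv]
  rw [h2]
  congr 1
  funext y
  rw [deriv_mul_const (differentiableAt_time hf y t)]

theorem integral_sq_cv_le_sq {f k : V → ℝ} (hf : Continuous f) (hcf : HasCompactSupport f)
    (hk : Continuous k) (hck : HasCompactSupport k) {N r : ℝ} (hN : ∫ x, |f x| ≤ N)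
    (hr : ∫ x, k x ^ 2 ≤ r ^ 2) : ∫ x, cv f k x ^ 2 ≤ (N * r) ^ 2 := by
  have n1 : 0 ≤ ∫ x, |f x| := integral_nonneg fun x => abs_nonneg _
  refine (integral_sq_cv_le hf hcf hk hck).trans ?_
  rw [mul_pow]
  gcongr

variable {T : ℝ} {v : Fin 2 → ℝ → V → ℝ} {p : ℝ → V → ℝ} {S : Fin 2 → Fin 2 → ℝ → V → ℝ}

theorem IsStokesFlow.far_pressure (H : IsStokesFlow T v p S)
    (hvi : ∀ t ∈ Set.Icc 0 T, ∀ i, Integrable fun x => v i t x ^ 2)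
    (hSi : ∀ t ∈ Set.Icc 0 T, ∀ i l, Integrable fun x => S i l t x ^ 2)
    {B : ℝ → ℝ} (hB : ∀ t, 0 ≤ B t) (hBi : IntegrableOn B (Set.Ioc 0 T))
    (hv : ∀ t ∈ Set.Icc 0 T, ∀ i, ∫ x, v i t x ^ 2 ≤ B t ^ 2)
    (hS : ∀ t ∈ Set.Icc 0 T, ∀ i l, ∫ x, S i l t x ^ 2 ≤ B t ^ 2)
    {f : ℝ → V → ℝ} (hf : ContDiff ℝ ∞ (Function.uncurry f)) {K : Set V}
    (hK : IsCompact K) (hs : ∀ t x, x ∉ K → f t x = 0) {N : ℝ} (hN0 : 0 ≤ N)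
    (hN : ∀ t ∈ Set.Icc 0 T, ∫ x, |f t x| ≤ N)
    (hN' : ∀ t ∈ Set.Icc 0 T, ∫ x, |deriv (fun s => f s x) t| ≤ N)
    {η : V → ℝ} (hη : ContDiff ℝ ∞ η) (hcη : HasCompactSupport η) {r : ℝ} (hr0 : 0 ≤ r)
    (hr : ∫ x, η x ^ 2 ≤ r ^ 2) (hr1 : ∀ l, ∫ x, pd l η x ^ 2 ≤ r ^ 2)
    (hr2 : ∫ x, lap η x ^ 2 ≤ r ^ 2) (i : Fin 2) {t : ℝ} (ht : t ∈ Set.Icc 0 T) :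
    |∫ s in 0..t, ∫ x, p s x * pd i (cv (f s) η) x|
      ≤ N * r * (4 * (∫ s in 0..t, B s) + B t + B 0) := by
  have hNr : 0 ≤ N * r := mul_nonneg hN0 hr0
  have hfs : ∀ s, ContDiff ℝ ∞ (f s) := contDiff_slice hf
  have hfc : ∀ s, HasCompactSupport (f s) := fun s => HasCompactSupport.intro hK (hs s)
  have hdf := contDiff_deriv_uncurry hf
  have hds : ∀ s x, x ∉ K → deriv (fun s => f s x) s = 0 := by
    intro s x hx
    have : (fun s => f s x) = fun _ => 0 := funext fun s => hs s x hx
    simp [this]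
  have hdc : ∀ s, HasCompactSupport fun x => deriv (fun s => f s x) s :=
    fun s => HasCompactSupport.intro hK (hds s)
  have hdfs : ∀ s, ContDiff ℝ ∞ fun x => deriv (fun s => f s x) s := fun s => contDiff_slice hdf s
  have hH : ContDiff ℝ ∞ (Function.uncurry fun s => cv (f s) η) :=
    contDiff_cv_uncurry hf hK hs hη.continuous
  have hK' : IsCompact (K + tsupport η) := hK.add hcη
  have hHs : ∀ s x, x ∉ K + tsupport η → cv (f s) η x = 0 := fun s x hx => cv_eq_zero (hs s) hx
  have hHc : ∀ s, HasCompactSupport (cv (f s) η) := fun s => HasCompactSupport.intro hK' (hHs s)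
  have hvH : ContDiff ℝ ∞ (Function.uncurry fun s x => v i s x * cv (f s) η x) :=
    (H.smooth_v i).mul hH
  have hvHs : ∀ s x, x ∉ K + tsupport η → v i s x * cv (f s) η x = 0 :=
    fun s x hx => by rw [hHs s x hx, mul_zero]
  have cvc : ∀ s, Continuous (v i s) := fun s => (contDiff_slice (H.smooth_v i) s).continuous
  have bound : ∀ s ∈ Set.Icc 0 T, ∀ {g w k : V → ℝ}, Continuous g → (Integrable fun x => g x ^ 2) →
      ∫ x, g x ^ 2 ≤ B s ^ 2 → ContDiff ℝ ∞ w → HasCompactSupport w → ∫ x, |w x| ≤ N →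
      ContDiff ℝ ∞ k → HasCompactSupport k → ∫ x, k x ^ 2 ≤ r ^ 2 →
      |∫ x, g x * cv w k x| ≤ B s * (N * r) := by
    intro s _ g w k hg hgi hgB hw hwc hwN hk hkc hkr
    exact abs_integral_mul_le hg (contDiff_cv hw.continuous hk hkc).continuous (hB s) hNr hgi
      (integrable_sq_of_compact (contDiff_cv hw.continuous hk hkc).continuous
        (hasCompactSupport_cv hwc hkc)) hgB
      (integral_sq_cv_le_sq hw.continuous hwc hk.continuous hkc hwN hkr)
  have hθ : ∀ s ∈ Set.Icc 0 T, |∫ x, v i s x * cv (f s) η x| ≤ B s * (N * r) := fun s h =>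
    bound s h (cvc s) (hvi s h i) (hv s h i) (hfs s) (hfc s) (hN s h) hη hcη hr
  have hpt : ∀ s ∈ Set.Icc 0 T, |(∫ x, p s x * pd i (cv (f s) η) x)
      - ∫ x, deriv (fun τ => v i τ x * cv (f τ) η x) s| ≤ N * r * (4 * B s) := by
    intro s h
    have e1 : ∀ x, deriv (fun τ => v i τ x * cv (f τ) η x) s
        = deriv (fun τ => v i τ x) s * cv (f s) η x
          + v i s x * cv (fun y => deriv (fun τ => f τ y) s) η x := by
      intro x
      rw [← deriv_cv hf hK hs hη]
      exact deriv_fun_mul (differentiableAt_time (H.smooth_v i) x s) (differentiableAt_time hH x s)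
    simp only [e1]
    rw [integral_add (integrable_mul_of_compact
        (contDiff_slice (contDiff_deriv_uncurry (H.smooth_v i)) s).continuous
        (contDiff_slice hH s).continuous (hHc s))
      (integrable_mul_of_compact (cvc s) (contDiff_cv (hdfs s).continuous hη hcη).continuous
        (hasCompactSupport_cv (hdc s) hcη)),
      H.weak_form h (contDiff_slice hH s) (hHc s) i, lap_cv (hfs s).continuous (hfc s) hη hcη]
    simp only [pd_cv (hfs s).continuous hη hcη, Fin.sum_univ_two]
    have b0 := abs_le.1 (bound s h (cvc s) (hvi s h i) (hv s h i) (hfs s) (hfc s) (hN s h)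
      (contDiff_lap hη) (hasCompactSupport_lap hcη) hr2)
    have b1 := fun l => abs_le.1 (bound s h (contDiff_slice (H.smooth_S i l) s).continuous
      (hSi s h i l) (hS s h i l) (hfs s) (hfc s) (hN s h)
      (contDiff_pd hη l) (hasCompactSupport_pd hcη l) (hr1 l))
    have b2 := abs_le.1 (bound s h (cvc s) (hvi s h i) (hv s h i) (hdfs s) (hdc s) (hN' s h)
      hη hcη hr)
    rw [abs_le]
    constructor <;> linarith [b0.1, b0.2, (b1 0).1, (b1 0).2, (b1 1).1, (b1 1).2, b2.1, b2.2]
  have ht0 := ht.1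
  have hc1 : Continuous fun s => ∫ x, p s x * pd i (cv (f s) η) x := by
    refine continuous_integral_of_support (K := K + tsupport η)
      (H.smooth_p.continuous.mul (contDiff_pd_uncurry hH i).continuous) hK' fun s x hx => ?_
    simp only [pd_cv (hfs s).continuous hη hcη]
    rw [cv_eq_zero (hs s), mul_zero]
    exact fun hx' => hx (Set.add_subset_add_left (closure_minimal
      (fun y hy => by
        by_contra h
        exact hy (pd_eq_zero_of_notMem h i)) (isClosed_tsupport _)) hx')
  have hc2 : Continuous fun s => ∫ x, deriv (fun τ => v i τ x * cv (f τ) η x) s := by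
    refine continuous_integral_of_support (K := K + tsupport η)
      (contDiff_deriv_uncurry hvH).continuous hK' fun s x hx => ?_
    have : (fun τ => v i τ x * cv (f τ) η x) = fun _ => 0 := funext fun τ => hvHs τ x hx
    simp [this]
  have hBt : IntervalIntegrable B volume 0 t := by
    rw [intervalIntegrable_iff_integrableOn_Ioc_of_le ht0]
    exact hBi.mono_set (Set.Ioc_subset_Ioc_right ht.2)
  have hintg : |∫ s in 0..t, ((∫ x, p s x * pd i (cv (f s) η) x)
      - ∫ x, deriv (fun τ => v i τ x * cv (f τ) η x) s)| ≤ ∫ s in 0..t, N * r * (4 * B s) := by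
    rw [← Real.norm_eq_abs]
    refine intervalIntegral.norm_integral_le_of_norm_le ht0 (Eventually.of_forall fun s h => ?_)
      ((hBt.const_mul 4).const_mul (N * r))
    exact hpt s ⟨h.1.le, h.2.trans ht.2⟩
  rw [intervalIntegral.integral_sub (hc1.intervalIntegrable _ _) (hc2.intervalIntegrable _ _),
    integral_deriv_of_support hvH hK' hvHs, intervalIntegral.integral_const_mul,
    intervalIntegral.integral_const_mul] at hintg
  have h1 := abs_le.1 hintg
  have h2 := abs_le.1 (hθ t ht)
  have h3 := abs_le.1 (hθ 0 ⟨le_rfl, ht0.trans ht.2⟩)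
  rw [abs_le]
  constructor <;> linarith [h1.1, h1.2, h2.1, h2.2, h3.1, h3.2]

end Pressure

section NearPressure

theorem integral_rescale_bump_sq_le {R : ℝ} (hR : 1 ≤ R) {C : ℝ} (h0 : ∫ x, bump x ^ 2 ≤ C ^ 2)
    (h1 : ∀ l, ∫ x, pd l bump x ^ 2 ≤ C ^ 2) (h2 : ∫ x, lap bump x ^ 2 ≤ C ^ 2) :
    (∫ x, rescale R bump x ^ 2 ≤ (R⁻¹ * C) ^ 2) ∧
    (∀ l, ∫ x, pd l (rescale R bump) x ^ 2 ≤ (R⁻¹ * C) ^ 2) ∧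
    ∫ x, lap (rescale R bump) x ^ 2 ≤ (R⁻¹ * C) ^ 2 := by
  have hR0 : 0 < R := by linarith
  have hi0 : 0 ≤ R⁻¹ := (inv_pos.2 hR0).le
  have hi1 : R⁻¹ ≤ 1 := inv_le_one_of_one_le₀ hR
  have hi2 : R⁻¹ ^ 2 ≤ 1 := pow_le_one₀ hi0 hi1
  have key : ∀ k : V → ℝ, ∫ x, k x ^ 2 ≤ C ^ 2 → ∫ x, rescale R k x ^ 2 ≤ (R⁻¹ * C) ^ 2 := by
    intro k hk
    rw [integral_rescale_sq k hR0, mul_pow]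
    gcongr
  have step : ∀ {k : V → ℝ} {a : ℝ}, 0 ≤ a → a ≤ 1 → ∫ x, k x ^ 2 ≤ (R⁻¹ * C) ^ 2 →
      ∫ x, (a * k x) ^ 2 ≤ (R⁻¹ * C) ^ 2 := by
    intro k a ha ha' hk
    simp only [mul_pow]
    rw [integral_const_mul]
    have : 0 ≤ ∫ x, k x ^ 2 := integral_nonneg fun x => sq_nonneg _
    have ha2 : a ^ 2 ≤ 1 := pow_le_one₀ ha ha'
    nlinarith
  refine ⟨key _ h0, fun l => ?_, ?_⟩
  · rw [pd_rescale contDiff_bump]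
    exact step hi0 hi1 (key _ (h1 l))
  · have e : lap (rescale R bump) = fun x => R⁻¹ ^ 2 * rescale R (lap bump) x := by
      funext x
      have e1 : ∀ l, pd l (fun x => R⁻¹ * rescale R (pd l bump) x) x
          = R⁻¹ ^ 2 * rescale R (pd l (pd l bump)) x := by
        intro l
        have c := contDiff_pd contDiff_bump l
        rw [pd_mul (f := fun _ => R⁻¹) (by fun_prop)
          ((contDiff_rescale c R).differentiable (by simp) x), pd_const, pd_rescale c]
        ring
      simp only [lap, Fin.sum_univ_two, pd_rescale contDiff_bump, e1]
      simp only [rescale, lap, Fin.sum_univ_two]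
      ring
    rw [e]
    exact step (by positivity) hi2 (key _ h2)

theorem cv_rescale (g : V → ℝ) {ε : ℝ} (hε : 0 < ε) (x : V) :
    cv g (rescale ε bump) x = ∫ z, bump z * g (x - ε • z) := by
  rw [← integral_rescale (fun z => bump z * g (x - ε • z)) hε, cv_comm]
  unfold cv
  congr 1
  funext y
  simp only [rescale]
  rw [smul_inv_smul₀ hε.ne']
  ring

open scoped Pointwise in
theorem exists_continuous_mollified {p g : ℝ → V → ℝ} (hp : Continuous (Function.uncurry p))
    (hg : Continuous (Function.uncurry g)) {K : Set V} (hK : IsCompact K)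
    (hs : ∀ t x, x ∉ K → g t x = 0) (t : ℝ) :
    ∃ Φ : ℝ → ℝ, Continuous Φ ∧ Φ 0 = (∫ z, bump z) * ∫ s in 0..t, ∫ x, p s x * g s x ∧
      ∀ ε, 0 < ε → ε ≤ 1 → Φ ε = ∫ s in 0..t, ∫ x, p s x * cv (g s) (rescale ε bump) x := by
  set e : ℝ → ℝ := fun ε => max 0 (min ε 1) with he
  have hec : Continuous e := by fun_prop
  have he01 : ∀ ε, e ε ∈ Set.Icc (0 : ℝ) 1 := fun ε =>
    ⟨le_max_left _ _, max_le zero_le_one (min_le_right _ _)⟩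
  set M : Set V := (fun q : ℝ × V => q.1 • q.2) '' (Set.Icc (0 : ℝ) 1 ×ˢ tsupport bump) with hM
  have hMc : IsCompact M := (isCompact_Icc.prod hasCompactSupport_bump).image (by fun_prop)
  have hψ : Continuous fun q : (ℝ × ℝ) × V => ∫ z, bump z * g q.1.2 (q.2 - e q.1.1 • z) := by
    refine continuous_integral_of_support (K := tsupport bump)
      (h := fun (q : (ℝ × ℝ) × V) z => bump z * g q.1.2 (q.2 - e q.1.1 • z)) ?_
      hasCompactSupport_bump fun q z hz => ?_
    · have h1 : Continuous fun q : ((ℝ × ℝ) × V) × V =>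
          Function.uncurry g (q.1.1.2, q.1.2 - e q.1.1.1 • q.2) := hg.comp (by fun_prop)
      exact (contDiff_bump.continuous.comp continuous_snd).mul h1
    · simp [image_eq_zero_of_notMem_tsupport hz]
  have hin : Continuous fun q : ℝ × ℝ =>
      ∫ x, p q.2 x * ∫ z, bump z * g q.2 (x - e q.1 • z) := by
    refine continuous_integral_of_support (K := K + M)
      (h := fun (q : ℝ × ℝ) x => p q.2 x * ∫ z, bump z * g q.2 (x - e q.1 • z)) ?_
      (hK.add hMc) fun q x hx => ?_
    · have h1 : Continuous fun q : (ℝ × ℝ) × V => Function.uncurry p (q.1.2, q.2) :=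
        hp.comp (by fun_prop)
      exact h1.mul hψ
    · have : ∀ z, bump z * g q.2 (x - e q.1 • z) = 0 := by
        intro z
        by_cases hz : z ∈ tsupport bump
        · rw [hs, mul_zero]
          intro hx'
          exact hx ⟨_, hx', e q.1 • z, ⟨(e q.1, z), ⟨he01 _, hz⟩, rfl⟩, by simp⟩
        · simp [image_eq_zero_of_notMem_tsupport hz]
      simp [this]
  refine ⟨fun ε => ∫ s in 0..t, ∫ x, p s x * ∫ z, bump z * g s (x - e ε • z),
    intervalIntegral.continuous_parametric_intervalIntegral_of_continuous'
      (f := fun ε s => ∫ x, p s x * ∫ z, bump z * g s (x - e ε • z)) hin 0 t, ?_, ?_⟩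
  · have e0 : e 0 = 0 := by simp [he]
    simp only [e0, zero_smul, sub_zero, integral_mul_const]
    rw [← intervalIntegral.integral_const_mul]
    congr 1
    funext s
    rw [← integral_const_mul]
    congr 1
    funext x
    ring
  · intro ε h0 h1
    have e1 : e ε = ε := by simp [he, h1, h0.le]
    simp only [e1, cv_rescale _ h0]

variable {T : ℝ} {v : Fin 2 → ℝ → V → ℝ} {p : ℝ → V → ℝ} {S : Fin 2 → Fin 2 → ℝ → V → ℝ}

theorem IsStokesFlow.near_pressure (H : IsStokesFlow T v p S) {t : ℝ}
    (ht : t ∈ Set.Ioo 0 T) {γ : ℝ} (hγ : 0 ≤ γ) (hSi : ∀ i l, Integrable fun x => S i l t x ^ 2)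
    (hS : ∀ i l, ∫ x, S i l t x ^ 2 ≤ γ ^ 2) {g : V → ℝ} (hg : ContDiff ℝ ∞ g)
    (hcg : HasCompactSupport g) {ε R : ℝ} (hε : 0 < ε) (hR : ε ≤ R) :
    |(∫ x, p t x * cv g (rescale ε bump) x) - ∫ x, p t x * cv g (rescale R bump) x|
      ≤ 8 * (∫ z, bump z) * (γ * √(∫ x, g x ^ 2)) := by
  have hR0 : 0 < R := hε.trans_le hR
  set c := ∫ z, bump z with hc
  have hc0 : 0 < c := integral_bump_pos
  set G := ∫ x, g x ^ 2 with hG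
  have hG0 : 0 ≤ G := integral_nonneg fun x => sq_nonneg _
  have hκ := contDiff_radialKernel hε hR0
  have hcκ := hasCompactSupport_radialKernel hε hR
  have hη := fun s => contDiff_rescale contDiff_bump s
  have hcη := fun {s : ℝ} (hs : 0 < s) => hasCompactSupport_rescale hasCompactSupport_bump hs
  have hl : ∀ x, lap (cv g (radialKernel ε R)) x
      = cv g (rescale ε bump) x - cv g (rescale R bump) x := by
    intro x
    rw [lap_cv hg.continuous hcg hκ hcκ, lap_radialKernel hε hR0,
      cv_sub_right hg.continuous hcg (hη ε).continuous (hη R).continuous]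
  have hy : ∀ {s : ℝ}, 0 < s → ∫ x, cv g (rescale s bump) x ^ 2 ≤ c ^ 2 * G := by
    intro s hs
    have h1 := integral_sq_cv_le (hη s).continuous (hcη hs) hg.continuous hcg
    rw [integral_abs_rescale _ hs] at h1
    simp only [abs_of_nonneg (bump_nonneg _)] at h1
    rwa [cv_comm g]
  have cc : ∀ s : ℝ, 0 < s → Continuous (cv g (rescale s bump)) := fun s hs =>
    (contDiff_cv hg.continuous (hη s) (hcη hs)).continuous
  have kk : ∀ s : ℝ, 0 < s → HasCompactSupport (cv g (rescale s bump)) := fun s hs =>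
    hasCompactSupport_cv hcg (hcη hs)
  have hw : ∫ x, lap (cv g (radialKernel ε R)) x ^ 2 ≤ (2 * (c * √G)) ^ 2 := by
    have i1 := (integrable_sq_of_compact (cc ε hε) (kk ε hε)).const_mul 2
    have i2 := (integrable_sq_of_compact (cc R hR0) (kk R hR0)).const_mul 2
    calc ∫ x, lap (cv g (radialKernel ε R)) x ^ 2
        ≤ ∫ x, (2 * cv g (rescale ε bump) x ^ 2 + 2 * cv g (rescale R bump) x ^ 2) := by
          refine integral_mono_of_nonneg (Eventually.of_forall fun x => sq_nonneg _) (i1.add i2)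
            (Eventually.of_forall fun x => ?_)
          simp only [hl]
          nlinarith [sq_nonneg (cv g (rescale ε bump) x + cv g (rescale R bump) x)]
      _ = 2 * (∫ x, cv g (rescale ε bump) x ^ 2) + 2 * ∫ x, cv g (rescale R bump) x ^ 2 := by
          rw [integral_add i1 i2, integral_const_mul, integral_const_mul]
      _ ≤ (2 * (c * √G)) ^ 2 := by
          rw [mul_pow, mul_pow, Real.sq_sqrt hG0]
          linarith [hy hε, hy hR0]
  have h1 := H.abs_integral_mul_lap_le ht hγ hSi hS (b := 2 * (c * √G)) (by positivity)
    (contDiff_cv hg.continuous hκ hcκ) (hasCompactSupport_cv hcg hcκ) hw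
  have hp := (contDiff_slice H.smooth_p t).continuous
  simp only [hl, mul_sub] at h1
  rw [integral_sub (integrable_mul_of_compact hp (cc ε hε) (kk ε hε))
    (integrable_mul_of_compact hp (cc R hR0) (kk R hR0))] at h1
  linarith

/-- A space-time bound for the pressure tested against a divergence. -/
theorem IsStokesFlow.pressure_bound (H : IsStokesFlow T v p S)
    (hvi : ∀ t ∈ Set.Icc 0 T, ∀ i, Integrable fun x => v i t x ^ 2)
    (hSi : ∀ t ∈ Set.Icc 0 T, ∀ i l, Integrable fun x => S i l t x ^ 2)
    {α γ : ℝ → ℝ} (hα : ∀ t, 0 ≤ α t) (hαi : IntegrableOn α (Set.Ioc 0 T))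
    (hγ : ∀ t, 0 ≤ γ t) (hγi : IntegrableOn γ (Set.Ioc 0 T))
    (hv : ∀ t ∈ Set.Icc 0 T, ∀ i, ∫ x, v i t x ^ 2 ≤ α t ^ 2)
    (hS : ∀ t ∈ Set.Icc 0 T, ∀ i l, ∫ x, S i l t x ^ 2 ≤ γ t ^ 2)
    {f : Fin 2 → ℝ → V → ℝ} (hf : ∀ i, ContDiff ℝ ∞ (Function.uncurry (f i))) {K : Set V}
    (hK : IsCompact K) (hs : ∀ i t x, x ∉ K → f i t x = 0) {t : ℝ} (ht : t ∈ Set.Icc 0 T) :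
    |∫ s in 0..t, ∫ x, p s x * (pd 0 (f 0 s) x + pd 1 (f 1 s) x)|
      ≤ 8 * ∫ s in 0..t, γ s * √(∫ x, (pd 0 (f 0 s) x + pd 1 (f 1 s) x) ^ 2) := by
  have ht0 := ht.1
  have hfs : ∀ i s, ContDiff ℝ ∞ (f i s) := fun i => contDiff_slice (hf i)
  have hfc : ∀ i s, HasCompactSupport (f i s) := fun i s => HasCompactSupport.intro hK (hs i s)
  set g : ℝ → V → ℝ := fun s x => pd 0 (f 0 s) x + pd 1 (f 1 s) x with hg
  have hgu : ContDiff ℝ ∞ (Function.uncurry g) :=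
    (contDiff_pd_uncurry (hf 0) 0).add (contDiff_pd_uncurry (hf 1) 1)
  have hsub : ∀ i s, tsupport (f i s) ⊆ K := fun i s => closure_minimal
    (fun y hy => by
      by_contra h
      exact hy (hs i s y h)) hK.isClosed
  have hgs : ∀ s x, x ∉ K → g s x = 0 := fun s x hx => by
    simp only [hg]
    rw [pd_eq_zero_of_notMem fun h => hx (hsub 0 s h),
      pd_eq_zero_of_notMem fun h => hx (hsub 1 s h), add_zero]
  have hgc : ∀ s, HasCompactSupport (g s) := fun s => HasCompactSupport.intro hK (hgs s)
  have hgsm : ∀ s, ContDiff ℝ ∞ (g s) := contDiff_slice hgu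
  have hG : Continuous fun s => √(∫ x, g s x ^ 2) :=
    (continuous_integral_of_support (h := fun s x => g s x ^ 2)
      ((continuous_pow 2).comp hgu.continuous) hK
      fun s x hx => by simp [hgs s x hx]).sqrt
  set c := ∫ z, bump z with hc
  have hc0 : 0 < c := integral_bump_pos
  obtain ⟨N, hN0, hN, hN'⟩ : ∃ N, 0 ≤ N ∧ (∀ i, ∀ t ∈ Set.Icc 0 T, ∫ x, |f i t x| ≤ N) ∧
      ∀ i, ∀ t ∈ Set.Icc 0 T, ∫ x, |deriv (fun s => f i s x) t| ≤ N := by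
    have c1 : ∀ i, Continuous fun t => ∫ x, |f i t x| := fun i =>
      continuous_integral_of_support (h := fun t x => |f i t x|) (hf i).continuous.abs hK
        fun s x hx => by simp [hs i s x hx]
    have c2 : ∀ i, Continuous fun t => ∫ x, |deriv (fun s => f i s x) t| := fun i =>
      continuous_integral_of_support (h := fun t x => |deriv (fun s => f i s x) t|)
        (contDiff_deriv_uncurry (hf i)).continuous.abs hK fun s x hx => by
          have : (fun s => f i s x) = fun _ => 0 := funext fun s => hs i s x hx
          simp [this]
    have n1 : ∀ i t, 0 ≤ ∫ x, |f i t x| := fun i t => integral_nonneg fun x => abs_nonneg _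
    have n2 : ∀ i t, 0 ≤ ∫ x, |deriv (fun s => f i s x) t| :=
      fun i t => integral_nonneg fun x => abs_nonneg _
    obtain ⟨N, hN⟩ := (isCompact_Icc (a := (0 : ℝ)) (b := T)).exists_bound_of_continuousOn
      (f := fun t => ((∫ x, |f 0 t x|) + ∫ x, |f 1 t x|)
        + ((∫ x, |deriv (fun s => f 0 s x) t|) + ∫ x, |deriv (fun s => f 1 s x) t|))
      (((c1 0).add (c1 1)).add ((c2 0).add (c2 1))).continuousOn
    have hN2 := fun t ht => (le_abs_self _).trans (hN t ht)
    refine ⟨|N|, abs_nonneg _, fun i t ht => ?_, fun i t ht => ?_⟩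
    · have := hN2 t ht
      have := le_abs_self N
      fin_cases i <;> simp only [Fin.zero_eta, Fin.mk_one] <;>
        linarith [n1 0 t, n1 1 t, n2 0 t, n2 1 t]
    · have := hN2 t ht
      have := le_abs_self N
      fin_cases i <;> simp only [Fin.zero_eta, Fin.mk_one] <;>
        linarith [n1 0 t, n1 1 t, n2 0 t, n2 1 t]
  obtain ⟨C, hC0, hC, hC1, hC2⟩ : ∃ C, 0 ≤ C ∧ ∫ x, bump x ^ 2 ≤ C ^ 2 ∧
      (∀ l, ∫ x, pd l bump x ^ 2 ≤ C ^ 2) ∧ ∫ x, lap bump x ^ 2 ≤ C ^ 2 := by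
    have n0 : ∀ k : V → ℝ, 0 ≤ ∫ x, k x ^ 2 := fun k => integral_nonneg fun x => sq_nonneg _
    have n1 := n0 bump
    have n2 := n0 (pd 0 bump)
    have n3 := n0 (pd 1 bump)
    have n4 := n0 (lap bump)
    refine ⟨√((∫ x, bump x ^ 2) + (∫ x, pd 0 bump x ^ 2) + (∫ x, pd 1 bump x ^ 2)
      + ∫ x, lap bump x ^ 2), Real.sqrt_nonneg _, ?_⟩
    rw [Real.sq_sqrt (by positivity)]
    refine ⟨by linarith, fun l => ?_, by linarith⟩
    fin_cases l <;> simp only [Fin.zero_eta, Fin.mk_one] <;> linarith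
  have hiv : ∀ {β : ℝ → ℝ}, IntegrableOn β (Set.Ioc 0 T) → IntervalIntegrable β volume 0 t := by
    intro β hβ
    rw [intervalIntegrable_iff_integrableOn_Ioc_of_le ht0]
    exact hβ.mono_set (Set.Ioc_subset_Ioc_right ht.2)
  set Q := 4 * (∫ s in 0..t, (α s + γ s)) + (α t + γ t) + (α 0 + γ 0) with hQ
  have hη := fun s => contDiff_rescale contDiff_bump s
  have hcη := fun {s : ℝ} (hs : 0 < s) => hasCompactSupport_rescale hasCompactSupport_bump hs
  have hpc : ∀ {s : ℝ} (_ : 0 < s) {k : ℝ → V → ℝ}, ContDiff ℝ ∞ (Function.uncurry k) →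
      (∀ t x, x ∉ K → k t x = 0) →
      Continuous fun τ => ∫ x, p τ x * cv (k τ) (rescale s bump) x := by
    intro s h0 k hk hks
    exact continuous_integral_of_support (h := fun τ x => p τ x * cv (k τ) (rescale s bump) x)
      (H.smooth_p.continuous.mul (contDiff_cv_uncurry hk hK hks (hη s).continuous).continuous)
      (hK.add (hcη h0)) fun τ x hx => by rw [cv_eq_zero (hks τ) hx, mul_zero]
  have hfar : ∀ R, 1 ≤ R → |∫ s in 0..t, ∫ x, p s x * cv (g s) (rescale R bump) x|
      ≤ 2 * (N * (R⁻¹ * C) * Q) := by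
    intro R hR
    have hR0 : 0 < R := by linarith
    obtain ⟨b0, b1, b2⟩ := integral_rescale_bump_sq_le hR hC hC1 hC2
    have hb := fun i => H.far_pressure hvi hSi (B := fun s => α s + γ s)
      (fun s => add_nonneg (hα s) (hγ s)) (hαi.add hγi)
      (fun s h i => (hv s h i).trans (pow_le_pow_left₀ (hα s) (by linarith [hγ s]) 2))
      (fun s h i l => (hS s h i l).trans (pow_le_pow_left₀ (hγ s) (by linarith [hα s]) 2))
      (hf i) hK (hs i) hN0 (hN i) (hN' i) (hη R) (hcη hR0)
      (mul_nonneg (inv_nonneg.2 hR0.le) hC0) b0 b1 b2 i ht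
    have hdi : ∀ i s x, x ∉ K → pd i (f i s) x = 0 := fun i s x hx =>
      pd_eq_zero_of_notMem (fun h => hx (hsub i s h)) i
    have e1 : ∀ i s, pd i (cv (f i s) (rescale R bump)) = cv (pd i (f i s)) (rescale R bump) := by
      intro i s
      rw [cv_pd (hfs i s) (hfc i s) (hη R) (hcη hR0), pd_cv (hfs i s).continuous (hη R) (hcη hR0)]
    have e2 : ∀ s, ∫ x, p s x * cv (g s) (rescale R bump) x
        = (∫ x, p s x * pd 0 (cv (f 0 s) (rescale R bump)) x)
          + ∫ x, p s x * pd 1 (cv (f 1 s) (rescale R bump)) x := by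
      intro s
      have hpd := fun i => contDiff_pd (hfs i s) i
      have hcd := fun i => hasCompactSupport_pd (hfc i s) i
      have e3 : ∀ x, cv (g s) (rescale R bump) x = cv (pd 0 (f 0 s)) (rescale R bump) x
          + cv (pd 1 (f 1 s)) (rescale R bump) x := by
        intro x
        rw [cv_comm, cv_add_right (hη R).continuous (hcη hR0) (hpd 0).continuous
          (hpd 1).continuous, cv_comm, cv_comm (rescale R bump) (pd 1 (f 1 s))]
      have hi := fun i => integrable_mul_of_compact (contDiff_slice H.smooth_p s).continuous
        (contDiff_cv (hpd i).continuous (hη R) (hcη hR0)).continuous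
        (hasCompactSupport_cv (hcd i) (hcη hR0))
      simp only [e1, e3, mul_add]
      exact integral_add (hi 0) (hi 1)
    have cont : ∀ i, Continuous fun s => ∫ x, p s x * pd i (cv (f i s) (rescale R bump)) x := by
      intro i
      simp only [e1]
      exact hpc hR0 (contDiff_pd_uncurry (hf i) i) (hdi i)
    simp only [e2]
    rw [intervalIntegral.integral_add ((cont 0).intervalIntegrable _ _)
      ((cont 1).intervalIntegrable _ _)]
    refine (abs_add_le _ _).trans ?_
    linarith [hb 0, hb 1]
  obtain ⟨Φ, hΦ, hΦ0, hΦε⟩ := exists_continuous_mollified H.smooth_p.continuous hgu.continuous hK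
    hgs t
  have hγG : IntervalIntegrable (fun s => γ s * √(∫ x, g s x ^ 2)) volume 0 t :=
    (hiv hγi).mul_continuousOn hG.continuousOn
  have hnear : ∀ ε R, 0 < ε → ε ≤ 1 → 1 ≤ R →
      |Φ ε| ≤ 8 * c * (∫ s in 0..t, γ s * √(∫ x, g s x ^ 2)) + 2 * (N * (R⁻¹ * C) * Q) := by
    intro ε R h0 h1 hR
    have hR0 : 0 < R := by linarith
    have hd : |∫ s in 0..t, ((∫ x, p s x * cv (g s) (rescale ε bump) x)
        - ∫ x, p s x * cv (g s) (rescale R bump) x)|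
        ≤ ∫ s in 0..t, 8 * c * (γ s * √(∫ x, g s x ^ 2)) := by
      rw [← Real.norm_eq_abs]
      refine intervalIntegral.norm_integral_le_of_norm_le ht0 ?_ (hγG.const_mul _)
      filter_upwards [Measure.ae_ne volume T] with s hsT hs'
      have h' : s ∈ Set.Icc 0 T := ⟨hs'.1.le, hs'.2.trans ht.2⟩
      exact H.near_pressure ⟨hs'.1, lt_of_le_of_ne h'.2 hsT⟩ (hγ s) (hSi s h') (hS s h')
        (hgsm s) (hgc s) h0 (h1.trans hR)
    rw [intervalIntegral.integral_sub ((hpc h0 hgu hgs).intervalIntegrable _ _)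
      ((hpc hR0 hgu hgs).intervalIntegrable _ _), ← hΦε ε h0 h1,
      intervalIntegral.integral_const_mul] at hd
    have h2 := abs_le.1 hd
    have h3 := abs_le.1 (hfar R hR)
    rw [abs_le]
    constructor <;> linarith [h2.1, h2.2, h3.1, h3.2]
  have hlim : ∀ R, 1 ≤ R → |Φ 0|
      ≤ 8 * c * (∫ s in 0..t, γ s * √(∫ x, g s x ^ 2)) + 2 * (N * (R⁻¹ * C) * Q) := by
    intro R hR
    have h1 : Tendsto (fun ε => |Φ ε|) (nhdsWithin 0 (Set.Ioi 0)) (nhds |Φ 0|) :=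
      (hΦ.abs.tendsto 0).mono_left nhdsWithin_le_nhds
    refine le_of_tendsto h1 ?_
    filter_upwards [Ioc_mem_nhdsGT (zero_lt_one' ℝ)] with ε hε using hnear ε R hε.1 hε.2 hR
  have hlim2 : |Φ 0| ≤ 8 * c * (∫ s in 0..t, γ s * √(∫ x, g s x ^ 2)) := by
    have h1 : Tendsto (fun R : ℝ => 8 * c * (∫ s in 0..t, γ s * √(∫ x, g s x ^ 2))
        + 2 * (N * (R⁻¹ * C) * Q)) atTop
        (nhds (8 * c * (∫ s in 0..t, γ s * √(∫ x, g s x ^ 2)) + 2 * (N * (0 * C) * Q))) :=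
      (((((tendsto_inv_atTop_zero (𝕜 := ℝ)).mul_const C).const_mul N).mul_const Q).const_mul
        2).const_add _
    have h2 := ge_of_tendsto h1 (by
      filter_upwards [eventually_ge_atTop 1] with R hR using hlim R hR)
    simpa using h2
  rw [hΦ0, abs_mul, abs_of_pos hc0] at hlim2
  refine le_of_mul_le_mul_left ?_ hc0
  linarith

end NearPressure

section Cutoff

/-- Fatou's lemma for real integrals. -/
theorem integral_le_of_tendsto {α : Type*} [MeasurableSpace α] {μ : Measure α} {g : ℕ → α → ℝ}
    {h : α → ℝ} (hh : AEStronglyMeasurable h μ) (hi : ∀ n, Integrable (g n) μ)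
    (h0 : ∀ n x, 0 ≤ g n x) (ht : ∀ᵐ x ∂μ, Tendsto (fun n => g n x) atTop (nhds (h x))) {M : ℝ}
    (hM : ∀ n, ∫ x, g n x ∂μ ≤ M) : Integrable h μ ∧ ∫ x, h x ∂μ ≤ M := by
  have hM0 : 0 ≤ M := (integral_nonneg (h0 0)).trans (hM 0)
  have hh0 : 0 ≤ᵐ[μ] h := by
    filter_upwards [ht] with x hx using ge_of_tendsto' hx fun n => h0 n x
  have hle : ∫⁻ x, ENNReal.ofReal (h x) ∂μ ≤ ENNReal.ofReal M := by
    calc ∫⁻ x, ENNReal.ofReal (h x) ∂μ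
        = ∫⁻ x, liminf (fun n => ENNReal.ofReal (g n x)) atTop ∂μ := by
          refine lintegral_congr_ae ?_
          filter_upwards [ht] with x hx
          exact ((ENNReal.continuous_ofReal.tendsto _).comp hx).liminf_eq.symm
      _ ≤ liminf (fun n => ∫⁻ x, ENNReal.ofReal (g n x) ∂μ) atTop :=
          lintegral_liminf_le' fun n => (hi n).aestronglyMeasurable.aemeasurable.ennreal_ofReal
      _ ≤ ENNReal.ofReal M := by
          refine liminf_le_of_le (by isBoundedDefault) fun b hb => ?_
          obtain ⟨n, hn⟩ := hb.exists
          refine hn.trans ?_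
          rw [← ofReal_integral_eq_lintegral_ofReal (hi n) (Eventually.of_forall (h0 n))]
          exact ENNReal.ofReal_le_ofReal (hM n)
  have hintg : Integrable h μ := by
    refine ⟨hh, ?_⟩
    rw [hasFiniteIntegral_iff_ofReal hh0]
    exact hle.trans_lt ENNReal.ofReal_lt_top
  refine ⟨hintg, ?_⟩
  rw [← ofReal_integral_eq_lintegral_ofReal hintg hh0] at hle
  exact (ENNReal.ofReal_le_ofReal_iff hM0).1 hle

/-- A smooth cutoff equal to `1` for `|x| ≤ n + 1` and to `0` for `2 (n + 1)² ≤ |x|²`. -/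
def cutoff (n : ℕ) (x : V) : ℝ :=
  Real.smoothTransition (2 - vnsq x * (((n : ℝ) + 1) ^ 2)⁻¹) ^ 2

theorem contDiff_cutoff (n : ℕ) : ContDiff ℝ ∞ (cutoff n) :=
  (Real.smoothTransition.contDiff.comp (contDiff_const.sub (contDiff_vnsq.mul contDiff_const))).pow 2

theorem cutoff_nonneg (n : ℕ) (x : V) : 0 ≤ cutoff n x := sq_nonneg _

theorem cutoff_le_one (n : ℕ) (x : V) : cutoff n x ≤ 1 :=
  pow_le_one₀ (Real.smoothTransition.nonneg _) (Real.smoothTransition.le_one _)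

theorem cutoff_eq_zero {n : ℕ} {x : V} (h : 2 * ((n : ℝ) + 1) ^ 2 < vnsq x) : cutoff n x = 0 := by
  rw [cutoff, Real.smoothTransition.zero_of_nonpos, zero_pow two_ne_zero]
  rw [← div_eq_mul_inv, sub_nonpos, le_div_iff₀ (by positivity)]
  exact h.le

theorem hasCompactSupport_cutoff (n : ℕ) : HasCompactSupport (cutoff n) :=
  hasCompactSupport_of_vnsq _ fun _ => cutoff_eq_zero

theorem tendsto_cutoff (x : V) : Tendsto (fun n => cutoff n x) atTop (nhds 1) := by
  refine tendsto_const_nhds.congr' ?_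
  obtain ⟨N, hN⟩ := exists_nat_ge (vnsq x)
  filter_upwards [eventually_ge_atTop N] with n hn
  have h1 : (N : ℝ) ≤ n := by exact_mod_cast hn
  have h2 : (0 : ℝ) ≤ N := N.cast_nonneg
  rw [cutoff, Real.smoothTransition.one_of_one_le, one_pow]
  have : vnsq x * (((n : ℝ) + 1) ^ 2)⁻¹ ≤ 1 := by
    rw [← div_eq_mul_inv, div_le_one (by positivity)]
    nlinarith
  linarith

theorem exists_deriv_smoothTransition_le : ∃ D, 0 ≤ D ∧
    ∀ r, |deriv Real.smoothTransition r| ≤ D := by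
  have hc : Continuous (deriv Real.smoothTransition) :=
    (contDiff_infty_iff_deriv.1 Real.smoothTransition.contDiff).2.continuous
  obtain ⟨D, hD⟩ := (isCompact_Icc (a := (0 : ℝ)) (b := 1)).exists_bound_of_continuousOn
    hc.continuousOn
  refine ⟨|D|, abs_nonneg _, fun r => ?_⟩
  by_cases h0 : r < 0
  · have : Real.smoothTransition =ᶠ[nhds r] fun _ => 0 := by
      filter_upwards [Iio_mem_nhds h0] with y hy
        using Real.smoothTransition.zero_of_nonpos (le_of_lt hy)
    simp [this.deriv_eq]
  by_cases h1 : 1 < r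
  · have : Real.smoothTransition =ᶠ[nhds r] fun _ => 1 := by
      filter_upwards [Ioi_mem_nhds h1] with y hy
        using Real.smoothTransition.one_of_one_le (le_of_lt hy)
    simp [this.deriv_eq]
  · exact (hD r ⟨not_lt.1 h0, not_lt.1 h1⟩).trans (le_abs_self D)

theorem exists_grad_cutoff_le : ∃ K, 0 ≤ K ∧ ∀ n x,
    pd 0 (cutoff n) x ^ 2 + pd 1 (cutoff n) x ^ 2 ≤ K * (((n : ℝ) + 1) ^ 2)⁻¹ * cutoff n x := by
  obtain ⟨D, hD0, hD⟩ := exists_deriv_smoothTransition_le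
  refine ⟨32 * D ^ 2, by positivity, fun n x => ?_⟩
  set m : ℝ := (((n : ℝ) + 1) ^ 2)⁻¹ with hm
  have hm0 : 0 < m := by positivity
  set L : ℝ → ℝ := fun r => Real.smoothTransition (2 - r * m) ^ 2 with hL
  have hs : Differentiable ℝ Real.smoothTransition :=
    (Real.smoothTransition.contDiff (n := 1)).differentiable (by simp)
  have hLd : ∀ r, HasDerivAt L (2 * Real.smoothTransition (2 - r * m)
      * (deriv Real.smoothTransition (2 - r * m) * (-m))) r := by
    intro r
    have h1 : HasDerivAt (fun r : ℝ => 2 - r * m) (-m) r := by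
      simpa using ((hasDerivAt_id r).mul_const m).const_sub 2
    have h2 := (hs (2 - r * m)).hasDerivAt.comp r h1
    simpa using! h2.pow 2
  have hp : ∀ i, pd i (cutoff n) x = 2 * Real.smoothTransition (2 - vnsq x * m)
      * (deriv Real.smoothTransition (2 - vnsq x * m) * (-m)) * (2 * x i) := by
    intro i
    have := pd_comp (L := L) (f := vnsq) (x := x) (hLd _).differentiableAt
      (contDiff_vnsq.differentiable (by simp) x) i
    rw [(hLd _).deriv, pd_vnsq] at this
    exact this
  rw [hp, hp]
  set s := Real.smoothTransition (2 - vnsq x * m) with hs'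
  set d := deriv Real.smoothTransition (2 - vnsq x * m) with hd
  have hd2 : d ^ 2 ≤ D ^ 2 := by
    rw [← sq_abs d]
    exact pow_le_pow_left₀ (abs_nonneg _) (hD _) 2
  have hcut : cutoff n x = s ^ 2 := rfl
  have hv : vnsq x = x 0 ^ 2 + x 1 ^ 2 := by simp [vnsq]
  by_cases h : 2 * ((n : ℝ) + 1) ^ 2 < vnsq x
  · have h0 : s ^ 2 = 0 := by rw [← hcut, cutoff_eq_zero h]
    have h0' : s = 0 := by simpa using h0
    rw [hcut, h0']
    simp
  · have h1 : vnsq x * m ≤ 2 := by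
      rw [hm, ← div_eq_mul_inv, div_le_iff₀ (by positivity)]
      exact not_lt.1 h
    rw [hcut]
    calc (2 * s * (d * -m) * (2 * x 0)) ^ 2 + (2 * s * (d * -m) * (2 * x 1)) ^ 2
        = 16 * (s ^ 2 * m) * (d ^ 2 * (vnsq x * m)) := by rw [hv]; ring
      _ ≤ 16 * (s ^ 2 * m) * (D ^ 2 * 2) := by
        have := vnsq_nonneg x
        gcongr
      _ = _ := by ring

/-- The cutoff multiplied by the weight `1 + |x|²`. -/
def wcutoff (n : ℕ) (x : V) : ℝ := (1 + vnsq x) * cutoff n x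

theorem contDiff_wcutoff (n : ℕ) : ContDiff ℝ ∞ (wcutoff n) :=
  (contDiff_const.add contDiff_vnsq).mul (contDiff_cutoff n)

theorem hasCompactSupport_wcutoff (n : ℕ) : HasCompactSupport (wcutoff n) :=
  (hasCompactSupport_cutoff n).mul_left

theorem wcutoff_nonneg (n : ℕ) (x : V) : 0 ≤ wcutoff n x :=
  mul_nonneg (by linarith [vnsq_nonneg x]) (cutoff_nonneg n x)

theorem wcutoff_le (n : ℕ) (x : V) : wcutoff n x ≤ 1 + vnsq x :=
  mul_le_of_le_one_right (by linarith [vnsq_nonneg x]) (cutoff_le_one n x)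

theorem exists_grad_wcutoff_le : ∃ K, 0 ≤ K ∧ ∀ n x,
    pd 0 (wcutoff n) x ^ 2 + pd 1 (wcutoff n) x ^ 2 ≤ K * wcutoff n x := by
  obtain ⟨K, hK0, hK⟩ := exists_grad_cutoff_le
  refine ⟨8 + 6 * K, by positivity, fun n x => ?_⟩
  have dv : Differentiable ℝ vnsq := contDiff_vnsq.differentiable (by simp)
  have dc : Differentiable ℝ (cutoff n) := (contDiff_cutoff n).differentiable (by simp)
  have hp : ∀ i, pd i (wcutoff n) x
      = (1 + vnsq x) * pd i (cutoff n) x + cutoff n x * (2 * x i) := by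
    intro i
    have h1 := pd_mul (f := fun y => 1 + vnsq y) (g := cutoff n) (x := x)
      ((dv x).const_add 1) (dc x) i
    rw [pd_add (f := fun _ => 1) (by fun_prop) (dv x), pd_const, pd_vnsq, zero_add] at h1
    exact h1
  have hv0 := vnsq_nonneg x
  have hv : vnsq x = x 0 ^ 2 + x 1 ^ 2 := by simp [vnsq]
  have c0 := cutoff_nonneg n x
  have c1 := cutoff_le_one n x
  have key : (1 + vnsq x) ^ 2 * (pd 0 (cutoff n) x ^ 2 + pd 1 (cutoff n) x ^ 2)
      ≤ 3 * K * wcutoff n x := by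
    rw [wcutoff]
    have h1 := hK n x
    by_cases h : 2 * ((n : ℝ) + 1) ^ 2 < vnsq x
    · rw [cutoff_eq_zero h] at h1 ⊢
      simp only [mul_zero] at h1 ⊢
      exact mul_nonpos_of_nonneg_of_nonpos (sq_nonneg _) h1
    · have hm : (1 + vnsq x) * (((n : ℝ) + 1) ^ 2)⁻¹ ≤ 3 := by
        rw [← div_eq_mul_inv, div_le_iff₀ (by positivity)]
        have := not_lt.1 h
        have : (0 : ℝ) ≤ n := n.cast_nonneg
        nlinarith
      calc (1 + vnsq x) ^ 2 * (pd 0 (cutoff n) x ^ 2 + pd 1 (cutoff n) x ^ 2)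
          ≤ (1 + vnsq x) ^ 2 * (K * (((n : ℝ) + 1) ^ 2)⁻¹ * cutoff n x) := by gcongr
        _ = ((1 + vnsq x) * (((n : ℝ) + 1) ^ 2)⁻¹) * (K * ((1 + vnsq x) * cutoff n x)) := by ring
        _ ≤ 3 * (K * ((1 + vnsq x) * cutoff n x)) := by gcongr
        _ = _ := by ring
  have key2 : cutoff n x ^ 2 * vnsq x ≤ wcutoff n x := by
    rw [wcutoff, sq]
    nlinarith [mul_nonneg c0 hv0, mul_nonneg (mul_nonneg c0 hv0) (sub_nonneg.2 c1)]
  rw [hp, hp]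
  have e : 4 * (cutoff n x ^ 2 * vnsq x)
      = (cutoff n x * (2 * x 0)) ^ 2 + (cutoff n x * (2 * x 1)) ^ 2 := by rw [hv]; ring
  nlinarith [sq_nonneg ((1 + vnsq x) * pd 0 (cutoff n) x - cutoff n x * (2 * x 0)),
    sq_nonneg ((1 + vnsq x) * pd 1 (cutoff n) x - cutoff n x * (2 * x 1))]

end Cutoff

section Inequalities

theorem hardy {f : V → ℝ} (hf : ContDiff ℝ ∞ f)
    (h0 : Integrable fun x => (1 + vnsq x) * f x ^ 2)
    (h1 : Integrable fun x => (1 + vnsq x) * pd 0 f x ^ 2) :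
    ∫ x, f x ^ 2 ≤ 4 * ∫ x, (1 + vnsq x) * pd 0 f x ^ 2 := by
  have hfd : Differentiable ℝ f := hf.differentiable (by simp)
  have cf := hf.continuous
  have cd := continuous_pd hf 0
  have cv := contDiff_vnsq.continuous
  have hv : ∀ x : V, vnsq x = x 0 ^ 2 + x 1 ^ 2 := fun x => by simp [vnsq]
  have i0 : Integrable fun x => f x ^ 2 := by
    refine h0.mono' (by fun_prop) (Eventually.of_forall fun x => ?_)
    rw [Real.norm_of_nonneg (sq_nonneg _)]
    nlinarith [sq_nonneg (f x), mul_nonneg (vnsq_nonneg x) (sq_nonneg (f x))]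
  have i1 : Integrable fun x => x 0 * f x ^ 2 := by
    refine h0.mono' (by fun_prop) (Eventually.of_forall fun x => ?_)
    rw [Real.norm_eq_abs, abs_mul, abs_of_nonneg (sq_nonneg (f x)), hv]
    refine mul_le_mul_of_nonneg_right ?_ (sq_nonneg _)
    rw [abs_le]
    constructor <;> nlinarith [sq_nonneg (x 0 + 1), sq_nonneg (x 0 - 1), sq_nonneg (x 1)]
  have i2 : Integrable fun x => x 0 * (f x * pd 0 f x) := by
    refine (i0.add h1).mono' (by fun_prop) (Eventually.of_forall fun x => ?_)
    simp only [Pi.add_apply, Real.norm_eq_abs, hv]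
    rw [abs_le]
    constructor <;> nlinarith [sq_nonneg (f x + x 0 * pd 0 f x), sq_nonneg (f x - x 0 * pd 0 f x),
      sq_nonneg (x 1 * pd 0 f x), sq_nonneg (pd 0 f x), sq_nonneg (f x),
      sq_nonneg (x 0 * pd 0 f x)]
  have e : ∀ x, pd 0 (fun y => y 0 * f y ^ 2) x = f x ^ 2 + 2 * (x 0 * (f x * pd 0 f x)) := by
    intro x
    have := pd_mul (f := fun y : V => y 0) (g := fun y => f y * f y) (x := x) (by fun_prop)
      ((hfd x).mul (hfd x)) 0
    rw [pd_mul (hfd x) (hfd x), pd_coord] at this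
    simp only [← sq] at this
    rw [this]
    simp
    ring
  have hz := integral_pd_eq_zero (f := fun y => y 0 * f y ^ 2)
    ((by fun_prop : Differentiable ℝ fun y : V => y 0).mul (hfd.pow 2)) i1 0
    ((i0.add (i2.const_mul 2)).congr (Eventually.of_forall fun x => (e x).symm))
  simp only [e] at hz
  rw [integral_add i0 (i2.const_mul 2), integral_const_mul] at hz
  have hb : -(4 * ∫ x, x 0 * (f x * pd 0 f x))
      ≤ (∫ x, f x ^ 2) + 4 * ∫ x, (1 + vnsq x) * pd 0 f x ^ 2 := by
    rw [← integral_const_mul, ← integral_const_mul, ← integral_neg,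
      ← integral_add i0 (h1.const_mul 4)]
    refine integral_mono (i2.const_mul 4).neg (i0.add (h1.const_mul 4)) fun x => ?_
    simp only [hv]
    nlinarith [sq_nonneg (f x + 2 * (x 0 * pd 0 f x)), sq_nonneg (x 1 * pd 0 f x),
      sq_nonneg (pd 0 f x)]
  linarith

theorem norm_fderiv_le (f : V → ℝ) (x : V) : ‖fderiv ℝ f x‖ ≤ |pd 0 f x| + |pd 1 f x| := by
  refine ContinuousLinearMap.opNorm_le_bound _ (by positivity) fun y => ?_
  have hy : y = y 0 • (Pi.single 0 1 : V) + y 1 • (Pi.single 1 1 : V) := by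
    funext j
    fin_cases j <;> simp
  have h : fderiv ℝ f x y = y 0 * pd 0 f x + y 1 * pd 1 f x := by
    conv_lhs => rw [hy]
    simp [pd]
  have h0 : |y 0| ≤ ‖y‖ := norm_le_pi_norm y 0
  have h1 : |y 1| ≤ ‖y‖ := norm_le_pi_norm y 1
  rw [h, Real.norm_eq_abs]
  refine (abs_add_le _ _).trans ?_
  rw [abs_mul, abs_mul, add_mul, mul_comm |pd 0 f x|, mul_comm |pd 1 f x|]
  gcongr

theorem exists_sobolev : ∃ C, 0 ≤ C ∧ ∀ q : V → ℝ, ContDiff ℝ ∞ q → HasCompactSupport q →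
    ∫ x, q x ^ 2 ≤ C * (∫ x, (|pd 0 q x| + |pd 1 q x|)) ^ 2 := by
  refine ⟨lintegralPowLePowLIntegralFDerivConst (volume : Measure V) 2, NNReal.coe_nonneg _,
    fun q hq hc => ?_⟩
  have h := lintegral_pow_le_pow_lintegral_fderiv (volume : Measure V) (u := q)
    (hq.of_le (by simp)) hc (p := 2) (by simpa using Real.HolderConjugate.two_two)
  have c : ∀ i, Integrable fun x => |pd i q x| := fun i =>
    ((continuous_pd hq i).integrable_of_hasCompactSupport (hasCompactSupport_pd hc i)).abs
  have n : ∀ x, 0 ≤ |pd 0 q x| + |pd 1 q x| := fun x => by positivity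
  have e1 : ∫⁻ x, ‖q x‖ₑ ^ (2 : ℝ) = ENNReal.ofReal (∫ x, q x ^ 2) := by
    rw [ofReal_integral_eq_lintegral_ofReal (integrable_sq_of_compact hq.continuous hc)
      (Eventually.of_forall fun x => sq_nonneg _)]
    congr 1
    funext x
    rw [← ofReal_norm, ENNReal.rpow_two, ← ENNReal.ofReal_pow (norm_nonneg _),
      Real.norm_eq_abs, sq_abs]
  have e2 : ∫⁻ x, ‖fderiv ℝ q x‖ₑ ≤ ENNReal.ofReal (∫ x, (|pd 0 q x| + |pd 1 q x|)) := by
    have c01 : Integrable fun x => |pd 0 q x| + |pd 1 q x| := (c 0).add (c 1)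
    rw [ofReal_integral_eq_lintegral_ofReal c01 (Eventually.of_forall n)]
    refine lintegral_mono fun x => ?_
    rw [← ofReal_norm]
    exact ENNReal.ofReal_le_ofReal (norm_fderiv_le q x)
  have n2 : 0 ≤ ∫ x, (|pd 0 q x| + |pd 1 q x|) := integral_nonneg n
  rw [e1] at h
  have h2 := h.trans (mul_le_mul_right (ENNReal.rpow_le_rpow e2 (by norm_num : (0 : ℝ) ≤ 2)) _)
  rw [ENNReal.rpow_two, ← ENNReal.ofReal_pow n2, ← ENNReal.ofReal_coe_nnreal,
    ← ENNReal.ofReal_mul (NNReal.coe_nonneg _)] at h2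
  exact (ENNReal.ofReal_le_ofReal_iff (by positivity)).1 h2

end Inequalities

section Tools

theorem abs_integral_le_sqrt_mul_sqrt {α : Type*} [MeasurableSpace α] {μ : Measure α}
    {f A B : α → ℝ} (hA : Integrable A μ) (hB : Integrable B μ) (hA0 : ∀ x, 0 ≤ A x)
    (hB0 : ∀ x, 0 ≤ B x) (h : ∀ x, f x ^ 2 ≤ A x * B x) :
    |∫ x, f x ∂μ| ≤ √(∫ x, A x ∂μ) * √(∫ x, B x ∂μ) := by
  have eA : (fun x => √(A x) ^ 2) = A := funext fun x => Real.sq_sqrt (hA0 x)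
  have eB : (fun x => √(B x) ^ 2) = B := funext fun x => Real.sq_sqrt (hB0 x)
  have hcs := sq_integral_mul_le (f := fun x => √(A x)) (g := fun x => √(B x)) (μ := μ)
    (Real.continuous_sqrt.comp_aestronglyMeasurable hA.aestronglyMeasurable)
    (Real.continuous_sqrt.comp_aestronglyMeasurable hB.aestronglyMeasurable)
    (by rw [eA]; exact hA) (by rw [eB]; exact hB)
  rw [eA, eB] at hcs
  refine le_trans ?_ hcs.2
  rw [← Real.norm_eq_abs]
  refine norm_integral_le_of_norm_le hcs.1.abs (Eventually.of_forall fun x => ?_)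
  rw [Real.norm_eq_abs, ← Real.sqrt_mul (hA0 x), abs_of_nonneg (Real.sqrt_nonneg _)]
  exact Real.abs_le_sqrt (h x)

theorem exists_ladyzhenskaya : ∃ C, 0 ≤ C ∧ ∀ f : V → ℝ, ContDiff ℝ ∞ f →
    (Integrable fun x => f x ^ 2) → (∀ i, Integrable fun x => pd i f x ^ 2) →
    (Integrable fun x => f x ^ 4) ∧ ∫ x, f x ^ 4
      ≤ C * ((∫ x, f x ^ 2) * ((∫ x, f x ^ 2) + ((∫ x, pd 0 f x ^ 2) + ∫ x, pd 1 f x ^ 2))) := by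
  obtain ⟨C, hC0, hC⟩ := exists_sobolev
  obtain ⟨K, hK0, hK⟩ := exists_grad_cutoff_le
  refine ⟨C * (12 * (K + 1)), by positivity, fun f hf h0 h1 => ?_⟩
  have hfd : Differentiable ℝ f := hf.differentiable (by simp)
  have cpos : 0 ≤ ∫ x, f x ^ 2 := integral_nonneg fun _ => sq_nonneg _
  have bpos : ∀ i, 0 ≤ ∫ x, pd i f x ^ 2 := fun i => integral_nonneg fun _ => sq_nonneg _
  have hcs := fun i => sq_integral_mul_le (μ := volume) hf.continuous.aestronglyMeasurable
    (continuous_pd hf i).aestronglyMeasurable h0 (h1 i)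
  have hq : ∀ n, ContDiff ℝ ∞ fun x => cutoff n x * (f x * f x) := fun n =>
    (contDiff_cutoff n).mul (hf.mul hf)
  have hqc : ∀ n, HasCompactSupport fun x => cutoff n x * (f x * f x) := fun n =>
    (hasCompactSupport_cutoff n).mul_right
  refine integral_le_of_tendsto (g := fun n x => (cutoff n x * (f x * f x)) ^ 2)
    ((continuous_pow 4).comp hf.continuous).aestronglyMeasurable
    (fun n => integrable_sq_of_compact (hq n).continuous (hqc n)) (fun n x => sq_nonneg _)
    (Eventually.of_forall fun x => ?_) fun n => ?_
  · have := ((tendsto_cutoff x).mul_const (f x * f x)).pow 2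
    convert this using 2
    simp only [Function.comp_apply]
    ring
  · refine (hC _ (hq n) (hqc n)).trans ?_
    rw [mul_assoc]
    refine mul_le_mul_of_nonneg_left ?_ hC0
    have hgrad : ∀ i x, |pd i (cutoff n) x| ≤ √K := by
      intro i x
      refine Real.abs_le_sqrt ?_
      have h1 : K * (((n : ℝ) + 1) ^ 2)⁻¹ * cutoff n x ≤ K * 1 * 1 := by
        have : (((n : ℝ) + 1) ^ 2)⁻¹ ≤ 1 := inv_le_one_of_one_le₀ (by
          have : (0 : ℝ) ≤ n := n.cast_nonneg
          nlinarith)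
        gcongr
        · exact cutoff_nonneg n x
        · exact cutoff_le_one n x
      have := hK n x
      fin_cases i
      · change pd 0 (cutoff n) x ^ 2 ≤ K
        nlinarith [sq_nonneg (pd 1 (cutoff n) x)]
      · change pd 1 (cutoff n) x ^ 2 ≤ K
        nlinarith [sq_nonneg (pd 0 (cutoff n) x)]
    have hpt : ∀ i x, |pd i (fun y => cutoff n y * (f y * f y)) x|
        ≤ √K * f x ^ 2 + 2 * |f x * pd i f x| := by
      intro i x
      rw [pd_mul (f := cutoff n) (g := fun y => f y * f y)
        ((contDiff_cutoff n).differentiable (by simp) x) ((hfd x).mul (hfd x)),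
        pd_mul (hfd x) (hfd x)]
      have e : cutoff n x * (f x * pd i f x + f x * pd i f x) + f x * f x * pd i (cutoff n) x
          = pd i (cutoff n) x * f x ^ 2 + 2 * (cutoff n x * (f x * pd i f x)) := by ring
      rw [e]
      refine (abs_add_le _ _).trans ?_
      rw [abs_mul, abs_mul, abs_mul (cutoff n x), abs_of_nonneg (sq_nonneg (f x)),
        abs_of_nonneg (cutoff_nonneg n x), abs_two]
      gcongr
      · exact hgrad i x
      · exact mul_le_of_le_one_left (abs_nonneg _) (cutoff_le_one n x)
    have c : ∀ i, Integrable fun x => |pd i (fun y => cutoff n y * (f y * f y)) x| := fun i =>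
      ((continuous_pd (hq n) i).integrable_of_hasCompactSupport (hasCompactSupport_pd (hqc n) i)).abs
    have i0 := h0.const_mul (√K)
    have i1 := fun i => (hcs i).1.abs.const_mul 2
    have hle : ∀ i, ∫ x, |pd i (fun y => cutoff n y * (f y * f y)) x|
        ≤ √K * (∫ x, f x ^ 2) + 2 * (√(∫ x, f x ^ 2) * √(∫ x, pd i f x ^ 2)) := by
      intro i
      refine (integral_mono (c i) (i0.add (i1 i)) (hpt i)).trans ?_
      simp only [Pi.add_apply]
      rw [integral_add i0 (i1 i), integral_const_mul, integral_const_mul]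
      linarith [(hcs i).2]
    rw [integral_add (c 0) (c 1)]
    have n0 : ∀ i, 0 ≤ ∫ x, |pd i (fun y => cutoff n y * (f y * f y)) x| := fun i =>
      integral_nonneg fun _ => abs_nonneg _
    refine (pow_le_pow_left₀ (add_nonneg (n0 0) (n0 1)) (add_le_add (hle 0) (hle 1)) 2).trans ?_
    set a := √(∫ x, f x ^ 2) with ha
    set b := √(∫ x, pd 0 f x ^ 2) with hb
    set d := √(∫ x, pd 1 f x ^ 2) with hd
    have ea : ∫ x, f x ^ 2 = a ^ 2 := (Real.sq_sqrt cpos).symm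
    have eb : ∫ x, pd 0 f x ^ 2 = b ^ 2 := (Real.sq_sqrt (bpos 0)).symm
    have ed : ∫ x, pd 1 f x ^ 2 = d ^ 2 := (Real.sq_sqrt (bpos 1)).symm
    have ek : K = √K ^ 2 := (Real.sq_sqrt hK0).symm
    rw [ea, eb, ed]
    set k := √K
    rw [ek]
    have e1 : (k * a ^ 2 + 2 * (a * b) + (k * a ^ 2 + 2 * (a * d))) ^ 2
        = 4 * a ^ 2 * (k * a + b + d) ^ 2 := by ring
    have e2 : (k * a + b + d) ^ 2 ≤ 3 * (k ^ 2 * a ^ 2 + b ^ 2 + d ^ 2) := by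
      nlinarith [sq_nonneg (k * a - b), sq_nonneg (k * a - d), sq_nonneg (b - d)]
    have e3 : k ^ 2 * a ^ 2 + b ^ 2 + d ^ 2 ≤ (k ^ 2 + 1) * (a ^ 2 + (b ^ 2 + d ^ 2)) := by
      nlinarith [sq_nonneg a, mul_nonneg (sq_nonneg k) (sq_nonneg b),
        mul_nonneg (sq_nonneg k) (sq_nonneg d)]
    rw [e1]
    calc 4 * a ^ 2 * (k * a + b + d) ^ 2
        ≤ 4 * a ^ 2 * (3 * ((k ^ 2 + 1) * (a ^ 2 + (b ^ 2 + d ^ 2)))) := by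
          gcongr
          linarith
      _ = _ := by ring

theorem sqrt_gronwall {T G y₀ : ℝ} {y D g : ℝ → ℝ} (hT : 0 ≤ T)
    (hy : ContinuousOn y (Set.Icc 0 T)) (hy0 : ∀ t ∈ Set.Icc 0 T, 0 ≤ y t)
    (hD : ∀ t ∈ Set.Icc 0 T, 0 ≤ D t) (hg : ∀ t, 0 ≤ g t) (hgi : IntegrableOn g (Set.Ioc 0 T))
    (hG : ∫ t in Set.Ioc 0 T, g t ≤ G)
    (h : ∀ t ∈ Set.Icc 0 T, y t + D t ≤ y₀ + ∫ s in 0..t, √(y s) * g s) {t : ℝ}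
    (ht : t ∈ Set.Icc 0 T) : y t + D t ≤ 2 * y₀ + 2 * G ^ 2 := by
  obtain ⟨r, hr, hmax⟩ := isCompact_Icc.exists_isMaxOn (Set.nonempty_Icc.2 hT) hy
  have key : ∀ t ∈ Set.Icc 0 T, y t + D t ≤ y₀ + √(y r) * G := by
    intro t ht
    refine (h t ht).trans ?_
    gcongr
    have hs : Set.Ioc 0 t ⊆ Set.Ioc 0 T := Set.Ioc_subset_Ioc_right ht.2
    rw [intervalIntegral.integral_of_le ht.1]
    have hi : IntegrableOn (fun s => √(y r) * g s) (Set.Ioc 0 T) := hgi.const_mul _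
    calc ∫ s in Set.Ioc 0 t, √(y s) * g s ≤ ∫ s in Set.Ioc 0 t, √(y r) * g s := by
          refine integral_mono_of_nonneg (Eventually.of_forall fun s =>
            mul_nonneg (Real.sqrt_nonneg _) (hg s)) (hi.mono_set hs) ?_
          filter_upwards [ae_restrict_mem measurableSet_Ioc] with s hs'
          exact mul_le_mul_of_nonneg_right
            (Real.sqrt_le_sqrt (hmax ⟨hs'.1.le, hs'.2.trans ht.2⟩)) (hg s)
      _ ≤ ∫ s in Set.Ioc 0 T, √(y r) * g s :=
          setIntegral_mono_set hi (Eventually.of_forall fun s =>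
            mul_nonneg (Real.sqrt_nonneg _) (hg s)) hs.eventuallyLE
      _ ≤ √(y r) * G := by
          rw [integral_const_mul]
          gcongr
  have e : √(y r) ^ 2 = y r := Real.sq_sqrt (hy0 r hr)
  have h1 := key r hr
  have h2 := key t ht
  have h3 := hD r hr
  nlinarith [sq_nonneg (√(y r) - G)]

end Tools

section ElasticFlow

/-- Squared speed of a time-dependent velocity field. -/
def speedSq (v : Fin 2 → ℝ → V → ℝ) (t : ℝ) (x : V) : ℝ := ∑ i, v i t x ^ 2

/-- Squared Frobenius norm of the velocity gradient. -/
def gradSq (v : Fin 2 → ℝ → V → ℝ) (t : ℝ) (x : V) : ℝ := ∑ i, ∑ l, pd l (v i t) x ^ 2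

/-- Squared Frobenius norm of the strain `F - I`. -/
def strainSq (E : Fin 2 → Fin 2 → ℝ → V → ℝ) (t : ℝ) (x : V) : ℝ := ∑ i, ∑ k, E i k t x ^ 2

/-- The density controlling all the fluxes in the energy balance. -/
def activity (v : Fin 2 → ℝ → V → ℝ) (E : Fin 2 → Fin 2 → ℝ → V → ℝ) (t : ℝ) (x : V) : ℝ :=
  speedSq v t x + speedSq v t x ^ 2 + gradSq v t x + strainSq E t x

/-- The elastic stress `F Fᵀ - I` written in terms of the strain. -/
def stress (E : Fin 2 → Fin 2 → ℝ → V → ℝ) (i l : Fin 2) (t : ℝ) (x : V) : ℝ :=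
  (∑ k, E i k t x * E l k t x) + E i l t x + E l i t x

/-- The viscoelastic system written in components, in terms of the strain. -/
structure IsElasticFlow (T : ℝ) (v : Fin 2 → ℝ → V → ℝ) (E : Fin 2 → Fin 2 → ℝ → V → ℝ)
    (p : ℝ → V → ℝ) : Prop where
  smooth_v : ∀ i, ContDiff ℝ ∞ (Function.uncurry (v i))
  smooth_E : ∀ i k, ContDiff ℝ ∞ (Function.uncurry (E i k))
  smooth_p : ContDiff ℝ ∞ (Function.uncurry p)
  momentum : ∀ t ∈ Set.Icc 0 T, ∀ x i,
    deriv (fun s => v i s x) t + (∑ l, v l t x * pd l (v i t) x) + pd i (p t) x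
      = lap (v i t) x + ∑ l, pd l (stress E i l t) x
  transport : ∀ t ∈ Set.Icc 0 T, ∀ x i k,
    deriv (fun s => E i k s x) t + (∑ l, v l t x * pd l (E i k t) x)
      = (∑ l, pd l (v i t) x * E l k t x) + pd k (v i t) x
  div_free : ∀ t ∈ Set.Icc 0 T, ∀ x, ∑ i, pd i (v i t) x = 0
  div_strain : ∀ t ∈ Set.Icc 0 T, ∀ x k, ∑ i, pd i (E i k t) x = 0
  strain_le : ∀ t ∈ Set.Icc 0 T, ∀ x, strainSq E t x ≤ 1 / 4

variable {T : ℝ} {v : Fin 2 → ℝ → V → ℝ} {E : Fin 2 → Fin 2 → ℝ → V → ℝ} {p : ℝ → V → ℝ}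

theorem speedSq_nonneg (v : Fin 2 → ℝ → V → ℝ) (t : ℝ) (x : V) : 0 ≤ speedSq v t x :=
  Finset.sum_nonneg fun _ _ => sq_nonneg _

theorem gradSq_nonneg (v : Fin 2 → ℝ → V → ℝ) (t : ℝ) (x : V) : 0 ≤ gradSq v t x :=
  Finset.sum_nonneg fun _ _ => Finset.sum_nonneg fun _ _ => sq_nonneg _

theorem strainSq_nonneg (E : Fin 2 → Fin 2 → ℝ → V → ℝ) (t : ℝ) (x : V) : 0 ≤ strainSq E t x :=
  Finset.sum_nonneg fun _ _ => Finset.sum_nonneg fun _ _ => sq_nonneg _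

theorem activity_nonneg (v : Fin 2 → ℝ → V → ℝ) (E : Fin 2 → Fin 2 → ℝ → V → ℝ) (t : ℝ) (x : V) :
    0 ≤ activity v E t x := by
  have := speedSq_nonneg v t x
  have := gradSq_nonneg v t x
  have := strainSq_nonneg E t x
  unfold activity
  positivity

theorem contDiff_speedSq (hv : ∀ i, ContDiff ℝ ∞ (Function.uncurry (v i))) :
    ContDiff ℝ ∞ (Function.uncurry (speedSq v)) :=
  ContDiff.sum (s := Finset.univ) fun i _ => (hv i).pow 2

theorem contDiff_gradSq (hv : ∀ i, ContDiff ℝ ∞ (Function.uncurry (v i))) :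
    ContDiff ℝ ∞ (Function.uncurry (gradSq v)) :=
  ContDiff.sum (s := Finset.univ) fun i _ =>
    ContDiff.sum (s := Finset.univ) fun l _ => (contDiff_pd_uncurry (hv i) l).pow 2

theorem contDiff_strainSq (hE : ∀ i k, ContDiff ℝ ∞ (Function.uncurry (E i k))) :
    ContDiff ℝ ∞ (Function.uncurry (strainSq E)) :=
  ContDiff.sum (s := Finset.univ) fun i _ =>
    ContDiff.sum (s := Finset.univ) fun k _ => (hE i k).pow 2

theorem contDiff_stress (hE : ∀ i k, ContDiff ℝ ∞ (Function.uncurry (E i k))) (i l : Fin 2) :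
    ContDiff ℝ ∞ (Function.uncurry (stress E i l)) :=
  ((ContDiff.sum fun k _ => (hE i k).mul (hE l k)).add (hE i l)).add (hE l i)

theorem pd_sq {f : V → ℝ} {x : V} (hf : DifferentiableAt ℝ f x) (i : Fin 2) :
    pd i (fun y => f y ^ 2) x = 2 * f x * pd i f x := by
  simp only [sq]
  rw [pd_mul hf hf]
  ring

theorem pd_strainSq (hE : ∀ i k, ContDiff ℝ ∞ (Function.uncurry (E i k))) (l : Fin 2) (t : ℝ)
    (x : V) : pd l (strainSq E t) x = ∑ i, ∑ k, 2 * E i k t x * pd l (E i k t) x := by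
  have d : ∀ i k, DifferentiableAt ℝ (E i k t) x := fun i k =>
    (contDiff_slice (hE i k) t).differentiable (by simp) x
  have e : strainSq E t = fun y => E 0 0 t y ^ 2 + E 0 1 t y ^ 2
      + (E 1 0 t y ^ 2 + E 1 1 t y ^ 2) := by
    funext y
    simp [strainSq]
  have d2 : ∀ i k, DifferentiableAt ℝ (fun y => E i k t y ^ 2) x := fun i k => (d i k).pow 2
  rw [e, pd_add ((d2 0 0).fun_add (d2 0 1)) ((d2 1 0).fun_add (d2 1 1)), pd_add (d2 0 0) (d2 0 1),
    pd_add (d2 1 0) (d2 1 1)]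
  simp only [pd_sq (d _ _), Fin.sum_univ_two]

theorem pd_speedSq (hv : ∀ i, ContDiff ℝ ∞ (Function.uncurry (v i))) (l : Fin 2) (t : ℝ) (x : V) :
    pd l (speedSq v t) x = ∑ i, 2 * v i t x * pd l (v i t) x := by
  have d : ∀ i, DifferentiableAt ℝ (v i t) x := fun i =>
    (contDiff_slice (hv i) t).differentiable (by simp) x
  have e : speedSq v t = fun y => v 0 t y ^ 2 + v 1 t y ^ 2 := by
    funext y
    simp [speedSq]
  rw [e, pd_add ((d 0).fun_pow 2) ((d 1).fun_pow 2)]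
  simp only [pd_sq (d _), Fin.sum_univ_two]

theorem deriv_strainSq (hE : ∀ i k, ContDiff ℝ ∞ (Function.uncurry (E i k))) (t : ℝ) (x : V) :
    deriv (fun s => strainSq E s x) t
      = ∑ i, ∑ k, 2 * E i k t x * deriv (fun s => E i k s x) t := by
  have d : ∀ i k, HasDerivAt (fun s => E i k s x) _ t := fun i k =>
    (differentiableAt_time (hE i k) x t).hasDerivAt
  have := HasDerivAt.fun_sum (u := Finset.univ) fun i _ =>
    HasDerivAt.fun_sum (u := Finset.univ) fun k _ => (d i k).fun_pow 2
  refine (HasDerivAt.deriv this).trans ?_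
  simp

theorem deriv_speedSq (hv : ∀ i, ContDiff ℝ ∞ (Function.uncurry (v i))) (t : ℝ) (x : V) :
    deriv (fun s => speedSq v s x) t = ∑ i, 2 * v i t x * deriv (fun s => v i s x) t := by
  have d : ∀ i, HasDerivAt (fun s => v i s x) _ t := fun i =>
    (differentiableAt_time (hv i) x t).hasDerivAt
  have := HasDerivAt.fun_sum (u := Finset.univ) fun i _ => (d i).fun_pow 2
  refine (HasDerivAt.deriv this).trans ?_
  simp

namespace IsElasticFlow

theorem isStokesFlow (H : IsElasticFlow T v E p) :
    IsStokesFlow T v p fun i l t x => stress E i l t x - v i t x * v l t x where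
  smooth_v := H.smooth_v
  smooth_p := H.smooth_p
  smooth_S := fun i l => (contDiff_stress H.smooth_E i l).sub ((H.smooth_v i).mul (H.smooth_v l))
  momentum := by
    intro t ht x i
    have d : ∀ i, DifferentiableAt ℝ (v i t) x := fun i =>
      (contDiff_slice (H.smooth_v i) t).differentiable (by simp) x
    have dS : ∀ i l, DifferentiableAt ℝ (stress E i l t) x := fun i l =>
      (contDiff_slice (contDiff_stress H.smooth_E i l) t).differentiable (by simp) x
    have e : ∀ l, pd l (fun y => stress E i l t y - v i t y * v l t y) x
        = pd l (stress E i l t) x - (v i t x * pd l (v l t) x + v l t x * pd l (v i t) x) :=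
      fun l => by
        rw [pd_sub (f := stress E i l t) (g := fun y => v i t y * v l t y) (dS i l)
          ((d i).mul (d l)), pd_mul (d i) (d l)]
    have h1 := H.momentum t ht x i
    have h2 := H.div_free t ht x
    simp only [e, Fin.sum_univ_two] at h1 h2 ⊢
    linear_combination h1 + v i t x * h2
  div_free := H.div_free

/-- The viscous-elastic part of the energy flux. -/
def fluxMatrix (v : Fin 2 → ℝ → V → ℝ) (E : Fin 2 → Fin 2 → ℝ → V → ℝ) (i l : Fin 2) (t : ℝ)
    (x : V) : ℝ :=
  pd l (v i t) x + stress E i l t x - E l i t x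

/-- The energy flux. -/
def flux (v : Fin 2 → ℝ → V → ℝ) (E : Fin 2 → Fin 2 → ℝ → V → ℝ) (p : ℝ → V → ℝ) (l : Fin 2)
    (t : ℝ) (x : V) : ℝ :=
  2 * (v 0 t x * fluxMatrix v E 0 l t x + v 1 t x * fluxMatrix v E 1 l t x)
    - v l t x * (speedSq v t x + strainSq E t x + 2 * p t x)

theorem contDiff_fluxMatrix (H : IsElasticFlow T v E p) (i l : Fin 2) :
    ContDiff ℝ ∞ (Function.uncurry (fluxMatrix v E i l)) :=
  ((contDiff_pd_uncurry (H.smooth_v i) l).add (contDiff_stress H.smooth_E i l)).sub (H.smooth_E l i)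

theorem contDiff_flux (H : IsElasticFlow T v E p) (l : Fin 2) :
    ContDiff ℝ ∞ (Function.uncurry (flux v E p l)) :=
  (contDiff_const.mul (((H.smooth_v 0).mul (H.contDiff_fluxMatrix 0 l)).add
    ((H.smooth_v 1).mul (H.contDiff_fluxMatrix 1 l)))).sub
    ((H.smooth_v l).mul (((contDiff_speedSq H.smooth_v).add (contDiff_strainSq H.smooth_E)).add
      (contDiff_const.mul H.smooth_p)))

theorem energy_balance (H : IsElasticFlow T v E p) {t : ℝ} (ht : t ∈ Set.Icc 0 T) (x : V) :
    deriv (fun s => speedSq v s x) t + deriv (fun s => strainSq E s x) t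
      = (∑ l, pd l (flux v E p l t) x) - 2 * gradSq v t x := by
  have d : ∀ i, DifferentiableAt ℝ (v i t) x := fun i =>
    (contDiff_slice (H.smooth_v i) t).differentiable (by simp) x
  have dE : ∀ i l, DifferentiableAt ℝ (E i l t) x := fun i l =>
    (contDiff_slice (H.smooth_E i l) t).differentiable (by simp) x
  have dS : ∀ i l, DifferentiableAt ℝ (stress E i l t) x := fun i l =>
    (contDiff_slice (contDiff_stress H.smooth_E i l) t).differentiable (by simp) x
  have dp : ∀ i l, DifferentiableAt ℝ (pd l (v i t)) x := fun i l =>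
    (contDiff_pd (contDiff_slice (H.smooth_v i) t) l).differentiable (by simp) x
  have dA : ∀ i l, DifferentiableAt ℝ (fluxMatrix v E i l t) x := fun i l =>
    (contDiff_slice (H.contDiff_fluxMatrix i l) t).differentiable (by simp) x
  have ds : DifferentiableAt ℝ (speedSq v t) x :=
    (contDiff_slice (contDiff_speedSq H.smooth_v) t).differentiable (by simp) x
  have dn : DifferentiableAt ℝ (strainSq E t) x :=
    (contDiff_slice (contDiff_strainSq H.smooth_E) t).differentiable (by simp) x
  have dq : DifferentiableAt ℝ (p t) x :=
    (contDiff_slice H.smooth_p t).differentiable (by simp) x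
  have e1 : ∀ i l, pd l (fluxMatrix v E i l t) x
      = pd l (pd l (v i t)) x + pd l (stress E i l t) x - pd l (E l i t) x := fun i l => by
    rw [← pd_add (dp i l) (dS i l)]
    exact pd_sub ((dp i l).add (dS i l)) (dE l i) l
  have e2 : ∀ l, pd l (flux v E p l t) x
      = 2 * ((v 0 t x * pd l (fluxMatrix v E 0 l t) x + fluxMatrix v E 0 l t x * pd l (v 0 t) x)
        + (v 1 t x * pd l (fluxMatrix v E 1 l t) x + fluxMatrix v E 1 l t x * pd l (v 1 t) x))
        - (v l t x * (pd l (speedSq v t) x + pd l (strainSq E t) x + 2 * pd l (p t) x)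
          + (speedSq v t x + strainSq E t x + 2 * p t x) * pd l (v l t) x) := fun l => by
    have c2 : DifferentiableAt ℝ (fun _ : V => (2 : ℝ)) x := differentiableAt_const _
    have a := ((d 0).fun_mul (dA 0 l)).fun_add ((d 1).fun_mul (dA 1 l))
    have b := (ds.fun_add dn).fun_add (c2.fun_mul dq)
    refine (pd_sub (c2.fun_mul a) ((d l).fun_mul b) l).trans ?_
    rw [pd_mul (d l) b, pd_mul c2 a, pd_const, pd_add ((d 0).fun_mul (dA 0 l))
      ((d 1).fun_mul (dA 1 l)), pd_mul (d 0) (dA 0 l), pd_mul (d 1) (dA 1 l),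
      pd_add (ds.fun_add dn) (c2.fun_mul dq), pd_add ds dn, pd_mul c2 dq, pd_const]
    ring
  have hm := H.momentum t ht x
  have ht' := H.transport t ht x
  have hd := H.div_free t ht x
  have hE := H.div_strain t ht x
  rw [deriv_speedSq H.smooth_v, deriv_strainSq H.smooth_E]
  simp only [e2, e1, pd_speedSq H.smooth_v, pd_strainSq H.smooth_E]
  have m0 := hm 0
  have m1 := hm 1
  have t00 := ht' 0 0
  have t01 := ht' 0 1
  have t10 := ht' 1 0
  have t11 := ht' 1 1
  have E0 := hE 0
  have E1 := hE 1
  simp only [fluxMatrix, lap, gradSq, Fin.sum_univ_two] at m0 m1 t00 t01 t10 t11 hd E0 E1 ⊢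
  simp only [show ∀ i l, stress E i l t x = E i 0 t x * E l 0 t x + E i 1 t x * E l 1 t x
    + E i l t x + E l i t x from fun i l => by simp [stress]]
  linear_combination 2 * v 0 t x * m0 + 2 * v 1 t x * m1 + 2 * E 0 0 t x * t00
    + 2 * E 0 1 t x * t01 + 2 * E 1 0 t x * t10 + 2 * E 1 1 t x * t11
    + (speedSq v t x + strainSq E t x + 2 * p t x) * hd + 2 * v 0 t x * E0 + 2 * v 1 t x * E1

theorem strain_balance (H : IsElasticFlow T v E p) {t : ℝ} (ht : t ∈ Set.Icc 0 T) (x : V) :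
    deriv (fun s => strainSq E s x) t
      = -(∑ l, pd l (fun y => v l t y * strainSq E t y) x)
        + 2 * ∑ i, ∑ k, E i k t x * ((∑ l, pd l (v i t) x * E l k t x) + pd k (v i t) x) := by
  have d : ∀ i, DifferentiableAt ℝ (v i t) x := fun i =>
    (contDiff_slice (H.smooth_v i) t).differentiable (by simp) x
  have dn : DifferentiableAt ℝ (strainSq E t) x :=
    (contDiff_slice (contDiff_strainSq H.smooth_E) t).differentiable (by simp) x
  have ht' := H.transport t ht x
  have hd := H.div_free t ht x
  rw [deriv_strainSq H.smooth_E]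
  simp only [pd_mul (d _) dn, pd_strainSq H.smooth_E]
  have t00 := ht' 0 0
  have t01 := ht' 0 1
  have t10 := ht' 1 0
  have t11 := ht' 1 1
  simp only [Fin.sum_univ_two] at t00 t01 t10 t11 hd ⊢
  linear_combination 2 * E 0 0 t x * t00
    + 2 * E 0 1 t x * t01 + 2 * E 1 0 t x * t10 + 2 * E 1 1 t x * t11
    + strainSq E t x * hd

end IsElasticFlow

end ElasticFlow

section EnergyEstimate

variable {T : ℝ} {v : Fin 2 → ℝ → V → ℝ} {E : Fin 2 → Fin 2 → ℝ → V → ℝ} {p : ℝ → V → ℝ}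

theorem integral_mul_div {φ : V → ℝ} (hφ : ContDiff ℝ ∞ φ) (hc : HasCompactSupport φ)
    {G : Fin 2 → V → ℝ} (hG : ∀ l, ContDiff ℝ ∞ (G l)) :
    ∫ x, φ x * ∑ l, pd l (G l) x = - ∫ x, ∑ l, G l x * pd l φ x := by
  have i1 : ∀ l, Integrable fun x => G l x * pd l φ x := fun l =>
    integrable_mul_of_compact (hG l).continuous (continuous_pd hφ l) (hasCompactSupport_pd hc l)
  have i2 : ∀ l, Integrable fun x => pd l (G l) x * φ x := fun l =>
    integrable_mul_of_compact (continuous_pd (hG l) l) hφ.continuous hc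
  simp only [mul_comm (φ _), Finset.sum_mul]
  rw [integral_finsetSum _ fun l _ => i2 l, integral_finsetSum _ fun l _ => i1 l,
    ← Finset.sum_neg_distrib]
  refine Finset.sum_congr rfl fun l _ => ?_
  rw [integral_mul_pd (hG l) hφ hc, neg_neg]

theorem row_sq_le_strainSq (E : Fin 2 → Fin 2 → ℝ → V → ℝ) (t : ℝ) (x : V) (i : Fin 2) :
    E i 0 t x ^ 2 + E i 1 t x ^ 2 ≤ strainSq E t x := by
  simp only [strainSq, Fin.sum_univ_two]
  fin_cases i <;> simp <;> positivity

theorem sq_le_strainSq (E : Fin 2 → Fin 2 → ℝ → V → ℝ) (t : ℝ) (x : V) (i l : Fin 2) :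
    E i l t x ^ 2 ≤ strainSq E t x := by
  refine le_trans ?_ (row_sq_le_strainSq E t x i)
  fin_cases l <;> simp <;> positivity

theorem sq_bilinear_le {n a b c d e : ℝ} (hn : a ^ 2 + b ^ 2 ≤ n) (hm : c ^ 2 + d ^ 2 ≤ n)
    (he : e ^ 2 ≤ n) (h : n ≤ 1 / 4) : (a * c + b * d + e) ^ 2 ≤ 3 * n := by
  have hn0 : 0 ≤ n := (sq_nonneg e).trans he
  have h1 : (a * c + b * d) ^ 2 ≤ n * n := by
    calc (a * c + b * d) ^ 2 ≤ (a ^ 2 + b ^ 2) * (c ^ 2 + d ^ 2) := by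
          nlinarith [sq_nonneg (a * d - b * c)]
      _ ≤ n * n := mul_le_mul hn hm (by positivity) hn0
  nlinarith [sq_nonneg (a * c + b * d - e)]

namespace IsElasticFlow

theorem fluxMatrix_sq_le (H : IsElasticFlow T v E p) {t : ℝ} (ht : t ∈ Set.Icc 0 T) (x : V)
    (i l : Fin 2) : fluxMatrix v E i l t x ^ 2 ≤ 2 * gradSq v t x + 6 * strainSq E t x := by
  have hn := H.strain_le t ht x
  have h1 : pd l (v i t) x ^ 2 ≤ gradSq v t x := by
    simp only [gradSq, Fin.sum_univ_two]
    fin_cases i <;> fin_cases l <;> simp <;>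
      nlinarith [sq_nonneg (pd 0 (v 0 t) x), sq_nonneg (pd 1 (v 0 t) x),
        sq_nonneg (pd 0 (v 1 t) x), sq_nonneg (pd 1 (v 1 t) x)]
  have h2 := sq_bilinear_le (row_sq_le_strainSq E t x i)
    (row_sq_le_strainSq E t x l) (sq_le_strainSq E t x i l) hn
  have e : fluxMatrix v E i l t x = pd l (v i t) x
      + (E i 0 t x * E l 0 t x + E i 1 t x * E l 1 t x + E i l t x) := by
    simp [fluxMatrix, stress]
    ring
  rw [e]
  nlinarith [sq_nonneg (pd l (v i t) x
      - (E i 0 t x * E l 0 t x + E i 1 t x * E l 1 t x + E i l t x))]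

theorem stress_sub_sq_le (H : IsElasticFlow T v E p) {t : ℝ} (ht : t ∈ Set.Icc 0 T) (x : V)
    (i l : Fin 2) :
    (stress E i l t x - v i t x * v l t x) ^ 2 ≤ 25 * activity v E t x := by
  have hn := H.strain_le t ht x
  have h2 := sq_bilinear_le (row_sq_le_strainSq E t x i)
    (row_sq_le_strainSq E t x l) (sq_le_strainSq E t x i l) hn
  have hv : ∀ i, v i t x ^ 2 ≤ speedSq v t x := by
    intro i
    simp only [speedSq, Fin.sum_univ_two]
    fin_cases i <;> simp <;> positivity
  have h3 : (v i t x * v l t x) ^ 2 ≤ speedSq v t x ^ 2 := by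
    rw [mul_pow, sq (speedSq v t x)]
    exact mul_le_mul (hv i) (hv l) (sq_nonneg _) (speedSq_nonneg v t x)
  have e : stress E i l t x = E i 0 t x * E l 0 t x + E i 1 t x * E l 1 t x + E i l t x
      + E l i t x := by
    simp [stress]
  have g0 := gradSq_nonneg v t x
  have s0 := speedSq_nonneg v t x
  have n0 := strainSq_nonneg E t x
  rw [e, activity]
  set A := E i 0 t x * E l 0 t x + E i 1 t x * E l 1 t x + E i l t x
  have h4 := sq_le_strainSq E t x l i
  have h5 : (A + E l i t x - v i t x * v l t x) ^ 2
      ≤ 3 * (A ^ 2 + E l i t x ^ 2 + (v i t x * v l t x) ^ 2) := by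
    nlinarith [sq_nonneg (A - E l i t x), sq_nonneg (A + v i t x * v l t x),
      sq_nonneg (E l i t x + v i t x * v l t x)]
  nlinarith [sq_nonneg (speedSq v t x)]

/-- The part of the energy flux through the level sets of a cutoff that does not involve the
pressure. -/
def cutoffFlux (v : Fin 2 → ℝ → V → ℝ) (E : Fin 2 → Fin 2 → ℝ → V → ℝ) (φ : V → ℝ) (t : ℝ)
    (x : V) : ℝ :=
  ∑ l, (v l t x * (speedSq v t x + strainSq E t x)
    - 2 * (v 0 t x * fluxMatrix v E 0 l t x + v 1 t x * fluxMatrix v E 1 l t x)) * pd l φ x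

theorem cutoffFlux_sq_le (H : IsElasticFlow T v E p) {t : ℝ} (ht : t ∈ Set.Icc 0 T) {φ : V → ℝ}
    {K : ℝ} {x : V} (hK : pd 0 φ x ^ 2 + pd 1 φ x ^ 2 ≤ K * φ x) :
    cutoffFlux v E φ t x ^ 2
      ≤ (K * (φ x * (speedSq v t x + strainSq E t x))) * (400 * activity v E t x) := by
  have hA := H.fluxMatrix_sq_le ht x
  have hn := H.strain_le t ht x
  have n0 := strainSq_nonneg E t x
  have g0 := gradSq_nonneg v t x
  have s0 := speedSq_nonneg v t x
  have hs : speedSq v t x = v 0 t x ^ 2 + v 1 t x ^ 2 := by simp [speedSq]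
  set q := speedSq v t x + strainSq E t x with hq
  have hK0 : 0 ≤ K * φ x := le_trans (by positivity) hK
  set B : Fin 2 → Fin 2 → ℝ := fun i l => (if i = l then q else 0) - 2 * fluxMatrix v E i l t x
    with hB
  have hq2 : q ^ 2 ≤ 2 * speedSq v t x ^ 2 + strainSq E t x := by
    nlinarith [sq_nonneg (speedSq v t x - strainSq E t x)]
  have hB2 : ∀ i l, B i l ^ 2 ≤ 100 * activity v E t x := by
    intro i l
    have h1 : (if i = l then q else 0) ^ 2 ≤ q ^ 2 := by
      split_ifs
      · exact le_rfl
      · simpa using sq_nonneg q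
    have h2 : B i l ^ 2 ≤ 2 * (if i = l then q else 0) ^ 2 + 8 * fluxMatrix v E i l t x ^ 2 := by
      simp only [hB]
      nlinarith [sq_nonneg ((if i = l then q else 0) + 2 * fluxMatrix v E i l t x)]
    have := hA i l
    unfold activity
    nlinarith [sq_nonneg (speedSq v t x)]
  have e : cutoffFlux v E φ t x
      = (v 0 t x * B 0 0 + v 1 t x * B 1 0) * pd 0 φ x
        + (v 0 t x * B 0 1 + v 1 t x * B 1 1) * pd 1 φ x := by
    simp [cutoffFlux, hB]
    ring
  have hcs : ∀ a b c d : ℝ, (a * b + c * d) ^ 2 ≤ (a ^ 2 + c ^ 2) * (b ^ 2 + d ^ 2) := by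
    intro a b c d
    nlinarith [sq_nonneg (a * d - b * c)]
  rw [e]
  have a0 := activity_nonneg v E t x
  calc _ ≤ ((v 0 t x * B 0 0 + v 1 t x * B 1 0) ^ 2 + (v 0 t x * B 0 1 + v 1 t x * B 1 1) ^ 2)
          * (pd 0 φ x ^ 2 + pd 1 φ x ^ 2) := hcs _ _ _ _
    _ ≤ (speedSq v t x * (B 0 0 ^ 2 + B 1 0 ^ 2) + speedSq v t x * (B 0 1 ^ 2 + B 1 1 ^ 2))
          * (K * φ x) := by
        rw [hs]
        refine mul_le_mul (add_le_add (hcs _ _ _ _) (hcs _ _ _ _)) hK (by positivity) (by positivity)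
    _ ≤ (q * (100 * activity v E t x + 100 * activity v E t x)
          + q * (100 * activity v E t x + 100 * activity v E t x)) * (K * φ x) := by
        have : speedSq v t x ≤ q := by linarith
        gcongr <;> exact hB2 _ _
    _ = _ := by ring

theorem integral_energy_deriv (H : IsElasticFlow T v E p) {t : ℝ} (ht : t ∈ Set.Icc 0 T) {φ : V → ℝ}
    (hφ : ContDiff ℝ ∞ φ) (hc : HasCompactSupport φ) :
    ∫ x, deriv (fun s => φ x * (speedSq v s x + strainSq E s x)) t
      = -2 * (∫ x, φ x * gradSq v t x) + (∫ x, cutoffFlux v E φ t x)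
        + 2 * ∫ x, p t x * (pd 0 (fun y => φ y * v 0 t y) x + pd 1 (fun y => φ y * v 1 t y) x) := by
  have dφ : Differentiable ℝ φ := hφ.differentiable (by simp)
  have dv : ∀ i, Differentiable ℝ (v i t) := fun i =>
    (contDiff_slice (H.smooth_v i) t).differentiable (by simp)
  have cv : ∀ i, Continuous (v i t) := fun i => (dv i).continuous
  have cs : Continuous (speedSq v t) := (contDiff_slice (contDiff_speedSq H.smooth_v) t).continuous
  have cn : Continuous (strainSq E t) :=
    (contDiff_slice (contDiff_strainSq H.smooth_E) t).continuous
  have cg : Continuous (gradSq v t) := (contDiff_slice (contDiff_gradSq H.smooth_v) t).continuous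
  have cA : ∀ i l, Continuous (fluxMatrix v E i l t) := fun i l =>
    (contDiff_slice (H.contDiff_fluxMatrix i l) t).continuous
  have cp : Continuous (p t) := (contDiff_slice H.smooth_p t).continuous
  have cG : ∀ l, ContDiff ℝ ∞ (flux v E p l t) := fun l => contDiff_slice (H.contDiff_flux l) t
  have cd : ∀ l, Continuous (pd l φ) := continuous_pd hφ
  have hcd := fun l => hasCompactSupport_pd hc l
  have e1 : ∀ x, deriv (fun s => φ x * (speedSq v s x + strainSq E s x)) t
      = φ x * (∑ l, pd l (flux v E p l t) x) - 2 * (φ x * gradSq v t x) := by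
    intro x
    have d1 := differentiableAt_time (contDiff_speedSq H.smooth_v) x t
    have d2 := differentiableAt_time (contDiff_strainSq H.smooth_E) x t
    rw [deriv_const_mul _ (d1.fun_add d2), deriv_fun_add d1 d2, H.energy_balance ht x]
    ring
  have e2 : ∀ x, -∑ l, flux v E p l t x * pd l φ x = cutoffFlux v E φ t x
      + 2 * (p t x * (pd 0 (fun y => φ y * v 0 t y) x + pd 1 (fun y => φ y * v 1 t y) x)) := by
    intro x
    have hd := H.div_free t ht x
    rw [pd_mul (dφ x) (dv 0 x), pd_mul (dφ x) (dv 1 x)]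
    simp only [Fin.sum_univ_two, flux, cutoffFlux] at hd ⊢
    linear_combination -2 * p t x * φ x * hd
  have i1 : Integrable fun x => φ x * ∑ l, pd l (flux v E p l t) x :=
    (hφ.continuous.mul (continuous_finsetSum _ fun l _ => continuous_pd (cG l) l)
      ).integrable_of_hasCompactSupport hc.mul_right
  have i2 : Integrable fun x => 2 * (φ x * gradSq v t x) :=
    ((hφ.continuous.mul cg).integrable_of_hasCompactSupport hc.mul_right).const_mul 2
  have i3 : Integrable fun x => cutoffFlux v E φ t x := by
    simp only [cutoffFlux]
    exact integrable_finsetSum _ fun l _ => integrable_mul_of_compact (by fun_prop) (cd l) (hcd l)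
  have hφv : ∀ i, ContDiff ℝ ∞ fun y => φ y * v i t y := fun i =>
    hφ.mul (contDiff_slice (H.smooth_v i) t)
  have i4 : Integrable fun x => 2 * (p t x * (pd 0 (fun y => φ y * v 0 t y) x
      + pd 1 (fun y => φ y * v 1 t y) x)) :=
    (integrable_mul_of_compact cp ((continuous_pd (hφv 0) 0).add (continuous_pd (hφv 1) 1))
      ((hasCompactSupport_pd hc.mul_right 0).add (hasCompactSupport_pd hc.mul_right 1))).const_mul 2
  simp only [e1]
  rw [integral_sub i1 i2, integral_mul_div hφ hc cG, ← integral_neg]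
  simp only [e2]
  rw [integral_add i3 i4, integral_const_mul, integral_const_mul]
  ring

end IsElasticFlow

end EnergyEstimate

section EnergyEstimate

variable {T : ℝ} {v : Fin 2 → ℝ → V → ℝ} {E : Fin 2 → Fin 2 → ℝ → V → ℝ} {p : ℝ → V → ℝ}

theorem continuous_integral_mul {φ : V → ℝ} (hφ : Continuous φ) (hc : HasCompactSupport φ)
    {h : ℝ → V → ℝ} (hh : Continuous (Function.uncurry h)) :
    Continuous fun t => ∫ x, φ x * h t x := by
  refine continuous_integral_of_support (h := fun t x => φ x * h t x)
    ((hφ.comp continuous_snd).mul hh) hc.isCompact fun t x hx => ?_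
  rw [image_eq_zero_of_notMem_tsupport hx, zero_mul]

theorem intervalIntegrable_continuous_mul {f g : ℝ → ℝ} {T t : ℝ} (hf : Continuous f)
    (hg : IntegrableOn g (Set.Ioc 0 T)) (ht : t ∈ Set.Icc 0 T) :
    IntervalIntegrable (fun s => f s * g s) volume 0 t :=
  IntervalIntegrable.continuousOn_mul
    ((intervalIntegrable_iff_integrableOn_Ioc_of_le ht.1).2
      (hg.mono_set (Set.Ioc_subset_Ioc_right ht.2))) hf.continuousOn

namespace IsElasticFlow

theorem energy_le (H : IsElasticFlow T v E p) {φ : V → ℝ} (hφ : ContDiff ℝ ∞ φ)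
    (hc : HasCompactSupport φ) (h0 : ∀ x, 0 ≤ φ x) {K : ℝ} (hK0 : 0 ≤ K)
    (hK : ∀ x, pd 0 φ x ^ 2 + pd 1 φ x ^ 2 ≤ K * φ x) {g : ℝ → ℝ} (hg : ∀ t, 0 ≤ g t)
    (hgi : IntegrableOn g (Set.Ioc 0 T)) (hact : ∀ t ∈ Set.Icc 0 T, Integrable (activity v E t))
    (hle : ∀ t ∈ Set.Icc 0 T, ∫ x, activity v E t x ≤ g t ^ 2) {t : ℝ} (ht : t ∈ Set.Icc 0 T) :
    (∫ x, φ x * (speedSq v t x + strainSq E t x)) + 2 * (∫ s in 0..t, ∫ x, φ x * gradSq v s x)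
      ≤ (∫ x, φ x * (speedSq v 0 x + strainSq E 0 x))
        + ∫ s in 0..t, √(∫ x, φ x * (speedSq v s x + strainSq E s x)) * (100 * √K * g s) := by
  have hs : ContDiff ℝ ∞ (Function.uncurry fun t x => speedSq v t x + strainSq E t x) :=
    (contDiff_speedSq H.smooth_v).add (contDiff_strainSq H.smooth_E)
  set y : ℝ → ℝ := fun s => ∫ x, φ x * (speedSq v s x + strainSq E s x) with hy
  have hyc : Continuous y := continuous_integral_mul hφ.continuous hc hs.continuous
  have hsub : ∀ s ∈ Set.Icc 0 t, s ∈ Set.Icc 0 T := fun s hs => ⟨hs.1, hs.2.trans ht.2⟩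
  have hφ0 : ∀ x, x ∉ tsupport φ → φ x = 0 := fun x hx => image_eq_zero_of_notMem_tsupport hx
  have hpφ : ∀ l x, x ∉ tsupport φ → pd l φ x = 0 := fun l x hx => pd_eq_zero_of_notMem hx l
  have hφu : ContDiff ℝ ∞ fun q : ℝ × V => φ q.2 := hφ.comp contDiff_snd
  have dφ : Differentiable ℝ φ := hφ.differentiable (by simp)
  have hqi : ∀ s, Integrable fun x => φ x * (speedSq v s x + strainSq E s x) := fun s =>
    (hφ.continuous.mul (contDiff_slice hs s).continuous).integrable_of_hasCompactSupport
      hc.mul_right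
  have hq0 : ∀ s x, 0 ≤ φ x * (speedSq v s x + strainSq E s x) := fun s x =>
    mul_nonneg (h0 x) (add_nonneg (speedSq_nonneg v s x) (strainSq_nonneg E s x))
  set f : Fin 2 → ℝ → V → ℝ := fun i s x => φ x * v i s x with hf
  have hfu : ∀ i, ContDiff ℝ ∞ (Function.uncurry (f i)) := fun i => hφu.mul (H.smooth_v i)
  have hfs : ∀ i t x, x ∉ tsupport φ → f i t x = 0 := fun i t x hx => by
    simp only [hf, hφ0 x hx, zero_mul]
  have c1 : Continuous fun s => ∫ x, φ x * gradSq v s x :=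
    continuous_integral_mul hφ.continuous hc (contDiff_gradSq H.smooth_v).continuous
  have c2 : Continuous fun s => ∫ x, cutoffFlux v E φ s x := by
    refine continuous_integral_of_support (h := cutoffFlux v E φ) ?_ hc.isCompact fun s x hx => ?_
    · have a1 : Continuous (Function.uncurry (speedSq v)) := (contDiff_speedSq H.smooth_v).continuous
      have a2 : Continuous (Function.uncurry (strainSq E)) :=
        (contDiff_strainSq H.smooth_E).continuous
      have a3 := fun i => (H.smooth_v i).continuous
      have a4 := fun i l => (H.contDiff_fluxMatrix i l).continuous
      have a5 : ∀ l, Continuous fun q : ℝ × V => pd l φ q.2 := fun l =>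
        (continuous_pd hφ l).comp continuous_snd
      exact continuous_finsetSum Finset.univ fun l _ => (((a3 l).mul (a1.add a2)).sub (continuous_const.mul
        (((a3 0).mul (a4 0 l)).add ((a3 1).mul (a4 1 l))))).mul (a5 l)
    · simp [cutoffFlux, hpφ _ x hx]
  have hgu : ContDiff ℝ ∞ (Function.uncurry fun s x => pd 0 (f 0 s) x + pd 1 (f 1 s) x) :=
    (contDiff_pd_uncurry (hfu 0) 0).add (contDiff_pd_uncurry (hfu 1) 1)
  have hgs : ∀ s x, x ∉ tsupport φ → pd 0 (f 0 s) x + pd 1 (f 1 s) x = 0 := by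
    intro s x hx
    have hsub : ∀ i, tsupport (f i s) ⊆ tsupport φ := fun i => closure_minimal
      (fun y hy => by
        by_contra h
        exact hy (hfs i s y h)) (isClosed_tsupport φ)
    rw [pd_eq_zero_of_notMem fun h => hx (hsub 0 h), pd_eq_zero_of_notMem fun h => hx (hsub 1 h),
      add_zero]
  have c3 : Continuous fun s => ∫ x, p s x * (pd 0 (f 0 s) x + pd 1 (f 1 s) x) :=
    continuous_integral_of_support (h := fun s x => p s x * (pd 0 (f 0 s) x + pd 1 (f 1 s) x))
      (H.smooth_p.continuous.mul hgu.continuous) hc.isCompact fun s x hx => by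
        simp only [hgs s x hx, mul_zero]
  have c4 : Continuous fun s => ∫ x, (pd 0 (f 0 s) x + pd 1 (f 1 s) x) ^ 2 :=
    continuous_integral_of_support (h := fun s x => (pd 0 (f 0 s) x + pd 1 (f 1 s) x) ^ 2)
      (hgu.pow 2).continuous hc.isCompact fun s x hx => by simp [hgs s x hx]
  have hvact : ∀ s x i, v i s x ^ 2 ≤ activity v E s x := by
    intro s x i
    have h1 : v i s x ^ 2 ≤ speedSq v s x := by
      simp only [speedSq, Fin.sum_univ_two]
      fin_cases i <;> simp <;> positivity
    have := gradSq_nonneg v s x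
    have := strainSq_nonneg E s x
    unfold activity
    nlinarith [sq_nonneg (speedSq v s x)]
  have hvi : ∀ s ∈ Set.Icc 0 T, ∀ i, Integrable fun x => v i s x ^ 2 := fun s hs i =>
    (hact s hs).mono' (((contDiff_slice (H.smooth_v i) s).pow 2).continuous.aestronglyMeasurable)
      (Eventually.of_forall fun x => by
        rw [Real.norm_eq_abs, abs_of_nonneg (sq_nonneg _)]
        exact hvact s x i)
  have hSi : ∀ s ∈ Set.Icc 0 T, ∀ i l,
      Integrable fun x => (stress E i l s x - v i s x * v l s x) ^ 2 := fun s hs i l =>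
    ((hact s hs).const_mul 25).mono' (((contDiff_slice (H.isStokesFlow.smooth_S i l) s).pow
        2).continuous.aestronglyMeasurable)
      (Eventually.of_forall fun x => by
        rw [Real.norm_eq_abs, abs_of_nonneg (sq_nonneg _)]
        exact H.stress_sub_sq_le hs x i l)
  have hdiv : ∀ s ∈ Set.Icc 0 T, ∫ x, (pd 0 (f 0 s) x + pd 1 (f 1 s) x) ^ 2 ≤ K * y s := by
    intro s hs
    rw [hy, ← integral_const_mul]
    refine integral_mono (integrable_of_support ((contDiff_slice hgu s).pow 2).continuous
      hc.isCompact fun x hx => by simp [hgs s x hx]) ((hqi s).const_mul K) fun x => ?_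
    have dv : ∀ i, DifferentiableAt ℝ (v i s) x := fun i =>
      (contDiff_slice (H.smooth_v i) s).differentiable (by simp) x
    have hd := H.div_free s hs x
    have e : pd 0 (f 0 s) x + pd 1 (f 1 s) x = v 0 s x * pd 0 φ x + v 1 s x * pd 1 φ x := by
      simp only [hf]
      rw [pd_mul (dφ x) (dv 0), pd_mul (dφ x) (dv 1)]
      rw [Fin.sum_univ_two] at hd
      linear_combination φ x * hd
    simp only [e]
    have h1 : speedSq v s x = v 0 s x ^ 2 + v 1 s x ^ 2 := by simp [speedSq]
    have n0 := strainSq_nonneg E s x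
    have s0 := speedSq_nonneg v s x
    have k0 : 0 ≤ K * φ x := mul_nonneg hK0 (h0 x)
    calc (v 0 s x * pd 0 φ x + v 1 s x * pd 1 φ x) ^ 2
        ≤ speedSq v s x * (pd 0 φ x ^ 2 + pd 1 φ x ^ 2) := by
          rw [h1]
          nlinarith [sq_nonneg (v 0 s x * pd 1 φ x - v 1 s x * pd 0 φ x)]
      _ ≤ (speedSq v s x + strainSq E s x) * (K * φ x) := by
          refine mul_le_mul (by linarith) (hK x) (by positivity) (by positivity)
      _ = _ := by ring
  have hy0 : ∀ s, 0 ≤ y s := fun s => integral_nonneg (hq0 s)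
  have hyg : ∀ c : ℝ, IntervalIntegrable (fun s => √(y s) * (c * g s)) volume 0 t := fun c =>
    intervalIntegrable_continuous_mul (Real.continuous_sqrt.comp hyc) (hgi.const_mul c) ht
  have hflux : ∫ s in 0..t, ∫ x, cutoffFlux v E φ s x
      ≤ ∫ s in 0..t, √(y s) * (20 * √K * g s) := by
    refine intervalIntegral.integral_mono_on ht.1 (c2.intervalIntegrable _ _) (hyg _) fun s hs' => ?_
    have hsT := hsub s hs'
    refine (le_abs_self _).trans ((abs_integral_le_sqrt_mul_sqrt ((hqi s).const_mul K)
      ((hact s hsT).const_mul 400) (fun x => mul_nonneg hK0 (hq0 s x))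
      (fun x => mul_nonneg (by norm_num) (activity_nonneg v E s x))
      fun x => H.cutoffFlux_sq_le hsT (hK x)).trans ?_)
    rw [integral_const_mul, integral_const_mul, Real.sqrt_mul hK0]
    have h1 : √(400 * ∫ x, activity v E s x) ≤ 20 * g s := by
      rw [show (20 : ℝ) * g s = √((20 * g s) ^ 2) from
        (Real.sqrt_sq (mul_nonneg (by norm_num) (hg s))).symm]
      refine Real.sqrt_le_sqrt ?_
      nlinarith [hle s hsT]
    calc √K * √(y s) * √(400 * ∫ x, activity v E s x) ≤ √K * √(y s) * (20 * g s) := by gcongr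
      _ = _ := by ring
  have hpress := H.isStokesFlow.pressure_bound hvi hSi (α := g) (γ := fun s => 5 * g s) hg hgi
    (fun s => mul_nonneg (by norm_num) (hg s)) (hgi.const_mul 5)
    (fun s hs i => (integral_mono (hvi s hs i) (hact s hs) fun x => hvact s x i).trans (hle s hs))
    (fun s hs i l => by
      refine (integral_mono (hSi s hs i l) ((hact s hs).const_mul 25) fun x =>
        H.stress_sub_sq_le hs x i l).trans ?_
      rw [integral_const_mul]
      nlinarith [hle s hs]) hfu hc.isCompact hfs ht
  have hpress2 : ∫ s in 0..t, 5 * g s * √(∫ x, (pd 0 (f 0 s) x + pd 1 (f 1 s) x) ^ 2)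
      ≤ ∫ s in 0..t, √(y s) * (5 * √K * g s) := by
    refine intervalIntegral.integral_mono_on ht.1 ?_ (hyg _) fun s hs' => ?_
    · simp only [mul_comm (5 * g _)]
      exact intervalIntegrable_continuous_mul (Real.continuous_sqrt.comp c4) (hgi.const_mul 5) ht
    · have h1 := Real.sqrt_le_sqrt (hdiv s (hsub s hs'))
      rw [Real.sqrt_mul hK0] at h1
      have := hg s
      calc 5 * g s * √(∫ x, (pd 0 (f 0 s) x + pd 1 (f 1 s) x) ^ 2)
          ≤ 5 * g s * (√K * √(y s)) := by gcongr
        _ = _ := by ring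
  have hderiv := integral_deriv_of_support (h := fun s x => φ x * (speedSq v s x + strainSq E s x))
    (hφu.mul hs) hc.isCompact (fun s x hx => by simp only [hφ0 x hx, zero_mul]) 0 t
  have hsplit : ∫ s in 0..t, (∫ x, deriv (fun s => φ x * (speedSq v s x + strainSq E s x)) s)
      = ∫ s in 0..t, (-2 * (∫ x, φ x * gradSq v s x) + (∫ x, cutoffFlux v E φ s x)
        + 2 * ∫ x, p s x * (pd 0 (f 0 s) x + pd 1 (f 1 s) x)) := by
    refine intervalIntegral.integral_congr fun s hs' => ?_
    rw [Set.uIcc_of_le ht.1] at hs'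
    exact H.integral_energy_deriv (hsub s hs') hφ hc
  have c12 : Continuous fun s => -2 * (∫ x, φ x * gradSq v s x) + ∫ x, cutoffFlux v E φ s x :=
    (c1.const_mul (-2)).add c2
  rw [hsplit, intervalIntegral.integral_add (c12.intervalIntegrable _ _)
    ((c3.const_mul 2).intervalIntegrable _ _), intervalIntegral.integral_add
    ((c1.const_mul (-2)).intervalIntegrable _ _) (c2.intervalIntegrable _ _),
    intervalIntegral.integral_const_mul, intervalIntegral.integral_const_mul] at hderiv
  have hc : ∀ c : ℝ, ∫ s in 0..t, √(y s) * (c * √K * g s)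
      = c * ∫ s in 0..t, √(y s) * (√K * g s) := by
    intro c
    rw [← intervalIntegral.integral_const_mul]
    exact intervalIntegral.integral_congr fun s _ => by ring
  rw [hc] at hflux hpress2 ⊢
  have := le_abs_self (∫ s in 0..t, ∫ x, p s x * (pd 0 (f 0 s) x + pd 1 (f 1 s) x))
  have hpos : 0 ≤ ∫ s in 0..t, √(y s) * (√K * g s) :=
    intervalIntegral.integral_nonneg ht.1 fun s _ => by
      have := hg s
      positivity
  linarith

/-- The production of `strainSq` by stretching. -/
def stretching (v : Fin 2 → ℝ → V → ℝ) (E : Fin 2 → Fin 2 → ℝ → V → ℝ) (t : ℝ) (x : V) : ℝ :=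
  ∑ i, ∑ k, E i k t x * ((∑ l, pd l (v i t) x * E l k t x) + pd k (v i t) x)

theorem stretching_sq_le (H : IsElasticFlow T v E p) {t : ℝ} (ht : t ∈ Set.Icc 0 T) (x : V) :
    stretching v E t x ^ 2 ≤ 3 * (strainSq E t x * gradSq v t x) := by
  have hn := H.strain_le t ht x
  have n0 := strainSq_nonneg E t x
  have g0 := gradSq_nonneg v t x
  have hcs : ∀ a b c d : ℝ, (a * b + c * d) ^ 2 ≤ (a ^ 2 + c ^ 2) * (b ^ 2 + d ^ 2) := by
    intro a b c d
    nlinarith [sq_nonneg (a * d - b * c)]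
  set Y : Fin 2 → Fin 2 → ℝ := fun i k => (∑ l, pd l (v i t) x * E l k t x) + pd k (v i t) x
    with hY
  have hY2 : ∀ i k, Y i k ^ 2 ≤ 2 * ((pd 0 (v i t) x ^ 2 + pd 1 (v i t) x ^ 2)
      * (E 0 k t x ^ 2 + E 1 k t x ^ 2)) + 2 * pd k (v i t) x ^ 2 := by
    intro i k
    have := hcs (pd 0 (v i t) x) (E 0 k t x) (pd 1 (v i t) x) (E 1 k t x)
    simp only [hY, Fin.sum_univ_two]
    nlinarith [sq_nonneg (pd 0 (v i t) x * E 0 k t x + pd 1 (v i t) x * E 1 k t x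
      - pd k (v i t) x)]
  have hsum : Y 0 0 ^ 2 + Y 0 1 ^ 2 + (Y 1 0 ^ 2 + Y 1 1 ^ 2)
      ≤ 2 * (gradSq v t x * strainSq E t x) + 2 * gradSq v t x := by
    have h00 := hY2 0 0
    have h01 := hY2 0 1
    have h10 := hY2 1 0
    have h11 := hY2 1 1
    simp only [gradSq, strainSq, Fin.sum_univ_two]
    nlinarith
  have e : stretching v E t x = (E 0 0 t x * Y 0 0 + E 0 1 t x * Y 0 1)
      + (E 1 0 t x * Y 1 0 + E 1 1 t x * Y 1 1) := by
    simp only [stretching, hY, Fin.sum_univ_two]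
  have hE : strainSq E t x = (E 0 0 t x ^ 2 + E 0 1 t x ^ 2) + (E 1 0 t x ^ 2 + E 1 1 t x ^ 2) := by
    simp [strainSq]
  have hcs4 : stretching v E t x ^ 2
      ≤ strainSq E t x * (Y 0 0 ^ 2 + Y 0 1 ^ 2 + (Y 1 0 ^ 2 + Y 1 1 ^ 2)) := by
    have := Finset.sum_mul_sq_le_sq_mul_sq Finset.univ
      (fun q : Fin 2 × Fin 2 => E q.1 q.2 t x) fun q => Y q.1 q.2
    simpa [e, hE, Fintype.sum_prod_type] using this
  refine hcs4.trans ?_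
  rw [mul_left_comm]
  refine mul_le_mul_of_nonneg_left ?_ n0
  nlinarith

theorem strain_energy_le (H : IsElasticFlow T v E p) {φ : V → ℝ} (hφ : ContDiff ℝ ∞ φ)
    (hc : HasCompactSupport φ) (h0 : ∀ x, 0 ≤ φ x) (h1 : ∀ x, φ x ≤ 1) {K : ℝ} (hK0 : 0 ≤ K)
    (hK : ∀ x, pd 0 φ x ^ 2 + pd 1 φ x ^ 2 ≤ K * φ x) {g : ℝ → ℝ} (hg : ∀ t, 0 ≤ g t)
    (hgi : IntegrableOn g (Set.Ioc 0 T))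
    (hact : ∀ t ∈ Set.Icc 0 T, Integrable fun x => speedSq v t x + gradSq v t x)
    (hle : ∀ t ∈ Set.Icc 0 T, ∫ x, (speedSq v t x + gradSq v t x) ≤ g t ^ 2)
    {t : ℝ} (ht : t ∈ Set.Icc 0 T) :
    (∫ x, φ x * strainSq E t x) ≤ (∫ x, φ x * strainSq E 0 x)
      + ∫ s in 0..t, √(∫ x, φ x * strainSq E s x) * (√(K + 24) * g s) := by
  have hs := contDiff_strainSq H.smooth_E
  set y : ℝ → ℝ := fun s => ∫ x, φ x * strainSq E s x with hy
  have hyc : Continuous y := continuous_integral_mul hφ.continuous hc hs.continuous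
  have hsub : ∀ s ∈ Set.Icc 0 t, s ∈ Set.Icc 0 T := fun s hs => ⟨hs.1, hs.2.trans ht.2⟩
  have hφ0 : ∀ x, x ∉ tsupport φ → φ x = 0 := fun x hx => image_eq_zero_of_notMem_tsupport hx
  have hφu : ContDiff ℝ ∞ fun q : ℝ × V => φ q.2 := hφ.comp contDiff_snd
  have hsm : ContDiff ℝ ∞ (Function.uncurry fun s x => φ x * strainSq E s x) := hφu.mul hs
  have hsupp : ∀ s x, x ∉ tsupport φ → φ x * strainSq E s x = 0 := fun s x hx => by
    rw [hφ0 x hx, zero_mul]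
  have hqi : ∀ s, Integrable fun x => φ x * strainSq E s x := fun s =>
    integrable_of_support (contDiff_slice hsm s).continuous hc.isCompact (hsupp s)
  have hq0 : ∀ s x, 0 ≤ φ x * strainSq E s x := fun s x =>
    mul_nonneg (h0 x) (strainSq_nonneg E s x)
  have hderiv := integral_deriv_of_support hsm hc.isCompact hsupp 0 t
  have hcd : Continuous fun s => ∫ x, deriv (fun s => φ x * strainSq E s x) s :=
    continuous_integral_of_support (contDiff_deriv_uncurry hsm).continuous hc.isCompact
      fun s x hx => by simp [hφ0 x hx]
  have hmono : ∫ s in 0..t, (∫ x, deriv (fun s => φ x * strainSq E s x) s)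
      ≤ ∫ s in 0..t, √(y s) * (√(K + 24) * g s) := by
    refine intervalIntegral.integral_mono_on ht.1 (hcd.intervalIntegrable _ _)
      (intervalIntegrable_continuous_mul (Real.continuous_sqrt.comp hyc) (hgi.const_mul _) ht)
      fun s hs' => ?_
    have hsT := hsub s hs'
    have dv : ∀ i, ContDiff ℝ ∞ (v i s) := fun i => contDiff_slice (H.smooth_v i) s
    have dn : ContDiff ℝ ∞ (strainSq E s) := contDiff_slice hs s
    have cG : ∀ l, ContDiff ℝ ∞ fun y => v l s y * strainSq E s y := fun l => (dv l).mul dn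
    have e1 : ∀ x, deriv (fun s => φ x * strainSq E s x) s
        = 2 * (φ x * stretching v E s x)
          - φ x * ∑ l, pd l (fun y => v l s y * strainSq E s y) x := by
      intro x
      rw [deriv_const_mul _ (differentiableAt_time hs x s), H.strain_balance hsT x, stretching]
      ring
    have cX : Continuous (stretching v E s) := by
      have a1 := fun i k => (contDiff_slice (H.smooth_E i k) s).continuous
      have a2 := fun i l => continuous_pd (dv i) l
      exact continuous_finsetSum Finset.univ fun i _ => continuous_finsetSum Finset.univ fun k _ =>
        (a1 i k).mul ((continuous_finsetSum Finset.univ fun l _ => (a2 i l).mul (a1 l k)).add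
          (a2 i k))
    have i1 : Integrable fun x => 2 * (φ x * stretching v E s x) :=
      ((hφ.continuous.mul cX).integrable_of_hasCompactSupport hc.mul_right).const_mul 2
    have i2 : Integrable fun x => φ x * ∑ l, pd l (fun y => v l s y * strainSq E s y) x :=
      (hφ.continuous.mul (continuous_finsetSum _ fun l _ => continuous_pd (cG l) l)
        ).integrable_of_hasCompactSupport hc.mul_right
    have i3 : Integrable fun x => ∑ l, (v l s x * strainSq E s x) * pd l φ x :=
      integrable_finsetSum _ fun l _ => integrable_mul_of_compact (cG l).continuous
        (continuous_pd hφ l) (hasCompactSupport_pd hc l)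
    have e2 : ∫ x, deriv (fun s => φ x * strainSq E s x) s
        = ∫ x, (2 * (φ x * stretching v E s x)
          + ∑ l, (v l s x * strainSq E s x) * pd l φ x) := by
      simp only [e1]
      rw [integral_sub i1 i2, integral_mul_div hφ hc cG, sub_neg_eq_add, integral_add i1 i3]
    rw [e2]
    refine (le_abs_self _).trans ((abs_integral_le_sqrt_mul_sqrt (hqi s)
      ((hact s hsT).const_mul (K + 24)) (hq0 s) (fun x => mul_nonneg (by linarith)
        (add_nonneg (speedSq_nonneg v s x) (gradSq_nonneg v s x))) fun x => ?_).trans ?_)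
    · have hX := H.stretching_sq_le hsT x
      have hn := H.strain_le s hsT x
      have n0 := strainSq_nonneg E s x
      have g0 := gradSq_nonneg v s x
      have s0 := speedSq_nonneg v s x
      have p0 := h0 x
      have p1 := h1 x
      have hs2 : speedSq v s x = v 0 s x ^ 2 + v 1 s x ^ 2 := by simp [speedSq]
      rw [Fin.sum_univ_two]
      have a1 : (φ x * stretching v E s x) ^ 2 ≤ 3 * (φ x * strainSq E s x) * gradSq v s x := by
        calc (φ x * stretching v E s x) ^ 2 = φ x * (φ x * stretching v E s x ^ 2) := by ring
          _ ≤ φ x * (1 * (3 * (strainSq E s x * gradSq v s x))) := by gcongr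
          _ = _ := by ring
      have a2 : (v 0 s x * strainSq E s x * pd 0 φ x + v 1 s x * strainSq E s x * pd 1 φ x) ^ 2
          ≤ (φ x * strainSq E s x) * (K * speedSq v s x) * (1 / 4) := by
        calc (v 0 s x * strainSq E s x * pd 0 φ x + v 1 s x * strainSq E s x * pd 1 φ x) ^ 2
            ≤ (strainSq E s x * strainSq E s x) * speedSq v s x
              * (pd 0 φ x ^ 2 + pd 1 φ x ^ 2) := by
              rw [hs2]
              have e : (strainSq E s x * strainSq E s x) * (v 0 s x ^ 2 + v 1 s x ^ 2)
                  * (pd 0 φ x ^ 2 + pd 1 φ x ^ 2)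
                  - (v 0 s x * strainSq E s x * pd 0 φ x + v 1 s x * strainSq E s x * pd 1 φ x) ^ 2
                  = (strainSq E s x * (v 0 s x * pd 1 φ x - v 1 s x * pd 0 φ x)) ^ 2 := by ring
              have := sq_nonneg (strainSq E s x * (v 0 s x * pd 1 φ x - v 1 s x * pd 0 φ x))
              linarith
          _ ≤ (strainSq E s x * (1 / 4)) * speedSq v s x * (K * φ x) := by
              gcongr
              exact hK x
          _ = _ := by ring
      set A := φ x * stretching v E s x
      set B := v 0 s x * strainSq E s x * pd 0 φ x + v 1 s x * strainSq E s x * pd 1 φ x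
      have hpn : 0 ≤ φ x * strainSq E s x := hq0 s x
      have hx1 : 0 ≤ φ x * strainSq E s x * (K * speedSq v s x) := by positivity
      have hx2 : 0 ≤ φ x * strainSq E s x * (K * gradSq v s x) := by positivity
      have hx3 : 0 ≤ φ x * strainSq E s x * speedSq v s x := by positivity
      nlinarith [sq_nonneg (2 * A - B)]
    · rw [integral_const_mul, Real.sqrt_mul (by linarith)]
      have : √(∫ x, (speedSq v s x + gradSq v s x)) ≤ g s := by
        rw [← Real.sqrt_sq (hg s)]
        exact Real.sqrt_le_sqrt (hle s hsT)
      gcongr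
  rw [hderiv] at hmono
  linarith

end IsElasticFlow

end EnergyEstimate

section WeightedEstimate

variable {T : ℝ} {v : Fin 2 → ℝ → V → ℝ} {E : Fin 2 → Fin 2 → ℝ → V → ℝ} {p : ℝ → V → ℝ}

/-- Finiteness of the weighted energy and of the weighted dissipation. -/
structure HasMoments (T : ℝ) (v : Fin 2 → ℝ → V → ℝ) (E : Fin 2 → Fin 2 → ℝ → V → ℝ) : Prop where
  speed : ∀ t ∈ Set.Icc 0 T, Integrable fun x => (1 + vnsq x) * speedSq v t x
  strain : ∀ t ∈ Set.Icc 0 T, Integrable fun x => (1 + vnsq x) * strainSq E t x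
  grad : ∀ t ∈ Set.Icc 0 T, Integrable fun x => (1 + vnsq x) * gradSq v t x
  dissipation : IntegrableOn (fun t => ∫ x, (1 + vnsq x) * gradSq v t x) (Set.Ioc 0 T)

theorem integrable_of_weighted {f h : V → ℝ} (hf : Continuous f) (hf0 : ∀ x, 0 ≤ f x)
    (hfh : ∀ x, f x ≤ h x) (hi : Integrable fun x => (1 + vnsq x) * h x) : Integrable f :=
  hi.mono' hf.aestronglyMeasurable (Eventually.of_forall fun x => by
    rw [Real.norm_eq_abs, abs_of_nonneg (hf0 x)]
    have h1 := hfh x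
    have h2 := mul_nonneg (vnsq_nonneg x) ((hf0 x).trans h1)
    nlinarith)

namespace IsElasticFlow

theorem integrable_speedSq (H : IsElasticFlow T v E p) (hm : HasMoments T v E) {t : ℝ}
    (ht : t ∈ Set.Icc 0 T) : Integrable (speedSq v t) :=
  integrable_of_weighted (contDiff_slice (contDiff_speedSq H.smooth_v) t).continuous
    (speedSq_nonneg v t) (fun _ => le_rfl) (hm.speed t ht)

theorem integrable_strainSq (H : IsElasticFlow T v E p) (hm : HasMoments T v E) {t : ℝ}
    (ht : t ∈ Set.Icc 0 T) : Integrable (strainSq E t) :=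
  integrable_of_weighted (contDiff_slice (contDiff_strainSq H.smooth_E) t).continuous
    (strainSq_nonneg E t) (fun _ => le_rfl) (hm.strain t ht)

theorem integrable_gradSq (H : IsElasticFlow T v E p) (hm : HasMoments T v E) {t : ℝ}
    (ht : t ∈ Set.Icc 0 T) : Integrable (gradSq v t) :=
  integrable_of_weighted (contDiff_slice (contDiff_gradSq H.smooth_v) t).continuous
    (gradSq_nonneg v t) (fun _ => le_rfl) (hm.grad t ht)

theorem sq_le_speedSq (v : Fin 2 → ℝ → V → ℝ) (t : ℝ) (x : V) (i : Fin 2) :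
    v i t x ^ 2 ≤ speedSq v t x :=
  Finset.single_le_sum (f := fun i => v i t x ^ 2) (fun _ _ => sq_nonneg _) (Finset.mem_univ i)

theorem sq_le_gradSq (v : Fin 2 → ℝ → V → ℝ) (t : ℝ) (x : V) (i l : Fin 2) :
    pd l (v i t) x ^ 2 ≤ gradSq v t x :=
  (Finset.single_le_sum (f := fun l => pd l (v i t) x ^ 2) (fun _ _ => sq_nonneg _)
    (Finset.mem_univ l)).trans
    (Finset.single_le_sum (f := fun i => ∑ l, pd l (v i t) x ^ 2)
      (fun _ _ => Finset.sum_nonneg fun _ _ => sq_nonneg _) (Finset.mem_univ i))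

theorem integral_gradSq_le (H : IsElasticFlow T v E p) (hm : HasMoments T v E) {t : ℝ}
    (ht : t ∈ Set.Icc 0 T) : ∫ x, gradSq v t x ≤ ∫ x, (1 + vnsq x) * gradSq v t x :=
  integral_mono (H.integrable_gradSq hm ht) (hm.grad t ht) fun x => by
    nlinarith [mul_nonneg (vnsq_nonneg x) (gradSq_nonneg v t x)]

theorem integral_speedSq_le (H : IsElasticFlow T v E p) (hm : HasMoments T v E) {t : ℝ}
    (ht : t ∈ Set.Icc 0 T) : ∫ x, speedSq v t x ≤ 4 * ∫ x, (1 + vnsq x) * gradSq v t x := by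
  have hw : Continuous fun x : V => 1 + vnsq x := continuous_const.add contDiff_vnsq.continuous
  have w0 : ∀ x : V, 0 ≤ 1 + vnsq x := fun x => add_nonneg zero_le_one (vnsq_nonneg x)
  have cv : ∀ i, ContDiff ℝ ∞ (v i t) := fun i => contDiff_slice (H.smooth_v i) t
  have i0 : ∀ i, Integrable fun x => (1 + vnsq x) * v i t x ^ 2 := fun i =>
    (hm.speed t ht).mono' (hw.mul ((cv i).pow 2).continuous).aestronglyMeasurable
      (Eventually.of_forall fun x => by
        rw [Real.norm_eq_abs, abs_of_nonneg (mul_nonneg (w0 x) (sq_nonneg _))]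
        exact mul_le_mul_of_nonneg_left (sq_le_speedSq v t x i) (w0 x))
  have i1 : ∀ i, Integrable fun x => (1 + vnsq x) * pd 0 (v i t) x ^ 2 := fun i =>
    (hm.grad t ht).mono' (hw.mul ((contDiff_pd (cv i) 0).pow 2).continuous).aestronglyMeasurable
      (Eventually.of_forall fun x => by
        rw [Real.norm_eq_abs, abs_of_nonneg (mul_nonneg (w0 x) (sq_nonneg _))]
        exact mul_le_mul_of_nonneg_left (sq_le_gradSq v t x i 0) (w0 x))
  have h := fun i => hardy (cv i) (i0 i) (i1 i)
  have is : ∀ i, Integrable fun x => v i t x ^ 2 := fun i =>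
    integrable_of_weighted ((cv i).pow 2).continuous (fun _ => sq_nonneg _) (fun _ => le_rfl) (i0 i)
  have e : ∫ x, speedSq v t x = (∫ x, v 0 t x ^ 2) + ∫ x, v 1 t x ^ 2 := by
    rw [← integral_add (is 0) (is 1)]
    simp [speedSq]
  have hsum : (∫ x, (1 + vnsq x) * pd 0 (v 0 t) x ^ 2) + (∫ x, (1 + vnsq x) * pd 0 (v 1 t) x ^ 2)
      ≤ ∫ x, (1 + vnsq x) * gradSq v t x := by
    rw [← integral_add (i1 0) (i1 1)]
    refine integral_mono ((i1 0).add (i1 1)) (hm.grad t ht) fun x => ?_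
    rw [← mul_add]
    refine mul_le_mul_of_nonneg_left ?_ (w0 x)
    simp only [gradSq, Fin.sum_univ_two]
    nlinarith [sq_nonneg (pd 1 (v 0 t) x), sq_nonneg (pd 1 (v 1 t) x)]
  linarith [h 0, h 1]

end IsElasticFlow

theorem exists_activity_le : ∃ C, 0 ≤ C ∧ ∀ (T : ℝ) (v : Fin 2 → ℝ → V → ℝ)
    (E : Fin 2 → Fin 2 → ℝ → V → ℝ) (p : ℝ → V → ℝ), IsElasticFlow T v E p → HasMoments T v E →
    ∀ t ∈ Set.Icc 0 T, Integrable (activity v E t) ∧ ∫ x, activity v E t x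
      ≤ (∫ x, speedSq v t x)
        + C * ((∫ x, speedSq v t x) * ((∫ x, speedSq v t x) + ∫ x, gradSq v t x))
        + (∫ x, gradSq v t x) + ∫ x, strainSq E t x := by
  obtain ⟨C, hC0, hC⟩ := exists_ladyzhenskaya
  refine ⟨8 * C, by positivity, fun T v E p H hm t ht => ?_⟩
  have hs := H.integrable_speedSq hm ht
  have hg := H.integrable_gradSq hm ht
  have hn := H.integrable_strainSq hm ht
  have cv : ∀ i, ContDiff ℝ ∞ (v i t) := fun i => contDiff_slice (H.smooth_v i) t
  have is : ∀ i, Integrable fun x => v i t x ^ 2 := fun i =>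
    hs.mono' ((cv i).pow 2).continuous.aestronglyMeasurable (Eventually.of_forall fun x => by
      rw [Real.norm_eq_abs, abs_of_nonneg (sq_nonneg _)]
      exact IsElasticFlow.sq_le_speedSq v t x i)
  have ig : ∀ i l, Integrable fun x => pd l (v i t) x ^ 2 := fun i l =>
    hg.mono' ((contDiff_pd (cv i) l).pow 2).continuous.aestronglyMeasurable
      (Eventually.of_forall fun x => by
        rw [Real.norm_eq_abs, abs_of_nonneg (sq_nonneg _)]
        exact IsElasticFlow.sq_le_gradSq v t x i l)
  have h := fun i => hC _ (cv i) (is i) (ig i)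
  have s0 : 0 ≤ ∫ x, speedSq v t x := integral_nonneg (speedSq_nonneg v t)
  have g0 : 0 ≤ ∫ x, gradSq v t x := integral_nonneg (gradSq_nonneg v t)
  have h4 : ∀ i, ∫ x, v i t x ^ 4
      ≤ 2 * C * ((∫ x, speedSq v t x) * ((∫ x, speedSq v t x) + ∫ x, gradSq v t x)) := by
    intro i
    refine (h i).2.trans ?_
    have a1 : ∫ x, v i t x ^ 2 ≤ ∫ x, speedSq v t x :=
      integral_mono (is i) hs fun x => IsElasticFlow.sq_le_speedSq v t x i
    have a2 : ∀ l, ∫ x, pd l (v i t) x ^ 2 ≤ ∫ x, gradSq v t x := fun l =>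
      integral_mono (ig i l) hg fun x => IsElasticFlow.sq_le_gradSq v t x i l
    have a0 : 0 ≤ ∫ x, v i t x ^ 2 := integral_nonneg fun _ => sq_nonneg _
    have b0 : ∀ l, 0 ≤ ∫ x, pd l (v i t) x ^ 2 := fun l => integral_nonneg fun _ => sq_nonneg _
    rw [mul_comm 2 C, mul_assoc C]
    refine mul_le_mul_of_nonneg_left ?_ hC0
    calc _ ≤ (∫ x, speedSq v t x) * (2 * ((∫ x, speedSq v t x) + ∫ x, gradSq v t x)) :=
          mul_le_mul a1 (by linarith [a2 0, a2 1]) (add_nonneg a0 (add_nonneg (b0 0) (b0 1))) s0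
      _ = _ := by ring
  have i4 : Integrable fun x => 2 * (v 0 t x ^ 4 + v 1 t x ^ 4) :=
    ((h 0).1.add (h 1).1).const_mul 2
  have hpt : ∀ x, speedSq v t x ^ 2 ≤ 2 * (v 0 t x ^ 4 + v 1 t x ^ 4) := fun x => by
    simp only [speedSq, Fin.sum_univ_two]
    nlinarith [sq_nonneg (v 0 t x ^ 2 - v 1 t x ^ 2)]
  have is2 : Integrable fun x => speedSq v t x ^ 2 :=
    i4.mono' ((contDiff_slice (contDiff_speedSq H.smooth_v) t).pow
        2).continuous.aestronglyMeasurable (Eventually.of_forall fun x => by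
      rw [Real.norm_eq_abs, abs_of_nonneg (sq_nonneg _)]
      exact hpt x)
  have hs2 : ∫ x, speedSq v t x ^ 2
      ≤ 8 * C * ((∫ x, speedSq v t x) * ((∫ x, speedSq v t x) + ∫ x, gradSq v t x)) := by
    refine (integral_mono is2 i4 hpt).trans ?_
    rw [integral_const_mul, integral_add (h 0).1 (h 1).1]
    linarith [h4 0, h4 1]
  have j1 : Integrable fun x => speedSq v t x + speedSq v t x ^ 2 := hs.add is2
  have j2 : Integrable fun x => speedSq v t x + speedSq v t x ^ 2 + gradSq v t x := j1.add hg
  refine ⟨j2.add hn, ?_⟩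
  simp only [activity]
  rw [integral_add j2 hn, integral_add j1 hg, integral_add hs is2]
  linarith

namespace IsElasticFlow

theorem exists_strain_bound (H : IsElasticFlow T v E p) (hm : HasMoments T v E) (hT : 0 ≤ T) :
    ∃ M, 0 ≤ M ∧ ∀ t ∈ Set.Icc 0 T, ∫ x, strainSq E t x ≤ M := by
  obtain ⟨K, hK0, hK⟩ := exists_grad_cutoff_le
  set d : ℝ → ℝ := fun t => ∫ x, (1 + vnsq x) * gradSq v t x with hd
  have d0 : ∀ t, 0 ≤ d t := fun t => integral_nonneg fun x =>
    mul_nonneg (add_nonneg zero_le_one (vnsq_nonneg x)) (gradSq_nonneg v t x)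
  set g : ℝ → ℝ := fun t => 1 + 5 * d t with hg
  have g0 : ∀ t, 0 ≤ g t := fun t => by linarith [d0 t]
  have hgi : IntegrableOn g (Set.Ioc 0 T) :=
    (integrableOn_const (by simp)).add (hm.dissipation.const_mul 5)
  have hact : ∀ t ∈ Set.Icc 0 T, Integrable fun x => speedSq v t x + gradSq v t x :=
    fun t ht => (H.integrable_speedSq hm ht).add (H.integrable_gradSq hm ht)
  have hle : ∀ t ∈ Set.Icc 0 T, ∫ x, (speedSq v t x + gradSq v t x) ≤ g t ^ 2 := by
    intro t ht
    rw [integral_add (H.integrable_speedSq hm ht) (H.integrable_gradSq hm ht)]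
    have h1 := H.integral_speedSq_le hm ht
    have h2 := H.integral_gradSq_le hm ht
    have := d0 t
    simp only [hg]
    nlinarith
  have hK1 : ∀ n x, pd 0 (cutoff n) x ^ 2 + pd 1 (cutoff n) x ^ 2 ≤ K * cutoff n x := by
    intro n x
    refine (hK n x).trans ?_
    have : (((n : ℝ) + 1) ^ 2)⁻¹ ≤ 1 := inv_le_one_of_one_le₀ (by
      have : (0 : ℝ) ≤ n := n.cast_nonneg
      nlinarith)
    exact mul_le_mul_of_nonneg_right (mul_le_of_le_one_right hK0 this) (cutoff_nonneg n x)
  have h0T : (0 : ℝ) ∈ Set.Icc 0 T := ⟨le_rfl, hT⟩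
  have cn : ∀ t, Continuous (strainSq E t) := fun t =>
    (contDiff_slice (contDiff_strainSq H.smooth_E) t).continuous
  have ci : ∀ n t, Integrable fun x => cutoff n x * strainSq E t x := fun n t =>
    ((contDiff_cutoff n).continuous.mul (cn t)).integrable_of_hasCompactSupport
      (hasCompactSupport_cutoff n).mul_right
  set G := ∫ t in Set.Ioc 0 T, √(K + 24) * g t with hG
  refine ⟨2 * (∫ x, strainSq E 0 x) + 2 * G ^ 2, add_nonneg (mul_nonneg (by norm_num)
    (integral_nonneg (strainSq_nonneg E 0))) (by positivity), fun t ht => ?_⟩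
  refine (integral_le_of_tendsto (g := fun n x => cutoff n x * strainSq E t x)
    (cn t).aestronglyMeasurable (fun n => ci n t)
    (fun n x => mul_nonneg (cutoff_nonneg n x) (strainSq_nonneg E t x))
    (Eventually.of_forall fun x => ?_) fun n => ?_).2
  · simpa using (tendsto_cutoff x).mul_const (strainSq E t x)
  · have := sqrt_gronwall (y := fun t => ∫ x, cutoff n x * strainSq E t x) (D := fun _ => 0)
      (g := fun t => √(K + 24) * g t) (y₀ := ∫ x, cutoff n x * strainSq E 0 x) hT
      (continuous_integral_mul (contDiff_cutoff n).continuous (hasCompactSupport_cutoff n)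
        (contDiff_strainSq H.smooth_E).continuous).continuousOn
      (fun t _ => integral_nonneg fun x => mul_nonneg (cutoff_nonneg n x) (strainSq_nonneg E t x))
      (fun _ _ => le_rfl) (fun t => mul_nonneg (Real.sqrt_nonneg _) (g0 t)) (hgi.const_mul _) hG.ge
      (fun t ht => by
        rw [add_zero]
        exact H.strain_energy_le (contDiff_cutoff n) (hasCompactSupport_cutoff n) (cutoff_nonneg n)
          (cutoff_le_one n) hK0 (hK1 n) g0 hgi hact hle ht) ht
    rw [add_zero] at this
    refine this.trans ?_
    have h1 : ∫ x, cutoff n x * strainSq E 0 x ≤ ∫ x, strainSq E 0 x :=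
      integral_mono (ci n 0) (H.integrable_strainSq hm h0T) fun x =>
        mul_le_of_le_one_left (strainSq_nonneg E 0 x) (cutoff_le_one n x)
    linarith

end IsElasticFlow

end WeightedEstimate

section MomentBound

theorem integral_le_of_tendsto_of_le {α : Type*} [MeasurableSpace α] {μ : Measure α}
    {g : ℕ → α → ℝ} {h : α → ℝ} (hh : AEStronglyMeasurable h μ) (hi : ∀ n, Integrable (g n) μ)
    (h0 : ∀ n x, 0 ≤ g n x) (ht : ∀ᵐ x ∂μ, Tendsto (fun n => g n x) atTop (nhds (h x)))
    {m : ℕ → ℝ} {M : ℝ} (hm : Tendsto m atTop (nhds M)) (hM : ∀ n, ∫ x, g n x ∂μ ≤ m n) :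
    Integrable h μ ∧ ∫ x, h x ∂μ ≤ M := by
  have key : ∀ δ > 0, Integrable h μ ∧ ∫ x, h x ∂μ ≤ M + δ := by
    intro δ hδ
    obtain ⟨N, hN⟩ := eventually_atTop.1
      (hm.eventually (eventually_le_nhds (lt_add_of_pos_right M hδ)))
    exact integral_le_of_tendsto (g := fun n => g (n + N)) hh (fun n => hi _) (fun n => h0 _)
      (ht.mono fun x hx => hx.comp (tendsto_add_atTop_nat N))
      fun n => (hM _).trans (hN _ (Nat.le_add_left N n))
  exact ⟨(key 1 one_pos).1, le_of_forall_pos_le_add fun δ hδ => (key δ hδ).2⟩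

variable {T : ℝ} {v : Fin 2 → ℝ → V → ℝ} {E : Fin 2 → Fin 2 → ℝ → V → ℝ} {p : ℝ → V → ℝ}

/-- The weighted energy `∫ (1 + |x|²) (|u|² + |F - I|²)` at time zero. -/
def initialMoment (v : Fin 2 → ℝ → V → ℝ) (E : Fin 2 → Fin 2 → ℝ → V → ℝ) : ℝ :=
  ∫ x, (1 + vnsq x) * (speedSq v 0 x + strainSq E 0 x)

theorem initialMoment_nonneg (v : Fin 2 → ℝ → V → ℝ) (E : Fin 2 → Fin 2 → ℝ → V → ℝ) :
    0 ≤ initialMoment v E :=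
  integral_nonneg fun x => mul_nonneg (add_nonneg zero_le_one (vnsq_nonneg x))
    (add_nonneg (speedSq_nonneg v 0 x) (strainSq_nonneg E 0 x))

theorem HasMoments.integrable_energy (hm : HasMoments T v E) {t : ℝ} (ht : t ∈ Set.Icc 0 T) :
    Integrable fun x => (1 + vnsq x) * (speedSq v t x + strainSq E t x) := by
  simp only [mul_add]
  exact (hm.speed t ht).add (hm.strain t ht)

namespace IsElasticFlow

theorem continuous_energy (H : IsElasticFlow T v E p) (t : ℝ) :
    Continuous fun x => speedSq v t x + strainSq E t x :=
  (contDiff_slice (contDiff_speedSq H.smooth_v) t).continuous.add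
    (contDiff_slice (contDiff_strainSq H.smooth_E) t).continuous

theorem integral_energy_zero_le (H : IsElasticFlow T v E p) (hm : HasMoments T v E) (hT : 0 ≤ T)
    {φ : V → ℝ} (hφ : Continuous φ) (hc : HasCompactSupport φ) (h1 : ∀ x, φ x ≤ 1 + vnsq x) :
    ∫ x, φ x * (speedSq v 0 x + strainSq E 0 x) ≤ initialMoment v E :=
  integral_mono ((hφ.mul (H.continuous_energy 0)).integrable_of_hasCompactSupport hc.mul_right)
    (hm.integrable_energy ⟨le_rfl, hT⟩) fun x => mul_le_mul_of_nonneg_right (h1 x)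
      (add_nonneg (speedSq_nonneg v 0 x) (strainSq_nonneg E 0 x))

theorem energy_gronwall (H : IsElasticFlow T v E p) (hm : HasMoments T v E) (hT : 0 ≤ T)
    {φ : V → ℝ} (hφ : ContDiff ℝ ∞ φ) (hc : HasCompactSupport φ) (h0 : ∀ x, 0 ≤ φ x)
    (h1 : ∀ x, φ x ≤ 1 + vnsq x) {K : ℝ} (hK0 : 0 ≤ K)
    (hK : ∀ x, pd 0 φ x ^ 2 + pd 1 φ x ^ 2 ≤ K * φ x) {g : ℝ → ℝ} (hg : ∀ t, 0 ≤ g t)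
    (hgi : IntegrableOn g (Set.Ioc 0 T)) (hact : ∀ t ∈ Set.Icc 0 T, Integrable (activity v E t))
    (hle : ∀ t ∈ Set.Icc 0 T, ∫ x, activity v E t x ≤ g t ^ 2) {t : ℝ} (ht : t ∈ Set.Icc 0 T) :
    (∫ x, φ x * (speedSq v t x + strainSq E t x))
        + 2 * (∫ s in (0 : ℝ)..t, ∫ x, φ x * gradSq v s x)
      ≤ 2 * initialMoment v E + 20000 * K * (∫ s in Set.Ioc 0 T, g s) ^ 2 := by
  have hcont : Continuous fun t => ∫ x, φ x * (speedSq v t x + strainSq E t x) :=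
    continuous_integral_mul hφ.continuous hc
      (h := fun t x => speedSq v t x + strainSq E t x)
      ((contDiff_speedSq H.smooth_v).add (contDiff_strainSq H.smooth_E)).continuous
  have h := sqrt_gronwall (y := fun t => ∫ x, φ x * (speedSq v t x + strainSq E t x))
    (D := fun t => 2 * (∫ s in (0 : ℝ)..t, ∫ x, φ x * gradSq v s x))
    (g := fun t => 100 * √K * g t) (y₀ := ∫ x, φ x * (speedSq v 0 x + strainSq E 0 x))
    (G := 100 * √K * ∫ s in Set.Ioc 0 T, g s) hT hcont.continuousOn
    (fun t _ => integral_nonneg fun x => mul_nonneg (h0 x)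
      (add_nonneg (speedSq_nonneg v t x) (strainSq_nonneg E t x)))
    (fun t ht => mul_nonneg zero_le_two (intervalIntegral.integral_nonneg ht.1 fun s _ =>
      integral_nonneg fun x => mul_nonneg (h0 x) (gradSq_nonneg v s x)))
    (fun t => mul_nonneg (mul_nonneg (by norm_num) (Real.sqrt_nonneg _)) (hg t))
    (hgi.const_mul _) (integral_const_mul _ _).le
    (fun t ht => H.energy_le hφ hc h0 hK0 hK hg hgi hact hle ht) ht
  refine h.trans (add_le_add (mul_le_mul_of_nonneg_left
    (H.integral_energy_zero_le hm hT hφ.continuous hc h1) zero_le_two) (le_of_eq ?_))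
  rw [mul_pow, mul_pow, Real.sq_sqrt hK0]
  ring

theorem energy_cutoff_le (H : IsElasticFlow T v E p) (hm : HasMoments T v E) (hT : 0 ≤ T) :
    ∃ m : ℕ → ℝ, Tendsto m atTop (nhds (2 * initialMoment v E)) ∧ ∀ n, ∀ t ∈ Set.Icc 0 T,
      (∫ x, cutoff n x * (speedSq v t x + strainSq E t x))
        + 2 * (∫ s in (0 : ℝ)..t, ∫ x, cutoff n x * gradSq v s x) ≤ m n := by
  obtain ⟨K, hK0, hK⟩ := exists_grad_cutoff_le
  obtain ⟨C, hC0, hC⟩ := exists_activity_le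
  obtain ⟨M, hM0, hM⟩ := H.exists_strain_bound hm hT
  set d : ℝ → ℝ := fun t => ∫ x, (1 + vnsq x) * gradSq v t x with hd
  have d0 : ∀ t, 0 ≤ d t := fun t => integral_nonneg fun x =>
    mul_nonneg (add_nonneg zero_le_one (vnsq_nonneg x)) (gradSq_nonneg v t x)
  set g : ℝ → ℝ := fun t => √(5 + 20 * C + M) * (1 + d t) with hg
  have g0 : ∀ t, 0 ≤ g t := fun t => mul_nonneg (Real.sqrt_nonneg _) (by linarith [d0 t])
  have hgi : IntegrableOn g (Set.Ioc 0 T) :=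
    ((integrableOn_const (by simp)).add hm.dissipation).const_mul _
  have hle : ∀ t ∈ Set.Icc 0 T, ∫ x, activity v E t x ≤ g t ^ 2 := by
    intro t ht
    refine (hC T v E p H hm t ht).2.trans ?_
    have h1 := H.integral_speedSq_le hm ht
    have h2 := H.integral_gradSq_le hm ht
    have h3 := hM t ht
    have s0 : 0 ≤ ∫ x, speedSq v t x := integral_nonneg (speedSq_nonneg v t)
    have b0 : 0 ≤ ∫ x, gradSq v t x := integral_nonneg (gradSq_nonneg v t)
    have hd0 := d0 t
    have h4 : (∫ x, speedSq v t x) * ((∫ x, speedSq v t x) + ∫ x, gradSq v t x)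
        ≤ 4 * d t * (5 * d t) :=
      mul_le_mul h1 (by linarith) (add_nonneg s0 b0) (by positivity)
    have h5 := mul_le_mul_of_nonneg_left h4 hC0
    simp only [hg]
    rw [mul_pow, Real.sq_sqrt (by positivity)]
    have h6 := mul_nonneg hC0 hd0
    have h7 := mul_nonneg hM0 hd0
    have h8 := mul_nonneg hM0 (sq_nonneg (d t))
    nlinarith
  have hrate : Tendsto (fun n : ℕ => (((n : ℝ) + 1) ^ 2)⁻¹) atTop (nhds 0) := by
    have h := tendsto_one_div_add_atTop_nhds_zero_nat (𝕜 := ℝ)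
    have h2 := h.pow 2
    simpa using h2
  refine ⟨fun n => 2 * initialMoment v E
    + 20000 * (K * (((n : ℝ) + 1) ^ 2)⁻¹) * (∫ s in Set.Ioc 0 T, g s) ^ 2, ?_, fun n t ht => ?_⟩
  · simpa using ((((hrate.const_mul K).const_mul 20000).mul_const
      ((∫ s in Set.Ioc 0 T, g s) ^ 2)).const_add (2 * initialMoment v E))
  · exact H.energy_gronwall hm hT (contDiff_cutoff n) (hasCompactSupport_cutoff n)
      (cutoff_nonneg n) (fun x => (cutoff_le_one n x).trans (by linarith [vnsq_nonneg x]))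
      (mul_nonneg hK0 (by positivity)) (hK n) g0 hgi (fun t ht => (hC T v E p H hm t ht).1) hle ht

theorem integral_energy_le (H : IsElasticFlow T v E p) (hm : HasMoments T v E) {t : ℝ}
    (ht : t ∈ Set.Icc 0 T) :
    (∫ x, speedSq v t x) + ∫ x, strainSq E t x ≤ 2 * initialMoment v E := by
  obtain ⟨m, hmt, hmb⟩ := H.energy_cutoff_le hm (ht.1.trans ht.2)
  rw [← integral_add (H.integrable_speedSq hm ht) (H.integrable_strainSq hm ht)]
  refine (integral_le_of_tendsto_of_le
    (g := fun n x => cutoff n x * (speedSq v t x + strainSq E t x))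
    (H.continuous_energy t).aestronglyMeasurable
    (fun n => ((contDiff_cutoff n).continuous.mul
      (H.continuous_energy t)).integrable_of_hasCompactSupport
      (hasCompactSupport_cutoff n).mul_right)
    (fun n x => mul_nonneg (cutoff_nonneg n x)
      (add_nonneg (speedSq_nonneg v t x) (strainSq_nonneg E t x)))
    (Eventually.of_forall fun x => by
      simpa using (tendsto_cutoff x).mul_const (speedSq v t x + strainSq E t x)) hmt
    fun n => ?_).2
  have := hmb n t ht
  have h0 : 0 ≤ ∫ s in (0 : ℝ)..t, ∫ x, cutoff n x * gradSq v s x :=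
    intervalIntegral.integral_nonneg ht.1 fun s _ =>
      integral_nonneg fun x => mul_nonneg (cutoff_nonneg n x) (gradSq_nonneg v s x)
  linarith

theorem dissipation_le (H : IsElasticFlow T v E p) (hm : HasMoments T v E) (hT : 0 ≤ T) :
    IntegrableOn (fun t => ∫ x, gradSq v t x) (Set.Ioc 0 T) ∧
      ∫ t in Set.Ioc 0 T, ∫ x, gradSq v t x ≤ initialMoment v E := by
  obtain ⟨m, hmt, hmb⟩ := H.energy_cutoff_le hm hT
  have hcg : Continuous (Function.uncurry (gradSq v)) := (contDiff_gradSq H.smooth_v).continuous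
  have hlim : Tendsto (fun n => m n / 2) atTop (nhds (initialMoment v E)) := by
    simpa using hmt.div_const 2
  refine integral_le_of_tendsto_of_le (g := fun n t => ∫ x, cutoff n x * gradSq v t x)
    (hcg.stronglyMeasurable.integral_prod_right (ν := volume)).aestronglyMeasurable
    (fun n => ((continuous_integral_mul (contDiff_cutoff n).continuous
      (hasCompactSupport_cutoff n) hcg).integrableOn_Icc (a := 0) (b := T)).mono_set
      Set.Ioc_subset_Icc_self)
    (fun n t => integral_nonneg fun x => mul_nonneg (cutoff_nonneg n x) (gradSq_nonneg v t x))
    ((ae_restrict_iff' measurableSet_Ioc).2 (Eventually.of_forall fun t ht => ?_)) hlim fun n => ?_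
  · have cg : Continuous (gradSq v t) := (contDiff_slice (contDiff_gradSq H.smooth_v) t).continuous
    refine tendsto_integral_of_dominated_convergence (gradSq v t)
      (fun n => ((contDiff_cutoff n).continuous.mul cg).aestronglyMeasurable)
      (H.integrable_gradSq hm (Set.Ioc_subset_Icc_self ht))
      (fun n => Eventually.of_forall fun x => ?_) (Eventually.of_forall fun x => ?_)
    · rw [Real.norm_eq_abs, abs_of_nonneg (mul_nonneg (cutoff_nonneg n x) (gradSq_nonneg v t x))]
      exact mul_le_of_le_one_left (gradSq_nonneg v t x) (cutoff_le_one n x)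
    · simpa using (tendsto_cutoff x).mul_const (gradSq v t x)
  · have h := hmb n T ⟨hT, le_rfl⟩
    rw [intervalIntegral.integral_of_le hT] at h
    have h0 : 0 ≤ ∫ x, cutoff n x * (speedSq v T x + strainSq E T x) :=
      integral_nonneg fun x => mul_nonneg (cutoff_nonneg n x)
        (add_nonneg (speedSq_nonneg v T x) (strainSq_nonneg E T x))
    linarith

end IsElasticFlow

theorem exists_moment_bound {T : ℝ} (hT : 0 < T) : ∃ M, 0 < M ∧
    ∀ (v : Fin 2 → ℝ → V → ℝ) (E : Fin 2 → Fin 2 → ℝ → V → ℝ) (p : ℝ → V → ℝ),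
      IsElasticFlow T v E p → HasMoments T v E → initialMoment v E ≤ 1 → ∀ t ∈ Set.Icc 0 T,
        ∫ x, (1 + vnsq x) * speedSq v t x ≤ M * initialMoment v E := by
  obtain ⟨K, hK0, hK⟩ := exists_grad_wcutoff_le
  obtain ⟨C, hC0, hC⟩ := exists_activity_le
  refine ⟨2 + 20000 * K * (T * ((4 + 4 * C) * (T + 1))), by positivity,
    fun v E p H hm h1 t ht => ?_⟩
  set ε := initialMoment v E with hε
  have ε0 : 0 ≤ ε := initialMoment_nonneg v E
  obtain ⟨hBi, hB⟩ := H.dissipation_le hm hT.le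
  set B : ℝ → ℝ := fun t => ∫ x, gradSq v t x with hBdef
  have B0 : ∀ t, 0 ≤ B t := fun t => integral_nonneg (gradSq_nonneg v t)
  set q : ℝ → ℝ := fun t => (4 + 4 * C) * (ε + B t) with hq
  have q0 : ∀ t, 0 ≤ q t := fun t =>
    mul_nonneg (by positivity) (add_nonneg ε0 (B0 t))
  have hconst : ∀ c : ℝ, IntegrableOn (fun _ : ℝ => c) (Set.Ioc 0 T) := fun c =>
    integrableOn_const (by simp)
  have hqi : IntegrableOn q (Set.Ioc 0 T) := ((hconst ε).add hBi).const_mul _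
  have hqB : ∫ t in Set.Ioc 0 T, q t ≤ (4 + 4 * C) * (T + 1) * ε := by
    simp only [hq]
    rw [integral_const_mul, integral_add (hconst ε) hBi, setIntegral_const, mul_assoc]
    refine mul_le_mul_of_nonneg_left ?_ (by positivity)
    simp only [Real.volume_real_Ioc_of_le hT.le, smul_eq_mul]
    linarith
  have hgi : IntegrableOn (fun t => √(q t)) (Set.Ioc 0 T) := by
    refine ((hconst 1).add hqi).mono'
      (Real.continuous_sqrt.comp_aestronglyMeasurable hqi.aestronglyMeasurable)
      (Eventually.of_forall fun t => ?_)
    rw [Real.norm_eq_abs, abs_of_nonneg (Real.sqrt_nonneg _)]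
    simp only [Pi.add_apply]
    nlinarith [Real.sq_sqrt (q0 t), sq_nonneg (√(q t) - 1), q0 t]
  have hG : (∫ t in Set.Ioc 0 T, √(q t)) ^ 2 ≤ T * ((4 + 4 * C) * (T + 1)) * ε := by
    have h := abs_integral_le_sqrt_mul_sqrt (μ := volume.restrict (Set.Ioc 0 T))
      (f := fun t => √(q t)) (A := fun _ => 1) (B := q) (hconst 1) hqi (fun _ => zero_le_one) q0
      fun t => by rw [one_mul, Real.sq_sqrt (q0 t)]
    rw [← sq_abs]
    refine (pow_le_pow_left₀ (abs_nonneg _) h 2).trans ?_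
    rw [mul_pow, Real.sq_sqrt (integral_nonneg fun _ => zero_le_one),
      Real.sq_sqrt (integral_nonneg q0), setIntegral_const, mul_assoc]
    simp only [Real.volume_real_Ioc_of_le hT.le, smul_eq_mul, sub_zero, mul_one]
    exact mul_le_mul_of_nonneg_left hqB hT.le
  have hle : ∀ t ∈ Set.Icc 0 T, ∫ x, activity v E t x ≤ √(q t) ^ 2 := by
    intro t ht
    rw [Real.sq_sqrt (q0 t)]
    refine (hC T v E p H hm t ht).2.trans ?_
    have h2 := H.integral_energy_le hm ht
    have s0 : 0 ≤ ∫ x, speedSq v t x := integral_nonneg (speedSq_nonneg v t)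
    have n0 : 0 ≤ ∫ x, strainSq E t x := integral_nonneg (strainSq_nonneg E t)
    have b0 := B0 t
    have h4 : (∫ x, speedSq v t x) * ((∫ x, speedSq v t x) + ∫ x, gradSq v t x)
        ≤ 2 * (2 * ε + B t) :=
      mul_le_mul (by linarith) (by linarith) (add_nonneg s0 b0) zero_le_two
    have h5 := mul_le_mul_of_nonneg_left h4 hC0
    simp only [hq]
    have h6 := mul_nonneg hC0 b0
    have h7 : (∫ x, gradSq v t x) = B t := rfl
    rw [h7] at h5 ⊢
    nlinarith
  have c1 : Continuous fun x => (1 + vnsq x) * speedSq v t x :=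
    (continuous_const.add contDiff_vnsq.continuous).mul
      (contDiff_slice (contDiff_speedSq H.smooth_v) t).continuous
  have cs : Continuous (speedSq v t) := (contDiff_slice (contDiff_speedSq H.smooth_v) t).continuous
  have ci : ∀ n, Integrable fun x => wcutoff n x * speedSq v t x := fun n =>
    ((contDiff_wcutoff n).continuous.mul cs).integrable_of_hasCompactSupport
      (hasCompactSupport_wcutoff n).mul_right
  refine (integral_le_of_tendsto (g := fun n x => wcutoff n x * speedSq v t x)
    c1.aestronglyMeasurable ci
    (fun n x => mul_nonneg (wcutoff_nonneg n x) (speedSq_nonneg v t x))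
    (Eventually.of_forall fun x => by
      simpa [wcutoff] using ((tendsto_cutoff x).const_mul (1 + vnsq x)).mul_const (speedSq v t x))
    fun n => ?_).2
  have h := H.energy_gronwall hm hT.le (contDiff_wcutoff n) (hasCompactSupport_wcutoff n)
    (wcutoff_nonneg n) (wcutoff_le n) hK0 (hK n) (fun t => Real.sqrt_nonneg (q t)) hgi
    (fun t ht => (hC T v E p H hm t ht).1) hle ht
  have h0 : 0 ≤ ∫ s in (0 : ℝ)..t, ∫ x, wcutoff n x * gradSq v s x :=
    intervalIntegral.integral_nonneg ht.1 fun s _ =>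
      integral_nonneg fun x => mul_nonneg (wcutoff_nonneg n x) (gradSq_nonneg v s x)
  have h2 : ∫ x, wcutoff n x * speedSq v t x
      ≤ ∫ x, wcutoff n x * (speedSq v t x + strainSq E t x) :=
    integral_mono (ci n) (((contDiff_wcutoff n).continuous.mul
      (H.continuous_energy t)).integrable_of_hasCompactSupport
      (hasCompactSupport_wcutoff n).mul_right) fun x =>
      mul_le_mul_of_nonneg_left (by linarith [strainSq_nonneg E t x]) (wcutoff_nonneg n x)
  have h3 := mul_le_mul_of_nonneg_left hG (show 0 ≤ 20000 * K by positivity)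
  linarith

end MomentBound

section Reformulation

variable {u : ℝ → V → V} {F : ℝ → V → M2} {P : ℝ → V → ℝ} {T : ℝ}

/-- The components of a velocity field. -/
def velocity (u : ℝ → V → V) (i : Fin 2) (t : ℝ) (x : V) : ℝ := u t x i

/-- The components of the strain `F - I`. -/
def strain (F : ℝ → V → M2) (i k : Fin 2) (t : ℝ) (x : V) : ℝ := F t x i k - idM i k

theorem speedSq_velocity (u : ℝ → V → V) (t : ℝ) (x : V) :
    speedSq (velocity u) t x = vnsq (u t x) := rfl

theorem strainSq_strain (F : ℝ → V → M2) (t : ℝ) (x : V) :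
    strainSq (strain F) t x = nsq (F t x - idM) := rfl

theorem contDiff_velocity (hu : ContDiff ℝ ∞ (Function.uncurry u)) (i : Fin 2) :
    ContDiff ℝ ∞ (Function.uncurry (velocity u i)) :=
  contDiff_pi.1 hu i

theorem contDiff_entry (hF : ContDiff ℝ ∞ (Function.uncurry F)) (i k : Fin 2) :
    ContDiff ℝ ∞ (Function.uncurry fun t x => F t x i k) :=
  contDiff_pi.1 (contDiff_pi.1 hF i) k

theorem contDiff_strain (hF : ContDiff ℝ ∞ (Function.uncurry F)) (i k : Fin 2) :
    ContDiff ℝ ∞ (Function.uncurry (strain F i k)) :=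
  (contDiff_entry hF i k).sub contDiff_const

theorem pd_strain (F : ℝ → V → M2) (i k l : Fin 2) (t : ℝ) (x : V) :
    pd l (strain F i k t) x = pd l (fun y => F t y i k) x := by
  simp only [pd]
  congr 1
  exact fderiv_sub_const _

theorem mul_transpose_eq_stress (F : ℝ → V → M2) (i j : Fin 2) (t : ℝ) (x : V) :
    ∑ k, F t x i k * F t x j k = stress (strain F) i j t x + idM i j := by
  fin_cases i <;> fin_cases j <;> simp [stress, strain, idM] <;> ring

theorem isElasticFlow (hu : ContDiff ℝ ∞ (Function.uncurry u))
    (hF : ContDiff ℝ ∞ (Function.uncurry F)) (hP : ContDiff ℝ ∞ (Function.uncurry P))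
    (hs : IsSolution u F P T)
    (hdiv : ∀ t ∈ Set.Icc (0 : ℝ) T, ∀ (x : V) (j : Fin 2), ∑ i, pd i (fun y => F t y i j) x = 0)
    (hle : ∀ t ∈ Set.Icc (0 : ℝ) T, ∀ x : V, nsq (F t x - idM) ≤ 1 / 4) :
    IsElasticFlow T (velocity u) (strain F) P where
  smooth_v := contDiff_velocity hu
  smooth_E := contDiff_strain hF
  smooth_p := hP
  momentum t ht x i := by
    have h := hs.1 t ht x i
    have e : ∀ j, pd j (fun y => ∑ k, F t y i k * F t y j k) x
        = pd j (stress (strain F) i j t) x := fun j => by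
      simp only [mul_transpose_eq_stress, pd]
      congr 1
      exact fderiv_add_const _
    simp only [e] at h
    have e' : deriv (fun s => u s x i) t + (∑ j, u t x j * pd j (fun y => u t y i) x)
        + pd i (P t) x = lap (fun y => u t y i) x + ∑ j, pd j (stress (strain F) i j t) x := by
      linarith
    exact e'
  transport t ht x i k := by
    have h := hs.2.1 t ht x i k
    have e : deriv (fun s => strain F i k s x) t = deriv (fun s => F s x i k) t :=
      deriv_sub_const _
    simp only [pd_strain, e]
    refine h.trans ?_
    change _ = (∑ l, pd l (fun y => u t y i) x * strain F l k t x) + pd k (fun y => u t y i) x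
    fin_cases k <;> simp [strain, idM] <;> ring
  div_free := hs.2.2
  div_strain t ht x k := by simpa only [pd_strain] using hdiv t ht x k
  strain_le := hle

end Reformulation

/-- Lemma 3.2: for every `T > 0` there is a constant `M(T)`,
depending only on `T`, with `sup_{0≤t≤T} ∫ (1+|x|²)|u(x,t)|² dx ≤ M(T) ε₀`. -/
theorem statement_8 :
    ∀ T : ℝ, 0 < T →
      ∃ M : ℝ, 0 < M ∧
        ∀ (u : ℝ → V → V) (F : ℝ → V → M2) (P : ℝ → V → ℝ),
          ContDiff ℝ (⊤ : ℕ∞) (Function.uncurry u) →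
          ContDiff ℝ (⊤ : ℕ∞) (Function.uncurry F) →
          ContDiff ℝ (⊤ : ℕ∞) (Function.uncurry P) →
          IsSolution u F P T →
          (∀ t ∈ Set.Icc (0:ℝ) T, ∀ (x : V) (j : Fin 2),
            ∑ i, pd i (fun y => F t y i j) x = 0) →
          (∀ t ∈ Set.Icc (0:ℝ) T, ∀ x : V, Matrix.det (Matrix.of (F t x)) = 1) →
          (∀ t ∈ Set.Icc (0:ℝ) T, ∀ x : V, nsq (F t x - idM) ≤ 1/4) →
          (∀ t ∈ Set.Icc (0:ℝ) T,
            Integrable (fun x : V => (1 + vnsq x) * vnsq (u t x)) ∧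
            Integrable (fun x : V => (1 + vnsq x) * nsq (F t x - idM)) ∧
            Integrable (fun x : V => (1 + vnsq x) * nsq (gradU (u t) x)) ∧
            Integrable (fun x : V => vnsq (u t x)) ∧
            Integrable (fun x : V => nsq (gradU (u t) x))) →
          IntegrableOn (fun t => ∫ x : V, (1 + vnsq x) * nsq (gradU (u t) x))
            (Set.Ioc (0:ℝ) T) →
          Integrable (fun x : V =>
            (nsq (F 0 x - idM) + vnsq (u 0 x)) * (1 + vnsq x)) →
          eps0 (u 0) (F 0) ≤ 1 →
          (⨆ t ∈ Set.Icc (0:ℝ) T, ∫ x : V, (1 + vnsq x) * vnsq (u t x))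
            ≤ M * eps0 (u 0) (F 0) := by
  intro T hT
  obtain ⟨M, hM0, hM⟩ := exists_moment_bound hT
  refine ⟨M, hM0, fun u F P hu hF hP hs hdiv _ hle hintg hdis hini heps => ?_⟩
  have H := isElasticFlow hu hF hP hs hdiv hle
  have hm : HasMoments T (velocity u) (strain F) :=
    ⟨fun t ht => (hintg t ht).1, fun t ht => (hintg t ht).2.1, fun t ht => (hintg t ht).2.2.1, hdis⟩
  have hmom : initialMoment (velocity u) (strain F)
      = ∫ x : V, (nsq (F 0 x - idM) + vnsq (u 0 x)) * (1 + vnsq x) :=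
    integral_congr_ae (Eventually.of_forall fun x => by
      simp only [speedSq_velocity, strainSq_strain]
      ring)
  have hmle : initialMoment (velocity u) (strain F) ≤ eps0 (u 0) (F 0) := by
    rw [hmom, eps0]
    refine le_add_of_nonneg_left (Real.iSup_nonneg fun x => ?_)
    exact strainSq_nonneg (strain F) 0 x
  have h0 : 0 ≤ M * eps0 (u 0) (F 0) :=
    mul_nonneg hM0.le ((initialMoment_nonneg _ _).trans hmle)
  refine Real.iSup_le (fun t => Real.iSup_le (fun ht => ?_) h0) h0
  exact (hM _ _ P H hm (hmle.trans heps) t ht).trans (mul_le_mul_of_nonneg_left hmle hM0.le)
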